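/- Let F be an algebraically closed field of characteristic 0 and let Q be a maximal finite abelian subgroup of Aut(𝔢₈) containing an element of order 4 of type I (i.e. an order-4 automorphism whose fixed subalgebra has dimension 66). Then Q also contains an element φ of order 4 whose fixed subalgebra 𝔢₈^φ has dimension 60 (i.e. an order-4 automorphism of type II). -/

import Mathlib

open LieAlgebra

/-- The group of automorphisms of a Lie algebra, realized as the subgroup of the group
of linear automorphisms consisting of those preserving the bracket. -/
def lieAut (R L : Type*) [CommRing R] [LieRing L] [LieAlgebra R L] :
    Subgroup (L ≃ₗ[R] L) where
  carrier := {e | ∀ x y : L, e ⁅x, y⁆ = ⁅e x, e y⁆}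
  one_mem' := fun _ _ => rfl
  mul_mem' := by
    intro f g hf hg x y
    show f (g ⁅x, y⁆) = _
    rw [hg]
    exact hf _ _
  inv_mem' := by
    intro f hf x y
    apply f.injective
    show f (f.symm ⁅x, y⁆) = f ⁅f.symm x, f.symm y⁆
    rw [hf (f.symm x) (f.symm y), f.apply_symm_apply, f.apply_symm_apply, f.apply_symm_apply]

/-- The subalgebra of fixed points of an automorphism of a Lie algebra. -/
def fixedSubalgebra {R L : Type*} [CommRing R] [LieRing L] [LieAlgebra R L]
    (θ : lieAut R L) : LieSubalgebra R L where
  carrier := {x | (θ : L ≃ₗ[R] L) x = x}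
  add_mem' := by
    intro a b ha hb
    simp only [Set.mem_setOf_eq] at *
    rw [map_add, ha, hb]
  zero_mem' := map_zero _
  smul_mem' := by
    intro c a ha
    simp only [Set.mem_setOf_eq] at *
    rw [map_smul, ha]
  lie_mem' := by
    intro a b ha hb
    simp only [Set.mem_setOf_eq] at *
    rw [θ.2 a b, ha, hb]

/-- A maximal finite abelian subgroup: a finite abelian subgroup which is maximal among
all abelian subgroups. -/
def IsMaximalFiniteAbelian {G : Type*} [Group G] (Q : Subgroup G) : Prop :=
  Finite Q ∧ (∀ a b, a ∈ Q → b ∈ Q → a * b = b * a) ∧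
    ∀ Q' : Subgroup G, (∀ a b, a ∈ Q' → b ∈ Q' → a * b = b * a) → Q ≤ Q' → Q' = Q

/-- Two subgroups are conjugate. -/
def SubgroupIsConj {G : Type*} [Group G] (Q₁ Q₂ : Subgroup G) : Prop :=
  ∃ g : G, Q₂ = Q₁.map (MulAut.conj g).toMonoidHom


namespace E8P

/-- The root lattice in simple root coordinates. -/
abbrev V := Fin 8 → ℤ

/-- The `E₈` form. -/
def Bf (v w : V) : ℤ :=
  2 * (v 0 * w 0 + v 1 * w 1 + v 2 * w 2 + v 3 * w 3 + v 4 * w 4 + v 5 * w 5 + v 6 * w 6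
    + v 7 * w 7)
  - (v 0 * w 2 + v 2 * w 0) - (v 2 * w 3 + v 3 * w 2) - (v 3 * w 4 + v 4 * w 3)
  - (v 4 * w 5 + v 5 * w 4) - (v 5 * w 6 + v 6 * w 5) - (v 6 * w 7 + v 7 * w 6)
  - (v 1 * w 3 + v 3 * w 1)

lemma Bf_comm (v w : V) : Bf v w = Bf w v := by unfold Bf; ring
lemma Bf_add_left (u v w : V) : Bf (u + v) w = Bf u w + Bf v w := by
  simp only [Bf, Pi.add_apply]; ring
lemma Bf_add_right (u v w : V) : Bf w (u + v) = Bf w u + Bf w v := by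
  simp only [Bf, Pi.add_apply]; ring
lemma Bf_sub_left (u v w : V) : Bf (u - v) w = Bf u w - Bf v w := by
  simp only [Bf, Pi.sub_apply]; ring
lemma Bf_sub_right (u v w : V) : Bf w (u - v) = Bf w u - Bf w v := by
  simp only [Bf, Pi.sub_apply]; ring
lemma Bf_neg_left (v w : V) : Bf (-v) w = - Bf v w := by
  simp only [Bf, Pi.neg_apply]; ring
lemma Bf_neg_right (v w : V) : Bf w (-v) = - Bf w v := by
  simp only [Bf, Pi.neg_apply]; ring
lemma Bf_smul_left (k : ℤ) (v w : V) : Bf (k • v) w = k * Bf v w := by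
  simp only [Bf, Pi.smul_apply, smul_eq_mul]; ring
lemma Bf_smul_right (k : ℤ) (v w : V) : Bf w (k • v) = k * Bf w v := by
  simp only [Bf, Pi.smul_apply, smul_eq_mul]; ring
lemma Bf_zero_left (w : V) : Bf 0 w = 0 := by simp [Bf]
lemma Bf_zero_right (w : V) : Bf w 0 = 0 := by simp [Bf]

lemma Bf_sq (v : V) : 60 * Bf v v = 30 * (2 * v 0 - v 2) ^ 2 + 10 * (3 * v 2 - 2 * v 3) ^ 2
    + 30 * (2 * v 1 - v 3) ^ 2 + 30 * (2 * v 7 - v 6) ^ 2 + 10 * (3 * v 6 - 2 * v 5) ^ 2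
    + 5 * (4 * v 5 - 3 * v 4) ^ 2 + 3 * (5 * v 4 - 4 * v 3) ^ 2 + 2 * v 3 ^ 2 := by
  unfold Bf; ring

lemma Bf_nonneg (v : V) : 0 ≤ Bf v v := by
  have := Bf_sq v
  nlinarith [sq_nonneg (2 * v 0 - v 2), sq_nonneg (3 * v 2 - 2 * v 3), sq_nonneg (2 * v 1 - v 3),
    sq_nonneg (2 * v 7 - v 6), sq_nonneg (3 * v 6 - 2 * v 5), sq_nonneg (4 * v 5 - 3 * v 4),
    sq_nonneg (5 * v 4 - 4 * v 3), sq_nonneg (v 3)]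

lemma eq_zero_of_Bf (v : V) (h : Bf v v = 0) : v = 0 := by
  have := Bf_sq v
  rw [h] at this
  have h1 := sq_nonneg (2 * v 0 - v 2)
  have h2 := sq_nonneg (3 * v 2 - 2 * v 3)
  have h3 := sq_nonneg (2 * v 1 - v 3)
  have h4 := sq_nonneg (2 * v 7 - v 6)
  have h5 := sq_nonneg (3 * v 6 - 2 * v 5)
  have h6 := sq_nonneg (4 * v 5 - 3 * v 4)
  have h7 := sq_nonneg (5 * v 4 - 4 * v 3)
  have h8 := sq_nonneg (v 3)
  have e1 : 2 * v 0 - v 2 = 0 := pow_eq_zero_iff (two_ne_zero) |>.1 (by linarith)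
  have e2 : 3 * v 2 - 2 * v 3 = 0 := pow_eq_zero_iff (two_ne_zero) |>.1 (by linarith)
  have e3 : 2 * v 1 - v 3 = 0 := pow_eq_zero_iff (two_ne_zero) |>.1 (by linarith)
  have e4 : 2 * v 7 - v 6 = 0 := pow_eq_zero_iff (two_ne_zero) |>.1 (by linarith)
  have e5 : 3 * v 6 - 2 * v 5 = 0 := pow_eq_zero_iff (two_ne_zero) |>.1 (by linarith)
  have e6 : 4 * v 5 - 3 * v 4 = 0 := pow_eq_zero_iff (two_ne_zero) |>.1 (by linarith)
  have e7 : 5 * v 4 - 4 * v 3 = 0 := pow_eq_zero_iff (two_ne_zero) |>.1 (by linarith)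
  have e8 : v 3 = 0 := pow_eq_zero_iff (two_ne_zero) |>.1 (by linarith)
  funext i
  fin_cases i <;> simp <;> omega

lemma Bf_even (v : V) : ∃ k, Bf v v = 2 * k := by
  refine ⟨(v 0 * v 0 + v 1 * v 1 + v 2 * v 2 + v 3 * v 3 + v 4 * v 4 + v 5 * v 5 + v 6 * v 6
    + v 7 * v 7) - (v 0 * v 2) - (v 2 * v 3) - (v 3 * v 4)
  - (v 4 * v 5) - (v 5 * v 6) - (v 6 * v 7) - (v 1 * v 3), ?_⟩
  unfold Bf; ring

lemma Bf_pos (v : V) (h : v ≠ 0) : 2 ≤ Bf v v := by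
  have h1 := Bf_nonneg v
  have h2 : Bf v v ≠ 0 := fun h' => h (eq_zero_of_Bf v h')
  obtain ⟨k, hk⟩ := Bf_even v
  omega

/-- simple roots -/
def sr (i : Fin 8) : V := Pi.single i 1

/-- marks of the highest root -/
def hi : V := ![2, 3, 4, 6, 5, 4, 3, 2]

lemma Bf_sr (i : Fin 8) : Bf (sr i) (sr i) = 2 := by revert i; decide +kernel

lemma sum_sr (v : V) : v = ∑ i, v i • sr i := by
  funext j; simp [sr, Finset.sum_apply, Pi.single_apply]

lemma Bf_sum_left {ι : Type*} (s : Finset ι) (f : ι → V) (w : V) :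
    Bf (∑ i ∈ s, f i) w = ∑ i ∈ s, Bf (f i) w := by
  classical
  induction s using Finset.induction_on with
  | empty => simp [Bf_zero_left]
  | insert a s ha ih => rw [Finset.sum_insert ha, Finset.sum_insert ha, Bf_add_left, ih]

lemma Bf_expand (v w : V) : Bf v w = ∑ i, v i * Bf (sr i) w := by
  conv_lhs => rw [sum_sr v]
  rw [Bf_sum_left]
  exact Finset.sum_congr rfl fun i _ => Bf_smul_left _ _ _

/-- reflection -/
def rf (a v : V) : V := v - Bf a v • a

lemma Bf_rf (a : V) (ha : Bf a a = 2) (v w : V) : Bf (rf a v) (rf a w) = Bf v w := by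
  simp only [rf, Bf_sub_left, Bf_sub_right, Bf_smul_left, Bf_smul_right, ha, Bf_comm v a]
  ring

lemma rf_rf (a : V) (ha : Bf a a = 2) (v : V) : rf a (rf a v) = v := by
  simp only [rf, Bf_sub_right, Bf_smul_right, ha, sub_smul, mul_smul]
  module

lemma rf_add (a v w : V) : rf a (v + w) = rf a v + rf a w := by
  simp only [rf, Bf_add_right]; module

/-- reflections as additive equivalences -/
def rfE (a : V) (ha : Bf a a = 2) : V ≃+ V where
  toFun := rf a
  invFun := rf a
  left_inv := rf_rf a ha
  right_inv := rf_rf a ha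
  map_add' := rf_add a

/-- Sign lemma. -/
lemma root_sign (v : V) (h : Bf v v = 2) : 0 ≤ v ∨ v ≤ 0 := by
  set p : V := v ⊔ 0
  set n : V := (-v) ⊔ 0
  have hv : v = p - n := by
    funext i; simp only [p, n, Pi.sub_apply, Pi.sup_apply, Pi.zero_apply, Pi.neg_apply]; omega
  have hpn : ∀ i, p i * n i = 0 := by
    intro i; simp only [p, n, Pi.sup_apply, Pi.zero_apply, Pi.neg_apply]
    rcases le_total (v i) 0 with h | h
    · rw [sup_eq_right.2 h, zero_mul]
    · rw [sup_eq_right.2 (by omega : - v i ≤ 0), mul_zero]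
  have hp : ∀ i, 0 ≤ p i := fun i => by simp [p]
  have hn : ∀ i, 0 ≤ n i := fun i => by simp [n]
  have hle : Bf p n ≤ 0 := by
    have := fun i j => mul_nonneg (hp i) (hn j)
    unfold Bf
    linarith [hpn 0, hpn 1, hpn 2, hpn 3, hpn 4, hpn 5, hpn 6, hpn 7, this 0 2, this 2 0, this 2 3,
      this 3 2, this 3 4, this 4 3, this 4 5, this 5 4, this 5 6, this 6 5, this 6 7, this 7 6,
      this 1 3, this 3 1]
  by_cases hp0 : p = 0
  · right
    rw [hv, hp0]; intro i; simpa using hn i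
  by_cases hn0 : n = 0
  · left
    rw [hv, hn0]; intro i; simpa using hp i
  have h1 := Bf_pos p hp0
  have h2 := Bf_pos n hn0
  rw [hv, Bf_sub_left, Bf_sub_right, Bf_sub_right, Bf_comm n p] at h
  omega

/-- Two roots: the Cartan integer is at most `1` unless they are equal. -/
lemma Bf_le_one (v w : V) (hv : Bf v v = 2) (hw : Bf w w = 2) (h : v ≠ w) : Bf v w ≤ 1 := by
  have := Bf_pos (v - w) (sub_ne_zero.2 h)
  rw [Bf_sub_left, Bf_sub_right, Bf_sub_right, Bf_comm w v, hv, hw] at this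
  omega

/-- A nonzero nonnegative vector pairs positively with some simple root in its support. -/
lemma exists_pos_sr (v : V) (hv : 0 ≤ v) (h0 : v ≠ 0) : ∃ i, 0 < v i ∧ 0 < Bf (sr i) v := by
  by_contra hc
  push Not at hc
  have h1 := Bf_pos v h0
  rw [Bf_expand] at h1
  have : ∑ i, v i * Bf (sr i) v ≤ 0 := by
    apply Finset.sum_nonpos
    intro i _
    rcases (hv i).lt_or_eq with h | h
    · exact mul_nonpos_of_nonneg_of_nonpos (hv i) (hc i h)
    · have : v i = 0 := h.symm
      simp [this]
  omega

/-- conversion from lists -/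
def toV (l : List ℤ) : V := fun i => l.getD i 0

/-- coordinates of the positive roots -/
def posL : List (List ℤ) := [
  [0,0,0,0,0,0,0,1],
  [0,0,0,0,0,0,1,0],
  [0,0,0,0,0,1,0,0],
  [0,0,0,0,1,0,0,0],
  [0,0,0,1,0,0,0,0],
  [0,0,1,0,0,0,0,0],
  [0,1,0,0,0,0,0,0],
  [1,0,0,0,0,0,0,0],
  [0,0,0,0,0,0,1,1],
  [0,0,0,0,0,1,1,0],
  [0,0,0,0,1,1,0,0],
  [0,0,0,1,1,0,0,0],
  [0,0,1,1,0,0,0,0],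
  [0,1,0,1,0,0,0,0],
  [1,0,1,0,0,0,0,0],
  [0,0,0,0,0,1,1,1],
  [0,0,0,0,1,1,1,0],
  [0,0,0,1,1,1,0,0],
  [0,0,1,1,1,0,0,0],
  [0,1,0,1,1,0,0,0],
  [0,1,1,1,0,0,0,0],
  [1,0,1,1,0,0,0,0],
  [0,0,0,0,1,1,1,1],
  [0,0,0,1,1,1,1,0],
  [0,0,1,1,1,1,0,0],
  [0,1,0,1,1,1,0,0],
  [0,1,1,1,1,0,0,0],
  [1,0,1,1,1,0,0,0],
  [1,1,1,1,0,0,0,0],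
  [0,0,0,1,1,1,1,1],
  [0,0,1,1,1,1,1,0],
  [0,1,0,1,1,1,1,0],
  [0,1,1,1,1,1,0,0],
  [0,1,1,2,1,0,0,0],
  [1,0,1,1,1,1,0,0],
  [1,1,1,1,1,0,0,0],
  [0,0,1,1,1,1,1,1],
  [0,1,0,1,1,1,1,1],
  [0,1,1,1,1,1,1,0],
  [0,1,1,2,1,1,0,0],
  [1,0,1,1,1,1,1,0],
  [1,1,1,1,1,1,0,0],
  [1,1,1,2,1,0,0,0],
  [0,1,1,1,1,1,1,1],
  [0,1,1,2,1,1,1,0],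
  [0,1,1,2,2,1,0,0],
  [1,0,1,1,1,1,1,1],
  [1,1,1,1,1,1,1,0],
  [1,1,1,2,1,1,0,0],
  [1,1,2,2,1,0,0,0],
  [0,1,1,2,1,1,1,1],
  [0,1,1,2,2,1,1,0],
  [1,1,1,1,1,1,1,1],
  [1,1,1,2,1,1,1,0],
  [1,1,1,2,2,1,0,0],
  [1,1,2,2,1,1,0,0],
  [0,1,1,2,2,1,1,1],
  [0,1,1,2,2,2,1,0],
  [1,1,1,2,1,1,1,1],
  [1,1,1,2,2,1,1,0],
  [1,1,2,2,1,1,1,0],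
  [1,1,2,2,2,1,0,0],
  [0,1,1,2,2,2,1,1],
  [1,1,1,2,2,1,1,1],
  [1,1,1,2,2,2,1,0],
  [1,1,2,2,1,1,1,1],
  [1,1,2,2,2,1,1,0],
  [1,1,2,3,2,1,0,0],
  [0,1,1,2,2,2,2,1],
  [1,1,1,2,2,2,1,1],
  [1,1,2,2,2,1,1,1],
  [1,1,2,2,2,2,1,0],
  [1,1,2,3,2,1,1,0],
  [1,2,2,3,2,1,0,0],
  [1,1,1,2,2,2,2,1],
  [1,1,2,2,2,2,1,1],
  [1,1,2,3,2,1,1,1],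
  [1,1,2,3,2,2,1,0],
  [1,2,2,3,2,1,1,0],
  [1,1,2,2,2,2,2,1],
  [1,1,2,3,2,2,1,1],
  [1,1,2,3,3,2,1,0],
  [1,2,2,3,2,1,1,1],
  [1,2,2,3,2,2,1,0],
  [1,1,2,3,2,2,2,1],
  [1,1,2,3,3,2,1,1],
  [1,2,2,3,2,2,1,1],
  [1,2,2,3,3,2,1,0],
  [1,1,2,3,3,2,2,1],
  [1,2,2,3,2,2,2,1],
  [1,2,2,3,3,2,1,1],
  [1,2,2,4,3,2,1,0],
  [1,1,2,3,3,3,2,1],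
  [1,2,2,3,3,2,2,1],
  [1,2,2,4,3,2,1,1],
  [1,2,3,4,3,2,1,0],
  [1,2,2,3,3,3,2,1],
  [1,2,2,4,3,2,2,1],
  [1,2,3,4,3,2,1,1],
  [2,2,3,4,3,2,1,0],
  [1,2,2,4,3,3,2,1],
  [1,2,3,4,3,2,2,1],
  [2,2,3,4,3,2,1,1],
  [1,2,2,4,4,3,2,1],
  [1,2,3,4,3,3,2,1],
  [2,2,3,4,3,2,2,1],
  [1,2,3,4,4,3,2,1],
  [2,2,3,4,3,3,2,1],
  [1,2,3,5,4,3,2,1],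
  [2,2,3,4,4,3,2,1],
  [1,3,3,5,4,3,2,1],
  [2,2,3,5,4,3,2,1],
  [2,2,4,5,4,3,2,1],
  [2,3,3,5,4,3,2,1],
  [2,3,4,5,4,3,2,1],
  [2,3,4,6,4,3,2,1],
  [2,3,4,6,5,3,2,1],
  [2,3,4,6,5,4,2,1],
  [2,3,4,6,5,4,3,1],
  [2,3,4,6,5,4,3,2]]

/-- Boolean check that the list is closed under going up. -/
lemma posL_up : ∀ u ∈ posL, ∀ i : Fin 8, Bf (sr i) (toV u) = -1 →
    ∃ w ∈ posL, ∀ j, toV w j = toV u j + sr i j := by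
  decide +kernel

lemma posL_sr : ∀ i : Fin 8, ∃ w ∈ posL, ∀ j, toV w j = sr i j := by decide +kernel

lemma posL_root : ∀ u ∈ posL, Bf (toV u) (toV u) = 2 := by decide +kernel

lemma posL_nonneg : ∀ u ∈ posL, ∀ j, 0 ≤ toV u j := by decide +kernel

lemma posL_le : ∀ u ∈ posL, ∀ j, toV u j ≤ hi j := by decide +kernel

/-- height -/
def ht (v : V) : ℤ := ∑ i, v i

lemma ht_sr (i : Fin 8) : ht (sr i) = 1 := by simp [ht, sr]
lemma ht_add (v w : V) : ht (v + w) = ht v + ht w := by simp [ht, Finset.sum_add_distrib]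
lemma ht_sub (v w : V) : ht (v - w) = ht v - ht w := by simp [ht]
lemma ht_neg (v : V) : ht (-v) = - ht v := by simp [ht]
lemma ht_smul (k : ℤ) (v : V) : ht (k • v) = k * ht v := by simp [ht, Finset.mul_sum]
lemma ht_nonneg (v : V) (h : 0 ≤ v) : 0 ≤ ht v := Finset.sum_nonneg fun i _ => h i
lemma ht_pos (v : V) (h : 0 ≤ v) (h0 : v ≠ 0) : 0 < ht v := by
  rcases (ht_nonneg v h).lt_or_eq with h1 | h1
  · exact h1
  · exfalso; apply h0
    have := (Finset.sum_eq_zero_iff_of_nonneg (fun i _ => h i)).1 h1.symm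
    funext i; exact this i (Finset.mem_univ i)

lemma root_ne_zero (v : V) (h : Bf v v = 2) : v ≠ 0 := by
  rintro rfl; rw [Bf_zero_left] at h; omega

/-- A positive nonsimple root is a simple root plus a positive root. -/
lemma pos_root_split (v : V) (h : Bf v v = 2) (hv : 0 ≤ v) :
    (∃ i, v = sr i) ∨ ∃ i, Bf (v - sr i) (v - sr i) = 2 ∧ 0 ≤ v - sr i ∧
      Bf (sr i) (v - sr i) = -1 := by
  obtain ⟨i, hi, hB⟩ := exists_pos_sr v hv (root_ne_zero v h)
  by_cases hs : sr i = v
  · exact Or.inl ⟨i, hs.symm⟩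
  right
  have h1 := Bf_le_one (sr i) v (Bf_sr i) h hs
  have h2 : Bf (sr i) v = 1 := by omega
  refine ⟨i, ?_, ?_, ?_⟩
  · rw [Bf_sub_left, Bf_sub_right, Bf_sub_right, Bf_comm v (sr i), Bf_sr, h, h2]; norm_num
  · intro j
    by_cases hj : j = i
    · subst hj; simp [sr]; omega
    · simp [sr, hj]; exact hv j
  · rw [Bf_sub_right, Bf_sr, h2]; norm_num

lemma pos_mem (n : ℕ) : ∀ v : V, Bf v v = 2 → 0 ≤ v → ht v ≤ n → ∃ l ∈ posL, toV l = v := by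
  induction n with
  | zero =>
    intro v h hv hn
    have := ht_pos v hv (root_ne_zero v h)
    simp at hn; omega
  | succ n ih =>
    intro v h hv hn
    rcases pos_root_split v h hv with ⟨i, rfl⟩ | ⟨i, h1, h2, h3⟩
    · obtain ⟨w, hw, hw'⟩ := posL_sr i
      exact ⟨w, hw, funext hw'⟩
    · obtain ⟨l, hl, hl'⟩ := ih (v - sr i) h1 h2 (by rw [ht_sub, ht_sr]; push_cast at hn; omega)
      obtain ⟨w, hw, hw'⟩ := posL_up l hl i (by rw [hl']; exact h3)
      refine ⟨w, hw, funext fun j => ?_⟩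
      rw [hw' j, hl']; simp

/-- the list of all roots -/
def rtL : List V := posL.map toV ++ posL.map (fun l => - toV l)

lemma mem_rtL (v : V) : v ∈ rtL ↔ Bf v v = 2 := by
  simp only [rtL, List.mem_append, List.mem_map]
  constructor
  · rintro (⟨l, hl, rfl⟩ | ⟨l, hl, rfl⟩)
    · exact posL_root l hl
    · rw [Bf_neg_left, Bf_neg_right, posL_root l hl]; norm_num
  · intro h
    rcases root_sign v h with hv | hv
    · obtain ⟨l, hl⟩ := pos_mem (ht v).toNat v h hv (by simp)
      exact Or.inl ⟨l, hl⟩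
    · obtain ⟨l, hl, hl'⟩ := pos_mem (ht (-v)).toNat (-v) (by
        rw [Bf_neg_left, Bf_neg_right, h]; norm_num) (by simpa using hv) (by simp)
      exact Or.inr ⟨l, hl, by rw [hl', neg_neg]⟩

/-- The finite set of roots. -/
def Rt : Finset V := rtL.toFinset

lemma mem_Rt (v : V) : v ∈ Rt ↔ Bf v v = 2 := by rw [Rt, List.mem_toFinset, mem_rtL]

lemma nodup_code : (rtL.map (fun v => v 0 + 13 * (v 1 + 13 * (v 2 + 13 * (v 3 + 13 * (v 4 + 13 *
    (v 5 + 13 * (v 6 + 13 * v 7)))))))).Nodup := by decide +kernel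

lemma rtL_nodup : rtL.Nodup := nodup_code.of_map _

lemma card_filter (p : V → Prop) [DecidablePred p] :
    (Rt.filter p).card = rtL.countP (fun v => decide (p v)) := by
  have : Rt.filter p = (rtL.filter (fun v => decide (p v))).toFinset := by
    ext v; simp [Rt]
  rw [this, List.toFinset_card_of_nodup (rtL_nodup.filter _), List.countP_eq_length_filter]

lemma card_Rt : Rt.card = 240 := by
  rw [Rt, List.toFinset_card_of_nodup rtL_nodup]; decide +kernel

end E8P

set_option linter.unusedSectionVars false

namespace E8P
open LieAlgebra

section Serre
variable (F : Type) [Field F] [CharZero F]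

/-- the quotient map -/
noncomputable def qm : FreeLieAlgebra F (CartanMatrix.Generators (Fin 8)) →ₗ⁅F⁆ e₈ F where
  toFun x := (LieSubmodule.Quotient.mk x :
    FreeLieAlgebra F _ ⧸ CartanMatrix.Relations.toIdeal F CartanMatrix.E₈)
  map_add' _ _ := rfl
  map_smul' _ _ := rfl
  map_lie' := rfl

lemma qm_surj : Function.Surjective (qm F) := Quotient.mk_surjective

lemma qm_rel (x) (hx : x ∈ CartanMatrix.Relations.toSet F CartanMatrix.E₈) : qm F x = 0 := by
  have : x ∈ CartanMatrix.Relations.toIdeal F CartanMatrix.E₈ := LieSubmodule.subset_lieSpan hx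
  exact (LieSubmodule.Quotient.mk_eq_zero _).2 this

/-- generators -/
noncomputable def gh (i : Fin 8) : e₈ F := qm F (FreeLieAlgebra.of F (.H i))
/-- generators -/
noncomputable def ge (i : Fin 8) : e₈ F := qm F (FreeLieAlgebra.of F (.E i))
/-- generators -/
noncomputable def gf (i : Fin 8) : e₈ F := qm F (FreeLieAlgebra.of F (.F i))

lemma E8_eq (i j : Fin 8) : CartanMatrix.E₈ i j = Bf (sr i) (sr j) := by
  have : ∀ i j : Fin 8, (CartanMatrix.E₈ i j : ℤ) = Bf (sr i) (sr j) := by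
    intro i j
    fin_cases i <;> fin_cases j <;> rfl
  exact this i j

lemma spread (P : Fin 8 → Prop) (h : ∀ j k, CartanMatrix.E₈ j k ≠ 0 → P j → P k) (i : Fin 8)
    (hi : P i) : ∀ j, P j := by
  have e : ∀ j k, Bf (sr j) (sr k) ≠ 0 → (P j ↔ P k) := fun j k hh =>
      ⟨fun a => h j k (by rw [E8_eq]; exact hh) a, fun a => h k j (by
        rw [E8_eq, Bf_comm]; exact hh) a⟩
  have e1 := e 0 2 (by decide +kernel)
  have e2 := e 2 3 (by decide +kernel)
  have e3 := e 3 4 (by decide +kernel)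
  have e4 := e 4 5 (by decide +kernel)
  have e5 := e 5 6 (by decide +kernel)
  have e6 := e 6 7 (by decide +kernel)
  have e7 := e 1 3 (by decide +kernel)
  have h3 : P 3 := by
    fin_cases i <;> simp at hi <;> tauto
  intro j
  fin_cases j <;> simp <;> tauto

lemma g_hh (i j) : ⁅gh F i, gh F j⁆ = 0 := by
  have := qm_rel F (CartanMatrix.Relations.HH F (i, j)) (by
    simp only [CartanMatrix.Relations.toSet]; simp)
  simpa [CartanMatrix.Relations.HH, gh, -LieSubmodule.Quotient.mk'_apply] using this

lemma g_ef (i) : ⁅ge F i, gf F i⁆ = gh F i := by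
  have := qm_rel F (CartanMatrix.Relations.EF F (i, i)) (by
    simp only [CartanMatrix.Relations.toSet]; simp)
  simpa [CartanMatrix.Relations.EF, gh, ge, gf, sub_eq_zero] using this

lemma g_ef_ne (i j) (hij : i ≠ j) : ⁅ge F i, gf F j⁆ = 0 := by
  have := qm_rel F (CartanMatrix.Relations.EF F (i, j)) (by
    simp only [CartanMatrix.Relations.toSet]; simp)
  simpa [CartanMatrix.Relations.EF, gh, ge, gf, hij] using this

lemma g_he (i j) : ⁅gh F i, ge F j⁆ = CartanMatrix.E₈ i j • ge F j := by
  have := qm_rel F (CartanMatrix.Relations.HE F CartanMatrix.E₈ (i, j)) (by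
    simp only [CartanMatrix.Relations.toSet]; simp)
  simp only [CartanMatrix.Relations.HE, Function.uncurry_apply_pair, map_sub, map_zsmul,
    LieHom.map_lie, sub_eq_zero] at this
  exact this

lemma g_hf (i j) : ⁅gh F i, gf F j⁆ = - CartanMatrix.E₈ i j • gf F j := by
  have := qm_rel F (CartanMatrix.Relations.HF F CartanMatrix.E₈ (i, j)) (by
    simp only [CartanMatrix.Relations.toSet]; simp)
  simp only [CartanMatrix.Relations.HF, Function.uncurry_apply_pair, map_add, map_zsmul,
    LieHom.map_lie] at this
  rw [neg_smul]
  exact eq_neg_of_add_eq_zero_left this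

lemma qm_ad_pow (x y) (n : ℕ) : qm F (((ad F _ x) ^ n) y) = ((ad F _ (qm F x)) ^ n) (qm F y) := by
  induction n with
  | zero => rfl
  | succ n ih => rw [pow_succ', pow_succ', Module.End.mul_apply, Module.End.mul_apply, ← ih]; simp

lemma g_adE (i j) : ∃ n : ℕ, ((ad F _ (ge F i)) ^ n) (ge F j) = 0 := by
  have := qm_rel F (CartanMatrix.Relations.adE F CartanMatrix.E₈ (i, j)) (by
    simp only [CartanMatrix.Relations.toSet]; simp)
  simp only [CartanMatrix.Relations.adE, Function.uncurry_apply_pair, qm_ad_pow,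
    LieHom.map_lie] at this
  refine ⟨(-CartanMatrix.E₈ i j).toNat + 1, ?_⟩
  rw [pow_succ, Module.End.mul_apply]
  exact this

lemma g_adF (i j) : ∃ n : ℕ, ((ad F _ (gf F i)) ^ n) (gf F j) = 0 := by
  have := qm_rel F (CartanMatrix.Relations.adF F CartanMatrix.E₈ (i, j)) (by
    simp only [CartanMatrix.Relations.toSet]; simp)
  simp only [CartanMatrix.Relations.adF, Function.uncurry_apply_pair, qm_ad_pow,
    LieHom.map_lie] at this
  refine ⟨(-CartanMatrix.E₈ i j).toNat + 1, ?_⟩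
  rw [pow_succ, Module.End.mul_apply]
  exact this

lemma g_span : LieSubalgebra.lieSpan F (e₈ F) (Set.range (ge F) ∪ Set.range (gf F)) = ⊤ := by
  set S := LieSubalgebra.lieSpan F (e₈ F) (Set.range (ge F) ∪ Set.range (gf F))
  have hE : ∀ i, ge F i ∈ S := fun i => LieSubalgebra.subset_lieSpan (Or.inl ⟨i, rfl⟩)
  have hF : ∀ i, gf F i ∈ S := fun i => LieSubalgebra.subset_lieSpan (Or.inr ⟨i, rfl⟩)
  let φ : CartanMatrix.Generators (Fin 8) → S := fun g => match g with
    | .H i => ⟨gh F i, by rw [← g_ef]; exact S.lie_mem (hE i) (hF i)⟩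
    | .E i => ⟨ge F i, hE i⟩
    | .F i => ⟨gf F i, hF i⟩
  have key : S.incl.comp (FreeLieAlgebra.lift F φ) = qm F := by
    apply FreeLieAlgebra.hom_ext
    intro g
    simp only [Function.comp, LieHom.comp_apply, FreeLieAlgebra.lift_of_apply]
    rcases g with i | i | i <;> rfl
  rw [eq_top_iff]
  intro x _
  obtain ⟨y, rfl⟩ := qm_surj F x
  rw [← key]
  exact (FreeLieAlgebra.lift F φ y).2

lemma g_ne [Nontrivial (e₈ F)] (i : Fin 8) : gh F i ≠ 0 := by
  -- vanishing spreads along the diagram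
  have h0 : ∀ j, gh F j = 0 → ∀ k, CartanMatrix.E₈ j k ≠ 0 → gh F k = 0 := by
    intro j hj k hk
    have h1 := g_he F j k
    rw [hj, zero_lie] at h1
    have : ge F k = 0 := by
      rw [eq_comm, ← Int.cast_smul_eq_zsmul F, smul_eq_zero] at h1
      exact h1.resolve_left (by exact_mod_cast hk)
    rw [← g_ef, this, zero_lie]
  intro hi
  have hall : ∀ j, gh F j = 0 := spread (fun j => gh F j = 0) (fun j k h1 h2 => h0 j h2 k h1) i hi
  have hE : ∀ j, ge F j = 0 := by
    intro j
    have h1 := g_he F j j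
    rw [hall j, zero_lie] at h1
    rw [eq_comm, ← Int.cast_smul_eq_zsmul F, smul_eq_zero] at h1
    refine h1.resolve_left ?_
    rw [E8_eq, Bf_sr]; norm_num
  have hF : ∀ j, gf F j = 0 := by
    intro j
    have h1 := g_hf F j j
    rw [hall j, zero_lie] at h1
    rw [eq_comm, ← Int.cast_smul_eq_zsmul F, smul_eq_zero] at h1
    refine h1.resolve_left ?_
    rw [E8_eq, Bf_sr]; norm_num
  have : (⊤ : LieSubalgebra F (e₈ F)) ≤ ⊥ := by
    rw [← g_span, LieSubalgebra.lieSpan_le]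
    rintro _ (⟨j, rfl⟩ | ⟨j, rfl⟩)
    · rw [hE]; exact zero_mem _
    · rw [hF]; exact zero_mem _
  obtain ⟨x, hx⟩ := exists_ne (0 : e₈ F)
  exact hx ((LieSubalgebra.mem_bot x).1 (this trivial))

lemma ge_ne [Nontrivial (e₈ F)] (i : Fin 8) : ge F i ≠ 0 := fun h => g_ne F i (by
  rw [← g_ef, h, zero_lie])

end Serre

/-- The form is nondegenerate over any field of characteristic zero. -/
lemma sr_solve {F : Type*} [Field F] (c : Fin 8 → F)
    (h : ∀ j, ∑ i, c i * (Bf (sr i) (sr j) : F) = 0) : c = 0 := by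
  have e : ∀ i j, (Bf (sr i) (sr j) : F) = ((CartanMatrix.E₈ i j : ℤ) : F) := fun i j => by
    rw [E8_eq]
  simp only [e] at h
  have h0 := h 0
  have h1 := h 1
  have h2 := h 2
  have h3 := h 3
  have h4 := h 4
  have h5 := h 5
  have h6 := h 6
  have h7 := h 7
  simp [CartanMatrix.E₈, Fin.sum_univ_eight] at h0 h1 h2 h3 h4 h5 h6 h7
  funext i
  fin_cases i <;> simp
  · linear_combination 4*h0+5*h1+7*h2+10*h3+8*h4+6*h5+4*h6+2*h7
  · linear_combination 5*h0+8*h1+10*h2+15*h3+12*h4+9*h5+6*h6+3*h7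
  · linear_combination 7*h0+10*h1+14*h2+20*h3+16*h4+12*h5+8*h6+4*h7
  · linear_combination 10*h0+15*h1+20*h2+30*h3+24*h4+18*h5+12*h6+6*h7
  · linear_combination 8*h0+12*h1+16*h2+24*h3+20*h4+15*h5+10*h6+5*h7
  · linear_combination 6*h0+9*h1+12*h2+18*h3+15*h4+12*h5+8*h6+4*h7
  · linear_combination 4*h0+6*h1+8*h2+12*h3+10*h4+8*h5+6*h6+3*h7
  · linear_combination 2*h0+3*h1+4*h2+6*h3+5*h4+4*h5+3*h6+2*h7

section Serre2
variable (F : Type) [Field F] [CharZero F]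

/-- The Chevalley basis of the Serre Lie algebra. -/
noncomputable def gB [Nontrivial (e₈ F)] :
    LieAlgebra.Basis (Fin 8) (LieSubalgebra.lieSpan F (e₈ F) (Set.range (gh F))) where
  A := CartanMatrix.E₈
  h := gh F
  e := ge F
  f := gf F
  cartan_eq_lieSpan := rfl
  span_ef := g_span F
  linInd := by
    rw [Fintype.linearIndependent_iff]
    intro c hc
    have : c = 0 := by
      apply sr_solve
      intro j
      have h1 : ⁅∑ i, c i • gh F i, ge F j⁆ = (∑ i, c i * (Bf (sr i) (sr j) : F)) • ge F j := by
        rw [sum_lie, Finset.sum_smul]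
        refine Finset.sum_congr rfl fun i _ => ?_
        rw [smul_lie, g_he, ← Int.cast_smul_eq_zsmul F, smul_smul, E8_eq]
      rw [hc, zero_lie] at h1
      exact (smul_eq_zero.1 h1.symm).resolve_right (ge_ne F j)
    exact fun i => congrFun this i
  nondegen := by
    apply Matrix.nondegenerate_of_det_ne_zero
    rw [CartanMatrix.E₈_det]; exact one_ne_zero
  sl2 i := {
    h_ne_zero := g_ne F i
    lie_e_f := g_ef F i
    lie_h_e_nsmul := by
      rw [g_he, E8_eq, Bf_sr]; exact ofNat_zsmul _ _
    lie_h_f_nsmul := by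
      rw [g_hf, E8_eq, Bf_sr, neg_smul]; rw [ofNat_zsmul] }
  lie_h_h := g_hh F
  lie_h_e i j := by rw [g_he, E8_eq, E8_eq, Bf_comm]
  lie_h_f i j := by rw [g_hf, E8_eq, E8_eq, Bf_comm]
  lie_e_f_ne := g_ef_ne F

end Serre2
end E8P

set_option linter.unusedSectionVars false

namespace E8P
open LieAlgebra

lemma iSupIndep_eq_of_le {ι F L : Type*} [Field F] [AddCommGroup L] [Module F L]
    (W M : ι → Submodule F L) (hW : iSupIndep W) (hM : ∀ i, M i ≤ W i) (ht : ⨆ i, M i = ⊤) (i : ι) :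
    M i = W i := by
  classical
  refine le_antisymm (hM i) fun x hx => ?_
  have h1 : x ∈ M i ⊔ ⨆ (j) (_ : j ≠ i), M j := by
    have : (⊤ : Submodule F L) ≤ M i ⊔ ⨆ (j) (_ : j ≠ i), M j := by
      rw [← ht]
      refine iSup_le fun j => ?_
      by_cases hj : j = i
      · subst hj; exact le_sup_left
      · exact le_sup_of_le_right (le_iSup₂_of_le j hj le_rfl)
    exact this trivial
  obtain ⟨a, ha, c, hc, rfl⟩ := Submodule.mem_sup.1 h1
  have h2 : c ∈ W i := by simpa using sub_mem hx (hM i ha)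
  have h3 : c ∈ ⨆ (j) (_ : j ≠ i), W j :=
    (iSup₂_mono fun j _ => hM j : _ ≤ ⨆ (j) (_ : j ≠ i), W j) hc
  have : c = 0 := (Submodule.disjoint_def.1 (hW i)) c h2 h3
  simpa [this] using ha

/-- sl2 injectivity: if `x` has weight `m ≥ 0`, `e` acts nilpotently on `x` and `f ^ m x = 0`
then `x = 0`. -/
lemma sl2_inj {F L : Type*} [Field F] [CharZero F] [LieRing L] [LieAlgebra F L] {h e f : L}
    (t : IsSl2Triple h e f) (k : ℕ) : ∀ (m : ℕ) (x : L), ⁅h, x⁆ = (m : F) • x →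
    ((ad F L e) ^ k) x = 0 → ((ad F L f) ^ m) x = 0 → x = 0 := by
  have step : ∀ (n : ℕ) (c : F) (x : L), ⁅h, x⁆ = c • x → ((ad F L f) ^ n) x = 0 →
      ((ad F L f) ^ (n + 1)) ⁅e, x⁆ = 0 := by
    have com : ∀ (n : ℕ) (c : F) (x : L), ⁅h, x⁆ = c • x → ∃ d : F,
        ((ad F L f) ^ (n + 1)) ⁅e, x⁆ = ⁅e, ((ad F L f) ^ (n + 1)) x⁆ + d • ((ad F L f) ^ n) x := by
      intro n
      induction n with
      | zero =>
        intro c x hx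
        refine ⟨-c, ?_⟩
        have : ⁅f, ⁅e, x⁆⁆ = ⁅e, ⁅f, x⁆⁆ - ⁅h, x⁆ := by
          rw [← t.lie_e_f, lie_lie]; abel
        simp [this, hx, sub_eq_add_neg]
      | succ n ih =>
        intro c x hx
        have hfx : ⁅h, ⁅f, x⁆⁆ = (c - 2) • ⁅f, x⁆ := by
          rw [leibniz_lie, hx, t.lie_lie_smul_f F]; simp [sub_smul]; abel
        obtain ⟨d, hd⟩ := ih (c - 2) ⁅f, x⁆ hfx
        refine ⟨d - c, ?_⟩
        have : ⁅f, ⁅e, x⁆⁆ = ⁅e, ⁅f, x⁆⁆ - ⁅h, x⁆ := by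
          rw [← t.lie_e_f, lie_lie]; abel
        have e1 : ∀ (n : ℕ) y, ((ad F L f) ^ (n + 1)) y = ((ad F L f) ^ n) ⁅f, y⁆ := fun n y => by
          rw [pow_succ]; rfl
        rw [e1 (n + 1) ⁅e, x⁆, this, map_sub, hd, hx, map_smul, e1 (n + 1) x, e1 n x, sub_smul]
        abel
    intro n c x hx h0
    obtain ⟨d, hd⟩ := com n c x hx
    rw [hd, h0, pow_succ', Module.End.mul_apply, h0]; simp
  have steps : ∀ (j n : ℕ) (c : F) (x : L), ⁅h, x⁆ = c • x → ((ad F L f) ^ n) x = 0 →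
      ((ad F L f) ^ (n + j)) (((ad F L e) ^ j) x) = 0 := by
    intro j
    induction j with
    | zero => intro n c x _ h0; simpa using h0
    | succ j ih =>
      intro n c x hx h0
      have hex : ⁅h, ⁅e, x⁆⁆ = (c + 2) • ⁅e, x⁆ := by
        rw [leibniz_lie, hx, t.lie_h_e_smul F]; simp [add_smul]; abel
      have := ih (n + 1) (c + 2) ⁅e, x⁆ hex (step n c x hx h0)
      rw [pow_succ (ad F L e), Module.End.mul_apply]
      rw [show n + (j + 1) = n + 1 + j by ring]
      exact this
  induction k with
  | zero => intro m x _ h0 _; simpa using h0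
  | succ k ih =>
    intro m x hx hk hm
    refine ih m x hx ?_ hm
    by_contra hne
    have P : t.HasPrimitiveVectorWith (((ad F L e) ^ k) x) ((m + 2 * k : ℕ) : F) :=
      { ne_zero := hne
        lie_h := by
          have := t.lie_h_pow_toEnd_e (R := F) hx k
          push_cast
          exact this
        lie_e := by
          rw [pow_succ', Module.End.mul_apply] at hk
          exact hk }
    exact P.pow_toEnd_f_ne_zero_of_eq_nat rfl (i := m + k) (by omega) (steps k m m x hx hm)

variable {F L : Type*} [Field F] [CharZero F] [LieRing L] [LieAlgebra F L] {H : LieSubalgebra F L}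
  (b : LieAlgebra.Basis (Fin 8) H)

/-- `E₈` Serre data -/
structure IsS : Prop where
  hA : ∀ i j, b.A i j = Bf (sr i) (sr j)
  adE : ∀ i j, ∃ n : ℕ, ((ad F L (b.e i)) ^ n) (b.e j) = 0
  adF : ∀ i j, ∃ n : ℕ, ((ad F L (b.f i)) ^ n) (b.f j) = 0

/-- weight spaces -/
def W (l : V) : Submodule F L where
  carrier := {x | ∀ i, ⁅b.h i, x⁆ = (Bf (sr i) l : F) • x}
  add_mem' := by intro x y hx hy i; rw [lie_add, hx i, hy i, smul_add]
  zero_mem' := by intro i; simp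
  smul_mem' := by intro c x hx i; rw [lie_smul, hx i, smul_comm]

lemma mem_W {l : V} {x : L} : x ∈ W b l ↔ ∀ i, ⁅b.h i, x⁆ = (Bf (sr i) l : F) • x := Iff.rfl

lemma lie_W {l m : V} {x y : L} (hx : x ∈ W b l) (hy : y ∈ W b m) : ⁅x, y⁆ ∈ W b (l + m) := by
  intro i
  rw [leibniz_lie, hx i, hy i, Bf_add_right]
  push_cast
  rw [smul_lie, lie_smul, add_smul]

lemma W_indep : iSupIndep (W b) := by
  have h1 := Module.End.independent_iInf_maxGenEigenspace_of_forall_mapsTo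
    (fun i : Fin 8 => ad F L (b.h i)) (by
      intro i j φ
      apply Module.End.mapsTo_maxGenEigenspace_of_comm
      refine LinearMap.ext fun x => ?_
      change ⁅b.h j, ⁅b.h i, x⁆⁆ = ⁅b.h i, ⁅b.h j, x⁆⁆
      rw [leibniz_lie, b.lie_h_h, zero_lie, zero_add])
  have inj : Function.Injective (fun (l : V) (i : Fin 8) => (Bf (sr i) l : F)) := by
    intro l m hlm
    have : (fun i => ((l i : F) - m i)) = 0 := by
      apply sr_solve
      intro j
      have := congrFun hlm j
      simp only at this
      rw [Bf_comm, Bf_expand, Bf_comm _ m, Bf_expand m] at this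
      push_cast at this
      simp only [sub_mul, Finset.sum_sub_distrib]
      rw [this, sub_self]
    funext i
    have := congrFun this i
    simp only [Pi.zero_apply, sub_eq_zero] at this
    exact_mod_cast this
  refine (h1.comp inj).mono fun l x hx => ?_
  simp only [Function.comp, Submodule.mem_iInf]
  intro i
  refine Module.End.mem_maxGenEigenspace _ _ _ |>.2 ⟨1, ?_⟩
  simp [hx i]

variable {b} (hb : IsS b)
include hb

lemma e_mem (i) : b.e i ∈ W b (sr i) := fun j => by
  rw [b.lie_h_e, hb.hA, Bf_comm, Int.cast_smul_eq_zsmul]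
lemma f_mem (i) : b.f i ∈ W b (- sr i) := fun j => by
  rw [b.lie_h_f, hb.hA, Bf_comm, Bf_neg_right, Int.cast_smul_eq_zsmul]

lemma engel_e (i : Fin 8) (x : L) : ∃ n : ℕ, ((ad F L (b.e i)) ^ n) x = 0 := by
  have : (⊤ : LieSubalgebra F L) ≤ LieSubalgebra.engel F (b.e i) := by
    rw [← b.span_ef, LieSubalgebra.lieSpan_le]
    rintro _ (⟨j, rfl⟩ | ⟨j, rfl⟩)
    · exact (LieSubalgebra.mem_engel_iff F _ _).2 (hb.adE i j)
    · refine (LieSubalgebra.mem_engel_iff F _ _).2 ?_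
      by_cases hij : i = j
      · subst hij
        refine ⟨3, ?_⟩
        have h2 := b.lie_h_e i i
        simp only [pow_succ, pow_zero, one_mul, Module.End.mul_apply, ad_apply, (b.sl2 i).lie_e_f]
        rw [← lie_skew (b.e i) (b.h i), h2]; simp
      · exact ⟨1, by simp [b.lie_e_f_ne i j hij]⟩
  exact (LieSubalgebra.mem_engel_iff F _ _).1 (this trivial)

lemma IsS.symm : IsS b.symm := ⟨hb.hA, hb.adF, hb.adE⟩

lemma engel_f (i : Fin 8) (x : L) : ∃ n : ℕ, ((ad F L (b.f i)) ^ n) x = 0 :=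
  engel_e hb.symm i x

omit hb in
lemma W_symm (l : V) : W b.symm l = W b (-l) := by
  ext x
  simp only [mem_W, LieAlgebra.Basis.symm_h, Pi.neg_apply, neg_lie, Bf_neg_right, Int.cast_neg,
    neg_smul]
  exact forall_congr' fun i => neg_eq_iff_eq_neg

lemma f_pow_mem {l : V} {x : L} (hx : x ∈ W b l) (i : Fin 8) (n : ℕ) :
    ((ad F L (b.f i)) ^ n) x ∈ W b (l - (n : ℤ) • sr i) := by
  induction n with
  | zero => simpa using hx
  | succ n ih =>
    rw [pow_succ', Module.End.mul_apply]
    have := lie_W b (f_mem hb i) ih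
    rw [show l - ((n + 1 : ℕ) : ℤ) • sr i = - sr i + (l - (n : ℤ) • sr i) by push_cast; module]
    exact this

lemma f_inj {l : V} (i : Fin 8) (n : ℕ) (hl : Bf (sr i) l = n) {x : L} (hx : x ∈ W b l)
    (h0 : ((ad F L (b.f i)) ^ n) x = 0) : x = 0 := by
  obtain ⟨k, hk⟩ := engel_e hb i x
  exact sl2_inj (b.sl2 i) k n x (by rw [hx i, hl]; simp) hk h0

lemma exists_W_rf_aux {l : V} (i : Fin 8) (hl : 0 ≤ Bf (sr i) l) (I : LieIdeal F L) :
    Module.rank F ↥(W b l ⊓ I.toSubmodule) ≤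
      Module.rank F ↥(W b (rf (sr i) l) ⊓ I.toSubmodule) := by
  obtain ⟨n, hn⟩ := Int.eq_ofNat_of_zero_le hl
  have hI : ∀ x ∈ I, ∀ k : ℕ, ((ad F L (b.f i)) ^ k) x ∈ I := by
    intro x hx k
    induction k with
    | zero => simpa using hx
    | succ k ih => rw [pow_succ', Module.End.mul_apply]; exact lie_mem_right F L I _ _ ih
  refine LinearMap.rank_le_of_injective
    ((((ad F L (b.f i)) ^ n).restrict (p := W b l ⊓ I.toSubmodule)
    (q := W b (rf (sr i) l) ⊓ I.toSubmodule) ?_)) ?_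
  · intro x hx
    refine ⟨?_, hI x hx.2 n⟩
    have := f_pow_mem hb hx.1 i n
    rwa [rf, hn]
  · rw [← LinearMap.ker_eq_bot, LinearMap.ker_eq_bot']
    rintro ⟨x, hx⟩ h0
    exact Subtype.ext (f_inj hb i n hn hx.1 (congrArg Subtype.val h0))

lemma rank_rf {l : V} (i : Fin 8) (I : LieIdeal F L) :
    Module.rank F ↥(W b l ⊓ I.toSubmodule) ≤
      Module.rank F ↥(W b (rf (sr i) l) ⊓ I.toSubmodule) := by
  rcases le_total 0 (Bf (sr i) l) with h | h
  · exact exists_W_rf_aux hb i h I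
  · have := exists_W_rf_aux hb.symm (l := -l) i (by rw [Bf_neg_right]; omega) I
    have e : -rf (sr i) (-l) = rf (sr i) l := by
      simp only [rf, Bf_neg_right]; module
    rwa [W_symm, W_symm, neg_neg, e] at this

end E8P

set_option linter.unusedSectionVars false

namespace E8P
open LieAlgebra

variable {F L : Type*} [Field F] [CharZero F] [LieRing L] [LieAlgebra F L] {H : LieSubalgebra F L}
  {b : LieAlgebra.Basis (Fin 8) H}

/-- at least two nonzero coordinates -/
def Two (l : V) : Prop := ∃ i j, i ≠ j ∧ l i ≠ 0 ∧ l j ≠ 0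

lemma two_of_pos_add {l m : V} (hl : 0 ≤ l) (hm : 0 ≤ m) (h : Two l ∨ Two m) : Two (l + m) := by
  rcases h with ⟨i, j, hij, h1, h2⟩ | ⟨i, j, hij, h1, h2⟩
  all_goals
    refine ⟨i, j, hij, ?_, ?_⟩
    · have := hl i; have := hm i; simp only [Pi.zero_apply, Pi.add_apply] at *; omega
    · have := hl j; have := hm j; simp only [Pi.zero_apply, Pi.add_apply] at *; omega

lemma sr_nonneg (i) : 0 ≤ sr i := by intro j; simp [sr, Pi.single_apply]; split_ifs <;> simp

lemma two_sr_add {i j : Fin 8} (h : i ≠ j) : Two (sr i + sr j) :=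
  ⟨i, j, h, by simp [sr, Pi.single_apply, h], by simp [sr, Pi.single_apply, h.symm]⟩

variable (b) in
/-- spanning set for the positive part -/
def Sp : Set L := {x | (∃ i, x = b.e i) ∨ ∃ l, 0 ≤ l ∧ Two l ∧ x ∈ W b l}

lemma upper_le (hb : IsS b) {x : L} (hx : x ∈ LieSubalgebra.lieSpan F L (Set.range b.e)) :
    x ∈ Submodule.span F (Sp b) := by
  induction hx using LieSubalgebra.lieSpan_induction with
  | mem u hu => obtain ⟨i, rfl⟩ := hu; exact Submodule.subset_span (Or.inl ⟨i, rfl⟩)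
  | zero => exact zero_mem _
  | add u v _ _ hu hv => exact add_mem hu hv
  | smul t u _ hu => exact Submodule.smul_mem _ t hu
  | lie u v hu0 hv0 hu hv =>
    clear hu0 hv0
    induction hu, hv using Submodule.span_induction₂ with
    | mem_mem x y hx hy =>
      rcases hx with ⟨i, rfl⟩ | ⟨l, h1, h2, h3⟩ <;> rcases hy with ⟨j, rfl⟩ | ⟨m, h4, h5, h6⟩
      · by_cases hij : i = j
        · subst hij; simp
        · exact Submodule.subset_span (Or.inr ⟨_, add_nonneg (sr_nonneg i) (sr_nonneg j),
            two_sr_add hij, lie_W b (e_mem hb i) (e_mem hb j)⟩)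
      · exact Submodule.subset_span (Or.inr ⟨_, add_nonneg (sr_nonneg i) h4,
            two_of_pos_add (sr_nonneg i) h4 (Or.inr h5), lie_W b (e_mem hb i) h6⟩)
      · exact Submodule.subset_span (Or.inr ⟨_, add_nonneg h1 (sr_nonneg j),
            two_of_pos_add h1 (sr_nonneg j) (Or.inl h2), lie_W b h3 (e_mem hb j)⟩)
      · exact Submodule.subset_span (Or.inr ⟨_, add_nonneg h1 h4,
            two_of_pos_add h1 h4 (Or.inl h2), lie_W b h3 h6⟩)
    | zero_left y hy => simp
    | zero_right x hx => simp
    | add_left x y z _ _ _ h1 h2 => rw [add_lie]; exact add_mem h1 h2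
    | add_right x y z _ _ _ h1 h2 => rw [lie_add]; exact add_mem h1 h2
    | smul_left r x y _ _ h => rw [smul_lie]; exact Submodule.smul_mem _ r h
    | smul_right r x y _ _ h => rw [lie_smul]; exact Submodule.smul_mem _ r h

variable (b) in
/-- spanning pieces, as sets -/
def Ms (l : V) : Set L := {x | (l = 0 ∧ ∃ i, x = b.h i) ∨ (∃ i, l = sr i ∧ x = b.e i) ∨
    (∃ i, l = - sr i ∧ x = b.f i) ∨ (Two l ∧ (0 ≤ l ∨ l ≤ 0) ∧ x ∈ W b l)}

lemma Ms_le (hb : IsS b) (l : V) : Submodule.span F (Ms b l) ≤ W b l := by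
  rw [Submodule.span_le]
  rintro x (⟨rfl, i, rfl⟩ | ⟨i, rfl, rfl⟩ | ⟨i, rfl, rfl⟩ | ⟨_, _, hx⟩)
  · intro j; rw [b.lie_h_h, Bf_zero_right]; simp
  · exact e_mem hb i
  · exact f_mem hb i
  · exact hx

lemma two_neg {l : V} (h : Two l) : Two (-l) := by
  obtain ⟨i, j, hij, h1, h2⟩ := h
  exact ⟨i, j, hij, by simpa using h1, by simpa using h2⟩

lemma Ms_top (hb : IsS b) : ⨆ l, Submodule.span F (Ms b l) = ⊤ := by
  set T := ⨆ l, Submodule.span F (Ms b l)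
  have hT : ∀ l, ∀ x ∈ Ms b l, x ∈ T := fun l x hx =>
    Submodule.mem_iSup_of_mem l (Submodule.subset_span hx)
  have h1 := b.iSup_cartan_borelLower_borelUpper_eq_top
  have h2 : H.toLieSubmodule ⊔ b.borelLower ⊔ b.borelUpper = ⊤ := by simpa using h1
  rw [eq_top_iff]
  intro x _
  have hx : x ∈ H.toLieSubmodule ⊔ b.borelLower ⊔ b.borelUpper := by rw [h2]; trivial
  obtain ⟨y, hy, z, hz, rfl⟩ := (LieSubmodule.mem_sup _ _ _).1 hx
  obtain ⟨u, hu, v, hv, rfl⟩ := (LieSubmodule.mem_sup _ _ _).1 hy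
  refine add_mem (add_mem ?_ ?_) ?_
  · have : u ∈ Submodule.span F (Set.range b.h) := by rw [← b.coe_cartan_eq_span]; exact hu
    refine (Submodule.span_le.2 ?_ : Submodule.span F (Set.range b.h) ≤ T) this
    rintro _ ⟨i, rfl⟩
    exact hT 0 _ (Or.inl ⟨rfl, i, rfl⟩)
  · have : v ∈ Submodule.span F (Sp b.symm) := upper_le hb.symm hv
    refine (Submodule.span_le.2 ?_ : Submodule.span F (Sp b.symm) ≤ T) this
    rintro x (⟨i, rfl⟩ | ⟨l, h1, h2, h3⟩)
    · exact hT (-sr i) _ (Or.inr (Or.inr (Or.inl ⟨i, rfl, rfl⟩)))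
    · rw [W_symm] at h3
      exact hT (-l) _ (Or.inr (Or.inr (Or.inr ⟨two_neg h2, Or.inr (by simpa using h1), h3⟩)))
  · have : z ∈ Submodule.span F (Sp b) := upper_le hb hz
    refine (Submodule.span_le.2 ?_ : Submodule.span F (Sp b) ≤ T) this
    rintro x (⟨i, rfl⟩ | ⟨l, h1, h2, h3⟩)
    · exact hT (sr i) _ (Or.inr (Or.inl ⟨i, rfl, rfl⟩))
    · exact hT l _ (Or.inr (Or.inr (Or.inr ⟨h2, Or.inl h1, h3⟩)))

lemma Ms_eq (hb : IsS b) (l : V) : Submodule.span F (Ms b l) = W b l :=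
  iSupIndep_eq_of_le _ _ (W_indep b) (Ms_le hb) (Ms_top hb) l

lemma W_top (hb : IsS b) : ⨆ l, W b l = ⊤ := by
  rw [← Ms_top hb]; exact iSup_congr fun l => (Ms_eq hb l).symm

lemma W_cases (hb : IsS b) {l : V} (h : W b l ≠ ⊥) : l = 0 ∨ (∃ i, l = sr i) ∨ (∃ i, l = - sr i) ∨
    (Two l ∧ (0 ≤ l ∨ l ≤ 0)) := by
  by_contra hc
  push Not at hc
  apply h
  rw [← Ms_eq hb l, Submodule.span_eq_bot]
  rintro x (⟨rfl, i, rfl⟩ | ⟨i, rfl, rfl⟩ | ⟨i, rfl, rfl⟩ | ⟨h1, h2, hx⟩)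
  · exact absurd rfl hc.1
  · exact absurd rfl (hc.2.1 i)
  · exact absurd rfl (hc.2.2.1 i)
  · rcases h2 with h2 | h2
    · exact absurd h2 (hc.2.2.2 h1).1
    · exact absurd h2 (hc.2.2.2 h1).2

lemma not_two_sr (i : Fin 8) : ¬ Two (sr i) := by
  rintro ⟨j, k, hjk, h1, h2⟩
  simp only [sr, Pi.single_apply, ne_eq, ite_eq_right_iff, one_ne_zero, imp_false, not_not] at h1 h2
  exact hjk (h1.trans h2.symm)

lemma sr_ne_zero (i : Fin 8) : sr i ≠ 0 := root_ne_zero _ (Bf_sr i)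

lemma sr_inj {i j : Fin 8} (h : sr i = sr j) : i = j := by
  have := congrFun h i
  by_contra hc
  simp [sr, Pi.single_apply, hc] at this

lemma sr_ne_neg (i j : Fin 8) : sr i ≠ - sr j := fun h => by
  have := congrArg ht h
  rw [ht_neg, ht_sr, ht_sr] at this; omega

lemma W_zero (hb : IsS b) : W b 0 = H.toSubmodule := by
  rw [b.coe_cartan_eq_span, ← Ms_eq hb]
  congr 1
  ext x
  constructor
  · rintro (⟨-, i, rfl⟩ | ⟨i, h, -⟩ | ⟨i, h, -⟩ | ⟨h, -⟩)
    · exact ⟨i, rfl⟩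
    · exact absurd h.symm (sr_ne_zero i)
    · exact absurd (neg_eq_zero.1 h.symm) (sr_ne_zero i)
    · obtain ⟨i, _, _, h, _⟩ := h; simp at h
  · rintro ⟨i, rfl⟩; exact Or.inl ⟨rfl, i, rfl⟩

lemma W_sr (hb : IsS b) (i : Fin 8) : W b (sr i) = F ∙ (b.e i) := by
  rw [← Ms_eq hb]
  congr 1
  ext x
  constructor
  · rintro (⟨h, -⟩ | ⟨j, h, rfl⟩ | ⟨j, h, -⟩ | ⟨h, -⟩)
    · exact absurd h (sr_ne_zero i)
    · rw [sr_inj h]; rfl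
    · exact absurd h (sr_ne_neg i j)
    · exact absurd h (not_two_sr i)
  · rintro rfl; exact Or.inr (Or.inl ⟨i, rfl, rfl⟩)

lemma rank_rf' (hb : IsS b) (l : V) (i : Fin 8) :
    Module.rank F ↥(W b l) ≤ Module.rank F ↥(W b (rf (sr i) l)) := by
  have := rank_rf hb (l := l) i ⊤
  rwa [LieSubmodule.top_toSubmodule, inf_top_eq, inf_top_eq] at this

lemma W_rf_ne (hb : IsS b) {l : V} (i : Fin 8) (h : W b l ≠ ⊥) : W b (rf (sr i) l) ≠ ⊥ := by
  intro h0
  have := rank_rf' hb l i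
  rw [h0, rank_bot] at this
  exact h (Submodule.rank_eq_zero.1 (le_antisymm this bot_le))

lemma W_pos (hb : IsS b) (n : ℕ) : ∀ l : V, 0 ≤ l → l ≠ 0 → ht l ≤ n → W b l ≠ ⊥ →
    Bf l l = 2 ∧ Module.rank F ↥(W b l) ≤ 1 := by
  induction n with
  | zero =>
    intro l h1 h2 h3
    have := ht_pos l h1 h2
    simp at h3; omega
  | succ n ih =>
    intro l h1 h2 h3 h4
    obtain ⟨i, hi, hB⟩ := exists_pos_sr l h1 h2
    by_cases hs : l = sr i
    · subst hs
      refine ⟨Bf_sr i, ?_⟩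
      rw [W_sr hb]
      exact (rank_span_le _).trans (by simp)
    have h5 := W_rf_ne hb i h4
    have htwo : ∃ j, j ≠ i ∧ 0 < l j := by
      rcases W_cases hb h4 with h | ⟨j, rfl⟩ | ⟨j, rfl⟩ | ⟨⟨j, k, hjk, hj, hk⟩, -⟩
      · exact absurd h h2
      · exfalso
        by_cases hij : j = i
        · subst hij; exact hs rfl
        · simp [sr, Pi.single_apply, Ne.symm hij] at hi
      · exfalso
        have := ht_pos _ h1 h2
        rw [ht_neg, ht_sr] at this; omega
      · by_cases hji : j = i
        · refine ⟨k, fun h => hjk (hji.trans h.symm), ?_⟩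
          have := h1 k; simp at this; omega
        · refine ⟨j, hji, ?_⟩
          have := h1 j; simp at this; omega
    obtain ⟨j, hji, hj⟩ := htwo
    have hrj : 0 < rf (sr i) l j := by
      simp only [rf, Pi.sub_apply, Pi.smul_apply, sr, Pi.single_apply, hji, if_false]
      simpa using hj
    have h6 : 0 ≤ rf (sr i) l := by
      rcases W_cases hb h5 with h | ⟨k, h⟩ | ⟨k, h⟩ | ⟨-, h | h⟩
      · rw [h]
      · rw [h]; exact sr_nonneg k
      · rw [h] at hrj
        have := sr_nonneg k j
        simp only [Pi.neg_apply, Pi.zero_apply] at *; omega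
      · exact h
      · have := h j; simp only [Pi.zero_apply] at this; omega
    obtain ⟨h7, h8⟩ := ih (rf (sr i) l) h6 (fun h => by rw [h] at hrj; simp at hrj) (by
      rw [rf, ht_sub, ht_smul, ht_sr]; push_cast at h3; omega) h5
    exact ⟨by rw [← h7, Bf_rf _ (Bf_sr i)], (rank_rf' hb l i).trans h8⟩

lemma W_root (hb : IsS b) {l : V} (h0 : l ≠ 0) (h : W b l ≠ ⊥) :
    Bf l l = 2 ∧ Module.rank F ↥(W b l) ≤ 1 := by
  have key : 0 ≤ l ∨ l ≤ 0 := by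
    rcases W_cases hb h with rfl | ⟨i, rfl⟩ | ⟨i, rfl⟩ | ⟨-, h⟩
    · exact Or.inl le_rfl
    · exact Or.inl (sr_nonneg i)
    · exact Or.inr (by simpa using sr_nonneg i)
    · exact h
  rcases key with hl | hl
  · exact W_pos hb (ht l).toNat l hl h0 (by simp) h
  · have := W_pos hb.symm (ht (-l)).toNat (-l) (by simpa using hl) (by simpa using h0) (by simp)
      (by rw [W_symm, neg_neg]; exact h)
    rw [W_symm, neg_neg, Bf_neg_left, Bf_neg_right, neg_neg] at this
    exact this

lemma W_ne_pos (hb : IsS b) (n : ℕ) : ∀ l : V, 0 ≤ l → Bf l l = 2 → ht l ≤ n → W b l ≠ ⊥ := by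
  induction n with
  | zero =>
    intro l h1 h2 h3
    have := ht_pos l h1 (root_ne_zero l h2)
    simp at h3; omega
  | succ n ih =>
    intro l h1 h2 h3
    rcases pos_root_split l h2 h1 with ⟨i, rfl⟩ | ⟨i, h4, h5, h6⟩
    · rw [W_sr hb]; simpa using (b.sl2 i).e_ne_zero
    · have := W_rf_ne hb i (ih (l - sr i) h5 h4 (by
        rw [ht_sub, ht_sr]; push_cast at h3; omega))
      rw [rf, h6] at this
      simpa using this

lemma W_ne (hb : IsS b) {l : V} (h : Bf l l = 2) : W b l ≠ ⊥ := by
  rcases root_sign l h with hl | hl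
  · exact W_ne_pos hb (ht l).toNat l hl h (by simp)
  · have := W_ne_pos hb.symm (ht (-l)).toNat (-l) (by simpa using hl) (by
      rw [Bf_neg_left, Bf_neg_right, h]; norm_num) (by simp)
    rwa [W_symm, neg_neg] at this

lemma W_top' (hb : IsS b) : ⨆ l ∈ insert 0 Rt, W b l = ⊤ := by
  rw [eq_top_iff, ← W_top hb]
  refine iSup_le fun l => ?_
  by_cases h : W b l = ⊥
  · rw [h]; exact bot_le
  · by_cases h0 : l = 0
    · exact le_iSup₂_of_le l (Finset.mem_insert.2 (Or.inl h0)) le_rfl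
    · exact le_iSup₂_of_le l (Finset.mem_insert_of_mem ((mem_Rt _).2 (W_root hb h0 h).1)) le_rfl

lemma finite_L (hb : IsS b) : FiniteDimensional F L := by
  have h : ∀ l, Module.Finite F ↥(W b l) := by
    intro l
    by_cases h0 : l = 0
    · subst h0; rw [W_zero hb, b.coe_cartan_eq_span]
      exact Module.Finite.span_of_finite F (Set.finite_range _)
    by_cases h : W b l = ⊥
    · rw [h]; infer_instance
    · have := (W_root hb h0 h).2
      exact Module.rank_lt_aleph0_iff.1 (this.trans_lt Cardinal.one_lt_aleph0)
  have hs : ∀ s : Finset V, Module.Finite F ↥(⨆ l ∈ s, W b l) := by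
    intro s
    rw [← Finset.sup_eq_iSup]
    exact Submodule.finite_finset_sup _ _
  have := hs (insert 0 Rt)
  rw [W_top' hb] at this
  exact Module.Finite.equiv Submodule.topEquiv

end E8P

set_option linter.unusedSectionVars false

namespace E8P
open LieAlgebra

lemma Bf_code_nodup : ((0 :: rtL).map (Bf ![1, 5, 25, 125, 625, 3125, 15625, 78125])).Nodup := by
  decide +kernel

lemma Bf_code_inj {v w : V} (hv : v = 0 ∨ Bf v v = 2) (hw : w = 0 ∨ Bf w w = 2)
    (h : Bf ![1, 5, 25, 125, 625, 3125, 15625, 78125] v =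
      Bf ![1, 5, 25, 125, 625, 3125, 15625, 78125] w) : v = w := by
  have hm : ∀ v : V, (v = 0 ∨ Bf v v = 2) → v ∈ (0 :: rtL) := fun v hv => by
    rcases hv with rfl | hv
    · exact List.mem_cons_self
    · exact List.mem_cons_of_mem _ ((mem_rtL _).2 hv)
  exact List.inj_on_of_nodup_map Bf_code_nodup (hm v hv) (hm w hw) h

variable {F L : Type*} [Field F] [CharZero F] [LieRing L] [LieAlgebra F L] {H : LieSubalgebra F L}
  {b : LieAlgebra.Basis (Fin 8) H}

lemma ideal_meets (hb : IsS b) (I : LieIdeal F L) (hI : I ≠ ⊥) :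
    ∃ l : V, (l = 0 ∨ Bf l l = 2) ∧ W b l ⊓ I.toSubmodule ≠ ⊥ := by
  have := finite_L hb
  set dv : V := ![1, 5, 25, 125, 625, 3125, 15625, 78125] with hdv
  set d : L := ∑ i, (dv i : F) • b.h i with hd
  have had : ∀ l : V, ∀ x ∈ W b l, ⁅d, x⁆ = (Bf dv l : F) • x := by
    intro l x hx
    rw [hd, sum_lie, Bf_expand]
    push_cast
    rw [Finset.sum_smul]
    refine Finset.sum_congr rfl fun i _ => ?_
    rw [smul_lie, (mem_W b).1 hx i, smul_smul]
  let E : F → Submodule F L := (ad F L d).eigenspace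
  let M : F → Submodule F L := fun μ => ⨆ l : {l : V // (l = 0 ∨ Bf l l = 2) ∧ (Bf dv l : F) = μ}, W b l
  have hME : ∀ μ, M μ ≤ E μ := by
    intro μ
    refine iSup_le fun ⟨l, h1, h2⟩ x hx => ?_
    rw [Module.End.mem_eigenspace_iff, ad_apply, had l x hx, h2]
  have hMt : ⨆ μ, M μ = ⊤ := by
    rw [eq_top_iff, ← W_top' hb]
    refine iSup₂_le fun l hl => ?_
    have hl' : l = 0 ∨ Bf l l = 2 := by
      rcases Finset.mem_insert.1 hl with h | h
      · exact Or.inl h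
      · exact Or.inr ((mem_Rt _).1 h)
    exact le_iSup_of_le (Bf dv l : F) (le_iSup_of_le
      (f := fun l : {l' : V // (l' = 0 ∨ Bf l' l' = 2) ∧ (Bf dv l' : F) = (Bf dv l : F)} => W b l)
      ⟨l, hl', rfl⟩ le_rfl)
  have hEq := iSupIndep_eq_of_le E M (Module.End.eigenspaces_iSupIndep _) hME hMt
  have hEt : ⨆ μ, E μ = ⊤ := by rw [← hMt]; exact iSup_congr fun μ => (hEq μ).symm
  have h1 := Submodule.eq_iSup_inf_genEigenspace (p := I.toSubmodule) (f := ad F L d) 1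
    (fun x hx => lie_mem_right F L I d x hx) hEt
  by_contra hc
  push Not at hc
  apply hI
  rw [← LieSubmodule.toSubmodule_eq_bot, h1, iSup_eq_bot]
  intro μ
  change I.toSubmodule ⊓ E μ = ⊥
  rw [← hEq μ, eq_bot_iff]
  by_cases h : ∃ l : V, (l = 0 ∨ Bf l l = 2) ∧ (Bf dv l : F) = μ
  · obtain ⟨l, hl, hlμ⟩ := h
    rw [← hc l hl, inf_comm]
    refine inf_le_inf_right _ (iSup_le fun ⟨l', h1, h2⟩ => ?_)
    have : l' = l := Bf_code_inj h1 hl (by rw [← hlμ] at h2; exact_mod_cast h2)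
    subst this; exact le_rfl
  · have : IsEmpty {l : V // (l = 0 ∨ Bf l l = 2) ∧ (Bf dv l : F) = μ} :=
      ⟨fun ⟨l, hl⟩ => h ⟨l, hl⟩⟩
    simp [M]

lemma ideal_sr_pos (hb : IsS b) (I : LieIdeal F L) (n : ℕ) : ∀ l : V, 0 ≤ l → Bf l l = 2 →
    ht l ≤ n → W b l ⊓ I.toSubmodule ≠ ⊥ → ∃ i, b.e i ∈ I := by
  induction n with
  | zero =>
    intro l h1 h2 h3
    have := ht_pos l h1 (root_ne_zero l h2)
    simp at h3; omega
  | succ n ih =>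
    intro l h1 h2 h3 h
    rcases pos_root_split l h2 h1 with ⟨i, rfl⟩ | ⟨i, h4, h5, h6⟩
    · obtain ⟨x, hx, hx0⟩ := Submodule.exists_mem_ne_zero_of_ne_bot h
      have hx1 : x ∈ W b (sr i) := hx.1
      rw [W_sr hb, Submodule.mem_span_singleton] at hx1
      obtain ⟨c, rfl⟩ := hx1
      refine ⟨i, ?_⟩
      have hc : c ≠ 0 := fun h => hx0 (by rw [h, zero_smul])
      exact (I.toSubmodule.smul_mem_iff hc).1 hx.2
    · refine ih (l - sr i) h5 h4 (by rw [ht_sub, ht_sr]; push_cast at h3; omega) ?_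
      have e : rf (sr i) l = l - sr i := by
        have : Bf (sr i) l = 1 := by
          rw [Bf_sub_right, Bf_sr] at h6; omega
        rw [rf, this, one_smul]
      intro h0
      have := rank_rf hb (l := l) i I
      rw [e, h0, rank_bot] at this
      exact h (Submodule.rank_eq_zero.1 (le_antisymm this bot_le))

lemma trivRad (hb : IsS b) : HasTrivialRadical F L := by
  rw [hasTrivialRadical_iff_no_abelian_ideals]
  intro I hab
  by_contra hI
  have ab : ∀ x ∈ I, ∀ y ∈ I, ⁅x, y⁆ = 0 := fun x hx y hy => by
    have := hab.trivial ⟨x, hx⟩ ⟨y, hy⟩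
    exact congrArg Subtype.val this
  have he : ∀ i, b.e i ∉ I := by
    intro i hi
    have h1 : b.h i ∈ I := by
      rw [← (b.sl2 i).lie_e_f]; exact lie_mem_left F L I _ _ hi
    have h2 := ab _ h1 _ hi
    rw [(b.sl2 i).lie_h_e_smul F] at h2
    exact (b.sl2 i).e_ne_zero ((smul_eq_zero.1 h2).resolve_left two_ne_zero)
  have hf : ∀ i, b.f i ∉ I := by
    intro i hi
    have h1 : b.h i ∈ I := by
      rw [← (b.sl2 i).lie_e_f]; exact lie_mem_right F L I _ _ hi
    have h2 := ab _ h1 _ hi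
    rw [(b.sl2 i).lie_lie_smul_f F] at h2
    exact (b.sl2 i).f_ne_zero ((smul_eq_zero.1 (neg_eq_zero.1 h2)).resolve_left two_ne_zero)
  have hr : ∀ l : V, Bf l l = 2 → W b l ⊓ I.toSubmodule = ⊥ := by
    intro l hl
    by_contra hc
    rcases root_sign l hl with h | h
    · obtain ⟨i, hi⟩ := ideal_sr_pos hb I (ht l).toNat l h hl (by simp) hc
      exact he i hi
    · obtain ⟨i, hi⟩ := ideal_sr_pos hb.symm I (ht (-l)).toNat (-l) (by simpa using h) (by
        rw [Bf_neg_left, Bf_neg_right, hl]; norm_num) (by simp) (by rwa [W_symm, neg_neg])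
      exact hf i hi
  obtain ⟨l, hl, h⟩ := ideal_meets hb I hI
  rcases hl with rfl | hl
  · obtain ⟨x, hx, hx0⟩ := Submodule.exists_mem_ne_zero_of_ne_bot h
    have hx1 : x ∈ W b 0 := hx.1
    rw [W_zero hb, b.coe_cartan_eq_span, Submodule.mem_span_range_iff_exists_fun] at hx1
    obtain ⟨c, hc⟩ := hx1
    have hz : ∀ j, ⁅x, b.e j⁆ = (∑ i, c i * (Bf (sr i) (sr j) : F)) • b.e j := by
      intro j
      rw [← hc, sum_lie, Finset.sum_smul]
      refine Finset.sum_congr rfl fun i _ => ?_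
      rw [smul_lie, (mem_W b).1 (e_mem hb j) i, smul_smul]
    have : c = 0 := by
      apply sr_solve
      intro j
      by_contra hne
      apply he j
      have : ⁅x, b.e j⁆ ∈ I := lie_mem_left F L I _ _ hx.2
      rw [hz j] at this
      exact (I.toSubmodule.smul_mem_iff hne).1 this
    apply hx0
    rw [← hc, this]; simp
  · exact h (hr l hl)


section RS
variable {F L : Type*} [Field F] [LieRing L] [LieAlgebra F L] (H : LieSubalgebra F L)

/-- simultaneous eigenspaces of a subalgebra -/
def RS (χ : Module.Dual F H) : Submodule F L where
  carrier := {x | ∀ h : H, ⁅(h : L), x⁆ = χ h • x}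
  add_mem' := by intro x y hx hy i; rw [lie_add, hx i, hy i, smul_add]
  zero_mem' := by intro i; simp
  smul_mem' := by intro c x hx i; rw [lie_smul, hx i, smul_comm]

lemma mem_RS {χ : Module.Dual F H} {x : L} : x ∈ RS H χ ↔ ∀ h : H, ⁅(h : L), x⁆ = χ h • x := Iff.rfl

lemma lie_RS {χ ψ : Module.Dual F H} {x y : L} (hx : x ∈ RS H χ) (hy : y ∈ RS H ψ) :
    ⁅x, y⁆ ∈ RS H (χ + ψ) := by
  intro h
  rw [leibniz_lie, hx h, hy h, smul_lie, lie_smul, LinearMap.add_apply, add_smul]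

lemma RS_indep (hab : ∀ x ∈ H, ∀ y ∈ H, ⁅x, y⁆ = 0) : iSupIndep (RS H) := by
  have h1 := Module.End.independent_iInf_maxGenEigenspace_of_forall_mapsTo
    (fun i : H => ad F L i) (by
      intro i j φ
      apply Module.End.mapsTo_maxGenEigenspace_of_comm
      refine LinearMap.ext fun x => ?_
      change ⁅(j : L), ⁅(i : L), x⁆⁆ = ⁅(i : L), ⁅(j : L), x⁆⁆
      rw [leibniz_lie, hab _ j.2 _ i.2, zero_lie, zero_add])
  have inj : Function.Injective (fun (χ : Module.Dual F H) (i : H) => χ i) := DFunLike.coe_injective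
  refine (h1.comp inj).mono fun l x hx => ?_
  simp only [Function.comp, Submodule.mem_iInf]
  intro i
  refine Module.End.mem_maxGenEigenspace _ _ _ |>.2 ⟨1, ?_⟩
  simp [hx i]

variable {H}
/-- the functional attached to a lattice vector -/
noncomputable def ev (B : Module.Basis (Fin 8) F (Module.Dual F H)) (v : V) : Module.Dual F H :=
  ∑ i, (v i : F) • B i

lemma ev_add (B : Module.Basis (Fin 8) F (Module.Dual F H)) (v w : V) :
    ev B (v + w) = ev B v + ev B w := by
  simp [ev, add_smul, Finset.sum_add_distrib]

lemma ev_zero (B : Module.Basis (Fin 8) F (Module.Dual F H)) : ev B 0 = 0 := by simp [ev]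

lemma ev_neg (B : Module.Basis (Fin 8) F (Module.Dual F H)) (v : V) : ev B (-v) = - ev B v := by
  rw [eq_neg_iff_add_eq_zero, ← ev_add, neg_add_cancel, ev_zero]

lemma ev_sub (B : Module.Basis (Fin 8) F (Module.Dual F H)) (v w : V) :
    ev B (v - w) = ev B v - ev B w := by
  rw [sub_eq_add_neg, ev_add, ev_neg, sub_eq_add_neg]

lemma ev_sr (B : Module.Basis (Fin 8) F (Module.Dual F H)) (i) : ev B (sr i) = B i := by
  simp [ev, sr, Pi.single_apply]

lemma ev_inj [CharZero F] (B : Module.Basis (Fin 8) F (Module.Dual F H)) :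
    Function.Injective (ev B) := by
  intro v w h
  have : (fun i => ((v i : F) - w i)) = 0 := by
    have h2 := Fintype.linearIndependent_iff.1 B.linearIndependent (fun i => ((v i : F) - w i)) (by
      simp only [sub_smul, Finset.sum_sub_distrib]
      exact sub_eq_zero.2 h)
    exact funext h2
  funext i
  have := congrFun this i
  simp only [Pi.zero_apply, sub_eq_zero] at this
  exact_mod_cast this

/-- `H` has root system `E₈` with base `B` -/
def IsE8 (B : Module.Basis (Fin 8) F (Module.Dual F H)) : Prop :=
  ∀ χ, χ ≠ 0 → (RS H χ ≠ ⊥ ↔ ∃ v, Bf v v = 2 ∧ χ = ev B v)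

end RS

lemma exists_IsE8 (hb : IsS b) : ∃ B : Module.Basis (Fin 8) F (Module.Dual F H), IsE8 B := by
  have := finite_L hb
  have hspan : Submodule.span F (Set.range b.h') = ⊤ := by
    rw [eq_top_iff]
    rintro ⟨x, hx⟩ -
    have hx' : x ∈ Submodule.span F (Set.range b.h) := by rwa [← b.coe_cartan_eq_span]
    rw [Submodule.mem_span_range_iff_exists_fun] at hx' ⊢
    obtain ⟨c, hc⟩ := hx'
    refine ⟨c, Subtype.ext ?_⟩
    refine Eq.trans ?_ hc
    simp [LieAlgebra.Basis.h']
  have hli : LinearIndependent F b.h' := by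
    have := b.linInd
    exact LinearIndependent.of_comp H.toSubmodule.subtype this
  let BH : Module.Basis (Fin 8) F H := Module.Basis.mk hli hspan.ge
  have hfr : Fintype.card (Fin 8) = Module.finrank F (Module.Dual F H) := by
    rw [Subspace.dual_finrank_eq, Module.finrank_eq_card_basis BH]
  let B := basisOfLinearIndependentOfCardEqFinrank b.linearIndependent_baseSupp hfr
  have hB : ∀ i, B i = b.baseSupp i := fun i => by simp [B]
  have hev : ∀ v i, ev B v (b.h' i) = Bf (sr i) v := by
    intro v i
    rw [Bf_comm, Bf_expand]
    simp [ev, hB, hb.hA]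
  have hWR : ∀ v, W b v = RS H (ev B v) := by
    intro v
    ext x
    constructor
    · intro hx h
      have hm : h ∈ Submodule.span F (Set.range b.h') := by rw [hspan]; trivial
      induction hm using Submodule.span_induction with
      | mem u hu => obtain ⟨i, rfl⟩ := hu; rw [hev]; exact hx i
      | zero => simp
      | add u v _ _ hu hv => 
        change ⁅(u : L) + (v : L), x⁆ = _
        rw [add_lie, hu, hv, map_add, add_smul]
      | smul t u _ hu => 
        change ⁅t • (u : L), x⁆ = _
        rw [smul_lie, hu, map_smul, smul_assoc]
    · intro hx i
      rw [← hev]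
      exact hx (b.h' i)
  have hab : ∀ x ∈ H, ∀ y ∈ H, ⁅x, y⁆ = 0 := by
    intro x hx y hy
    have := b.isLieAbelian_cartan.trivial ⟨x, hx⟩ ⟨y, hy⟩
    exact congrArg Subtype.val this
  have htop : ⨆ v, RS H (ev B v) = ⊤ := by
    rw [← W_top hb]; exact iSup_congr fun v => (hWR v).symm
  refine ⟨B, fun χ hχ => ⟨fun h => ?_, ?_⟩⟩
  · have hex : ∃ v, χ = ev B v := by
      by_contra hc
      push Not at hc
      apply h
      have h1 := RS_indep H hab χ
      rw [eq_bot_iff]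
      have h2 : (⊤ : Submodule F L) ≤ ⨆ (j) (_ : j ≠ χ), RS H j := by
        rw [← htop]
        exact iSup_le fun v => le_iSup₂_of_le (ev B v) (hc v).symm le_rfl
      have := h1.eq_bot_of_le (le_top.trans h2)
      rw [this]
    obtain ⟨v, rfl⟩ := hex
    rw [← hWR] at h
    exact ⟨v, (W_root hb (fun h0 => hχ (by rw [h0, ev_zero])) h).1, rfl⟩
  · rintro ⟨v, hv, rfl⟩
    rw [← hWR]
    exact W_ne hb hv

lemma gB_isS (F : Type) [Field F] [CharZero F] [Nontrivial (e₈ F)] : IsS (gB F) :=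
  ⟨fun i j => E8_eq i j, g_adE F, g_adF F⟩

theorem e8_main (F : Type) [Field F] [CharZero F] [Nontrivial (e₈ F)] :
    FiniteDimensional F (e₈ F) ∧ IsKilling F (e₈ F) ∧
    ∃ H : LieSubalgebra F (e₈ F), H.IsCartanSubalgebra ∧
      ∃ B : Module.Basis (Fin 8) F (Module.Dual F H), IsE8 B := by
  have h1 := finite_L (gB_isS F)
  have h2 := trivRad (gB_isS F)
  exact ⟨h1, inferInstance, _, (gB F).isCartanSubalgebra, exists_IsE8 (gB_isS F)⟩

end E8P

set_option linter.unusedSectionVars false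

namespace E8P
open MvPolynomial

section Vanish
variable {F ι : Type*} [Field F] [CharZero F] (Z : ι → Prop) [DecidablePred Z]

/-- restriction to the coordinate subspace given by `Z` -/
noncomputable def resZ : MvPolynomial ι F →ₐ[F] MvPolynomial ι F :=
  aeval (fun j => if Z j then X j else 0)

lemma resZ_X (j : ι) : resZ (F := F) Z (X j) = if Z j then X j else 0 := by simp [resZ]

lemma pderiv_comm' (i j : ι) (P : MvPolynomial ι F) :
    pderiv i (pderiv j P) = pderiv j (pderiv i P) := by
  classical
  by_cases h : i = j
  · rw [h]
  ext m
  rw [coeff_pderiv, coeff_pderiv, coeff_pderiv, coeff_pderiv]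
  simp only [Finsupp.add_apply, Finsupp.single_apply, h, Ne.symm h, if_false, add_zero]
  rw [add_right_comm]; ring

lemma resZ_pderiv {i : ι} (hi : Z i) (P : MvPolynomial ι F) :
    resZ Z (pderiv i P) = pderiv i (resZ Z P) := by
  classical
  induction P using MvPolynomial.induction_on with
  | C a => simp [resZ]
  | add p q hp hq => simp [hp, hq]
  | mul_X p n hp =>
    rw [pderiv_mul, map_add, map_mul, map_mul, map_mul, pderiv_mul, hp]
    congr 2
    rw [resZ_X, pderiv_X]
    by_cases h : n = i
    · subst h; simp [hi]
    · rw [Pi.single_eq_of_ne h]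
      split_ifs
      · rw [pderiv_X_of_ne h, map_zero]
      · simp

/-- polynomials vanishing to order `> k` along the subspace -/
def Wv : ℕ → MvPolynomial ι F → Prop
  | 0 => fun P => resZ Z P = 0
  | (k + 1) => fun P => resZ Z P = 0 ∧ ∀ j, Wv k (pderiv j P)

variable {Z}
lemma Wv.res {k : ℕ} {P : MvPolynomial ι F} (h : Wv Z k P) : resZ Z P = 0 := by
  cases k with
  | zero => exact h
  | succ k => exact h.1

lemma Wv.pred {k : ℕ} : ∀ {P : MvPolynomial ι F}, Wv Z (k + 1) P → Wv Z k P := by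
  induction k with
  | zero => intro P h; exact h.1
  | succ k ih => intro P h; exact ⟨h.1, fun j => ih (h.2 j)⟩

lemma Wv.zero (k : ℕ) : Wv Z k (0 : MvPolynomial ι F) := by
  induction k with
  | zero => exact map_zero _
  | succ k ih => exact ⟨map_zero _, fun j => by rw [map_zero]; exact ih⟩

lemma Wv.add {k : ℕ} : ∀ {P Q : MvPolynomial ι F}, Wv Z k P → Wv Z k Q → Wv Z k (P + Q) := by
  induction k with
  | zero => intro P Q h h'; change resZ Z _ = 0; rw [map_add, h.res, h'.res, add_zero]
  | succ k ih =>
    intro P Q h h'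
    exact ⟨by rw [map_add, h.res, h'.res, add_zero], fun j => by
      rw [map_add]; exact ih (h.2 j) (h'.2 j)⟩

lemma Wv.mul {k : ℕ} : ∀ (a : MvPolynomial ι F) {P : MvPolynomial ι F}, Wv Z k P →
    Wv Z k (a * P) := by
  induction k with
  | zero => intro a P h; change resZ Z _ = 0; rw [map_mul, h.res, mul_zero]
  | succ k ih =>
    intro a P h
    refine ⟨by rw [map_mul, h.res, mul_zero], fun j => ?_⟩
    rw [pderiv_mul]
    exact (ih _ h.pred).add (ih _ (h.2 j))

lemma Wv.sum {k : ℕ} {κ : Type*} (s : Finset κ) (f : κ → MvPolynomial ι F)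
    (h : ∀ i ∈ s, Wv Z k (f i)) : Wv Z k (∑ i ∈ s, f i) := by
  classical
  induction s using Finset.induction_on with
  | empty => rw [Finset.sum_empty]; exact Wv.zero k
  | insert a s ha ih =>
    rw [Finset.sum_insert ha]
    exact (h a (Finset.mem_insert_self _ _)).add
      (ih fun i hi => h i (Finset.mem_insert_of_mem hi))

lemma Wv.mul_ker {k : ℕ} : ∀ {q P : MvPolynomial ι F}, resZ Z q = 0 → Wv Z k P →
    Wv Z (k + 1) (q * P) := by
  induction k with
  | zero =>
    intro q P hq h
    refine ⟨by rw [map_mul, hq, zero_mul], fun j => ?_⟩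
    change resZ Z _ = 0
    rw [pderiv_mul, map_add, map_mul, map_mul, hq, h.res]; simp
  | succ k ih =>
    intro q P hq h
    refine ⟨by rw [map_mul, hq, zero_mul], fun j => ?_⟩
    rw [pderiv_mul]
    exact (h.mul _).add (ih hq (h.2 j))

lemma Wv.of_normal {k : ℕ} : ∀ {P : MvPolynomial ι F}, resZ Z P = 0 →
    (∀ j, ¬ Z j → Wv Z k (pderiv j P)) → Wv Z (k + 1) P := by
  induction k with
  | zero =>
    intro P h0 h
    refine ⟨h0, fun j => ?_⟩
    by_cases hj : Z j
    · change resZ Z _ = 0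
      rw [resZ_pderiv Z hj, h0, map_zero]
    · exact h j hj
  | succ k ih =>
    intro P h0 h
    refine ⟨h0, fun j => ?_⟩
    by_cases hj : Z j
    · refine ih (by rw [resZ_pderiv Z hj, h0, map_zero]) fun i hi => ?_
      rw [pderiv_comm']
      exact (h i hi).2 j
    · exact h j hj

lemma Wv.of_mul {k : ℕ} {a : MvPolynomial ι F} (ha : resZ Z a ≠ 0) :
    ∀ {P : MvPolynomial ι F}, Wv Z k (a * P) → Wv Z k P := by
  induction k with
  | zero =>
    intro P h
    have := h.res
    rw [map_mul] at this
    exact (mul_eq_zero.1 this).resolve_left ha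
  | succ k ih =>
    intro P h
    have h1 : Wv Z k P := ih h.pred
    refine ⟨h1.res, fun j => ih ?_⟩
    have h2 := h.2 j
    rw [pderiv_mul] at h2
    have h3 := h2.add (h1.mul (- pderiv j a))
    convert h3 using 1; ring

lemma coeff_zero_resZ (P : MvPolynomial ι F) : coeff 0 (resZ Z P) = coeff 0 P := by
  rw [← constantCoeff_eq]
  induction P using MvPolynomial.induction_on with
  | C a => simp [resZ]
  | add p q hp hq => simp [hp, hq]
  | mul_X p n hp =>
    rw [map_mul, map_mul, map_mul, resZ_X]
    split_ifs <;> simp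

lemma Wv.coeff {k : ℕ} : ∀ {P : MvPolynomial ι F}, Wv Z k P → ∀ m : ι →₀ ℕ, m.degree = k →
    coeff m P = 0 := by
  induction k with
  | zero =>
    intro P h m hm
    have : m = 0 := (Finsupp.degree_eq_zero_iff m).1 hm
    rw [this, ← coeff_zero_resZ (Z := Z), h.res, coeff_zero]
  | succ k ih =>
    intro P h m hm
    have hm0 : m ≠ 0 := by rintro rfl; simp at hm
    obtain ⟨i, hi⟩ := Finsupp.ne_iff.1 hm0
    have hle : Finsupp.single i 1 ≤ m := by
      rw [Finsupp.single_le_iff]; simp at hi; omega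
    obtain ⟨m', rfl⟩ := exists_add_of_le hle
    rw [add_comm] at hm ⊢
    have := ih (h.2 i) m' (by rw [map_add, Finsupp.degree_single] at hm; omega)
    rw [coeff_pderiv] at this
    exact (mul_eq_zero.1 this).resolve_right (Nat.cast_add_one_ne_zero _)

/-- The abstract density argument. -/
theorem vanish [Fintype ι] (P : MvPolynomial ι F) (h0 : resZ Z P = 0)
    (l : ι → ι → MvPolynomial ι F) (a : ι → MvPolynomial ι F)
    (hD : ∀ i, ¬ Z i → ∑ j, l i j * pderiv j P = 0)
    (ha : ∀ i, ¬ Z i → resZ Z (a i) ≠ 0)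
    (hl : ∀ i, ¬ Z i → resZ Z (l i i - a i) = 0)
    (hl' : ∀ i j, ¬ Z i → j ≠ i → resZ Z (l i j) = 0) : P = 0 := by
  classical
  have key : ∀ k, Wv Z k P := by
    intro k
    induction k with
    | zero => exact h0
    | succ k ih =>
      refine Wv.of_normal h0 fun i hi => ?_
      apply Wv.of_mul (ha i hi)
      have e : a i * pderiv i P = -1 * ((l i i - a i) * pderiv i P) +
          (-1) * ∑ j ∈ Finset.univ.erase i, l i j * pderiv j P := by
        have h1 := hD i hi
        rw [← Finset.add_sum_erase _ _ (Finset.mem_univ i)] at h1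
        linear_combination h1
      have hk : ∀ q j, resZ Z q = 0 → Wv Z k (q * pderiv j P) := by
        intro q j hq
        cases k with
        | zero => change resZ Z _ = 0; rw [map_mul, hq, zero_mul]
        | succ k => exact Wv.mul_ker hq (ih.2 j)
      rw [e]
      refine Wv.add (Wv.mul _ (hk _ _ (hl i hi))) (Wv.mul _ (Wv.sum _ _ fun j hj => ?_))
      exact hk _ _ (hl' i j hi (Finset.ne_of_mem_erase hj))
  ext m
  rw [coeff_zero]
  exact (key m.degree).coeff m rfl

end Vanish

end E8P

set_option linter.unusedSectionVars false

namespace E8P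
open MvPolynomial LieAlgebra

section WB
variable {F L : Type*} [Field F] [CharZero F] [LieRing L] [LieAlgebra F L]

/-- A basis of weight vectors for an abelian self-centralizing subalgebra. -/
structure WBasis (H : LieSubalgebra F L) (ι : Type*) where
  b : Module.Basis ι F L
  wt : ι → Module.Dual F H
  mem : ∀ i, b i ∈ RS H (wt i)
  zero : ∀ i, wt i = 0 → b i ∈ H
  ab : ∀ x ∈ H, ∀ y ∈ H, ⁅x, y⁆ = 0

variable {H : LieSubalgebra F L} {ι : Type*} [Fintype ι] [DecidableEq ι] (w : WBasis H ι)

lemma WBasis.repr_lie (h : H) (x : L) (j : ι) :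
    w.b.repr ⁅(h : L), x⁆ j = w.wt j h * w.b.repr x j := by
  have : ⁅(h : L), x⁆ = ∑ i, (w.b.repr x i * w.wt i h) • w.b i := by
    conv_lhs => rw [← w.b.sum_repr x, lie_sum]
    refine Finset.sum_congr rfl fun i _ => ?_
    rw [lie_smul, w.mem i h, smul_smul]
  rw [this, w.b.repr_sum_self]; ring

lemma WBasis.repr_H {h : L} (hh : h ∈ H) {j : ι} (hj : w.wt j ≠ 0) : w.b.repr h j = 0 := by
  obtain ⟨h', hh'⟩ : ∃ h', w.wt j h' ≠ 0 := by
    by_contra hc; push Not at hc; exact hj (LinearMap.ext hc)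
  have := w.repr_lie h' h j
  rw [w.ab _ h'.2 _ hh] at this
  simp at this
  exact this.resolve_left hh'

variable (b : Module.Basis ι F L)
/-- matrix of ad -/
noncomputable def Nm (z : L) : Matrix ι ι F := LinearMap.toMatrix b b (ad F L z)

lemma Nm_apply (z : L) (r c : ι) : Nm b z r c = b.repr ⁅z, b c⁆ r := by
  rw [Nm, LinearMap.toMatrix_apply, ad_apply]

lemma Nm_sum {κ : Type*} (s : Finset κ) (c : κ → F) (x : κ → L) :
    Nm b (∑ i ∈ s, c i • x i) = ∑ i ∈ s, c i • Nm b (x i) := by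
  ext r k
  rw [Nm_apply, sum_lie, map_sum, Finsupp.finsetSum_apply, Matrix.sum_apply]
  refine Finset.sum_congr rfl fun i _ => ?_
  rw [smul_lie, map_smul, Finsupp.smul_apply, Matrix.smul_apply, Nm_apply]

lemma Nm_lie (y z : L) : Nm b ⁅y, z⁆ = Nm b y * Nm b z - Nm b z * Nm b y := by
  rw [Nm, Nm, Nm, ← LinearMap.toMatrix_mul, ← LinearMap.toMatrix_mul, ← map_sub]
  congr 1
  ext x
  change ⁅⁅y, z⁆, x⁆ = ⁅y, ⁅z, x⁆⁆ - ⁅z, ⁅y, x⁆⁆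
  rw [lie_lie]

/-- generic ad matrix -/
noncomputable def gM : Matrix ι ι (MvPolynomial ι F) :=
  fun r c => ∑ j, X j * C (Nm b (b j) r c)

/-- trace polynomials -/
noncomputable def tau (k : ℕ) : MvPolynomial ι F := ((gM b) ^ k).trace

lemma eval_gM (c : ι → F) : (gM b).map (eval c) = Nm b (∑ j, c j • b j) := by
  rw [Nm_sum]
  ext r k
  simp [gM, Matrix.sum_apply]

lemma eval_tau (c : ι → F) (k : ℕ) :
    eval c (tau b k) = LinearMap.trace F L ((ad F L (∑ j, c j • b j)) ^ k) := by
  rw [LinearMap.trace_eq_matrix_trace F b, ← LinearMap.toMatrix_pow]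
  change _ = ((Nm b (∑ j, c j • b j)) ^ k).trace
  rw [← eval_gM, tau, ← RingHom.mapMatrix_apply, ← map_pow, RingHom.mapMatrix_apply,
    AddMonoidHom.map_trace]

/-- vector field -/
noncomputable def vf (y : L) (j : ι) : MvPolynomial ι F := ∑ i, X i * C (b.repr ⁅y, b i⁆ j)

/-- derivation -/
noncomputable def Dy (y : L) : Derivation F (MvPolynomial ι F) (MvPolynomial ι F) :=
  mkDerivation F (vf b y)

lemma Dy_eq (y : L) (P : MvPolynomial ι F) : Dy b y P = ∑ j, vf b y j * pderiv j P := by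
  induction P using MvPolynomial.induction_on with
  | C a => simp [Dy]
  | add p q hp hq => simp [hp, hq, mul_add, Finset.sum_add_distrib]
  | mul_X p n hp =>
    rw [Derivation.leibniz, hp, Dy, mkDerivation_X]
    simp only [pderiv_mul, mul_add, Finset.sum_add_distrib, smul_eq_mul]
    rw [add_comm, Finset.mul_sum]
    congr 1
    · exact Finset.sum_congr rfl fun i _ => by ring
    · simp [pderiv_X, Pi.single_apply, mul_comm]

lemma Dy_gM (y : L) : (gM b).map (Dy b y) =
    (Nm b y).map C * gM b - gM b * (Nm b y).map C := by
  have h1 : ∀ (r c : ι), Dy b y (gM b r c) = ∑ i, X i * C (Nm b ⁅y, b i⁆ r c) := by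
    intro r c
    have h2 : ∀ i, Nm b ⁅y, b i⁆ r c = ∑ j, b.repr ⁅y, b i⁆ j * Nm b (b j) r c := by
      intro i
      conv_lhs => rw [← b.sum_repr ⁅y, b i⁆, Nm_sum]
      simp [Matrix.sum_apply]
    simp only [gM, map_sum, Derivation.leibniz, h2, Finset.mul_sum]
    rw [Finset.sum_comm]
    refine Finset.sum_congr rfl fun j _ => ?_
    have : Dy b y (C (Nm b (b j) r c)) = 0 := by simp [Dy]
    rw [this, smul_zero, zero_add, Dy, mkDerivation_X, vf, smul_eq_mul, Finset.mul_sum]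
    refine Finset.sum_congr rfl fun i _ => ?_
    rw [C_mul]; ring
  ext1 r c
  rw [Matrix.map_apply, h1, Matrix.sub_apply, Matrix.mul_apply, Matrix.mul_apply]
  simp only [gM, Nm_lie, Matrix.sub_apply, Matrix.mul_apply, Matrix.map_apply, Finset.mul_sum,
    Finset.sum_mul, map_sub, map_sum, mul_sub, Finset.sum_sub_distrib]
  congr 1
  · rw [Finset.sum_comm]
    refine Finset.sum_congr rfl fun j _ => Finset.sum_congr rfl fun i _ => ?_
    rw [C_mul]; ring
  · rw [Finset.sum_comm]
    refine Finset.sum_congr rfl fun j _ => Finset.sum_congr rfl fun i _ => ?_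
    rw [C_mul]; ring

lemma Dy_map_mul (y : L) (M N : Matrix ι ι (MvPolynomial ι F)) :
    (M * N).map (Dy b y) = M.map (Dy b y) * N + M * N.map (Dy b y) := by
  ext1 r c
  simp only [Matrix.map_apply, Matrix.mul_apply, Matrix.add_apply, map_sum, Derivation.leibniz,
    smul_eq_mul, Finset.sum_add_distrib]
  rw [add_comm]
  congr 1
  exact Finset.sum_congr rfl fun i _ => mul_comm _ _

lemma Dy_gM_pow (y : L) (k : ℕ) : ((gM b) ^ k).map (Dy b y) =
    (Nm b y).map C * (gM b) ^ k - (gM b) ^ k * (Nm b y).map C := by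
  induction k with
  | zero =>
    ext1 r c
    simp [Matrix.one_apply, Matrix.map_apply]
    split_ifs <;> simp
  | succ k ih =>
    rw [pow_succ, Dy_map_mul, ih, Dy_gM]
    noncomm_ring

lemma Dy_tau (y : L) (k : ℕ) : Dy b y (tau b k) = 0 := by
  have : Dy b y (tau b k) = (((gM b) ^ k).map (Dy b y)).trace := by
    simp [tau, Matrix.trace]
  rw [this, Dy_gM_pow, Matrix.trace_sub, Matrix.trace_mul_comm, sub_self]

lemma Dy_aeval (y : L) (G : MvPolynomial ℕ F) : Dy b y (aeval (tau b) G) = 0 := by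
  induction G using MvPolynomial.induction_on with
  | C a => simp
  | add p q hp hq => rw [map_add, map_add, hp, hq, add_zero]
  | mul_X p n hp => rw [map_mul, Derivation.leibniz, hp, aeval_X, Dy_tau]; simp

lemma eval_aeval' {κ : Type*} (c : ι → F) (t : κ → MvPolynomial ι F) (G : MvPolynomial κ F) :
    eval c (aeval t G) = eval (fun k => eval c (t k)) G := by
  induction G using MvPolynomial.induction_on with
  | C a => simp
  | add p q hp hq => rw [map_add, map_add, map_add, hp, hq]
  | mul_X p n hp => rw [map_mul, map_mul, map_mul, hp, aeval_X, eval_X]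

/-- the value polynomial of the weight `i` on the zero part -/
noncomputable def aW [DecidableEq (Module.Dual F H)] (i : ι) : MvPolynomial ι F :=
  ∑ j, if h : w.wt j = 0 then X j * C (- w.wt i ⟨w.b j, w.zero j h⟩) else 0

lemma lie_bb {i k : ι} (hk : w.wt k = 0) :
    ⁅w.b i, w.b k⁆ = (- w.wt i ⟨w.b k, w.zero k hk⟩) • w.b i := by
  rw [← lie_skew, neg_smul]
  congr 1
  exact w.mem i ⟨w.b k, w.zero k hk⟩

lemma resZ_vf [DecidableEq (Module.Dual F H)] (i j : ι) :
    resZ (fun i => w.wt i = 0) (vf w.b (w.b i) j) =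
      if j = i then resZ (fun i => w.wt i = 0) (aW w i) else 0 := by
  have h1 : resZ (fun i => w.wt i = 0) (vf w.b (w.b i) j) =
      ∑ k, if h : w.wt k = 0 then X k * C (if j = i then - w.wt i ⟨w.b k, w.zero k h⟩ else 0)
        else 0 := by
    rw [vf, map_sum]
    refine Finset.sum_congr rfl fun k _ => ?_
    rw [map_mul, resZ_X]
    by_cases hk : w.wt k = 0
    · rw [if_pos hk, dif_pos hk, lie_bb w hk, map_smul, Finsupp.smul_apply, w.b.repr_self,
        Finsupp.single_apply]
      congr 1
      simp only [resZ, eq_comm (a := i)]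
      split_ifs <;> simp
    · rw [if_neg hk, dif_neg hk, zero_mul]
  rw [h1]
  split_ifs with hji
  · rw [aW, map_sum]
    refine Finset.sum_congr rfl fun k _ => ?_
    by_cases hk : w.wt k = 0
    · simp only [dif_pos hk]
      rw [map_mul, resZ_X, if_pos hk]
      simp [resZ, hji]
    · simp only [dif_neg hk, map_zero]
  · refine Finset.sum_eq_zero fun k _ => ?_
    split_ifs <;> simp

lemma resZ_aW_ne [DecidableEq (Module.Dual F H)] {i : ι} (hi : w.wt i ≠ 0) :
    resZ (fun i => w.wt i = 0) (aW w i) ≠ 0 := by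
  intro h0
  apply hi
  have key : ∀ j (h : w.wt j = 0), w.wt i ⟨w.b j, w.zero j h⟩ = 0 := by
    intro j h
    have h2 := congrArg (eval (Pi.single j 1)) h0
    rw [aW, map_sum, map_sum, Finset.sum_eq_single j] at h2
    · rw [dif_pos h, map_mul, resZ_X, if_pos h] at h2
      simpa [resZ] using h2
    · intro k _ hk
      split_ifs with hk0
      · rw [map_mul, resZ_X, if_pos hk0, map_mul, eval_X, Pi.single_eq_of_ne hk, zero_mul]
      · simp
    · simp
  ext h
  have h3 : (h : H) = ∑ j, if hj : w.wt j = 0 then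
      w.b.repr (h : L) j • (⟨w.b j, w.zero j hj⟩ : H) else 0 := by
    apply Subtype.ext
    conv_lhs => rw [← w.b.sum_repr (h : L)]
    change _ = H.subtype _
    rw [map_sum]
    refine Finset.sum_congr rfl fun j _ => ?_
    split_ifs with hj
    · rfl
    · rw [w.repr_H h.2 hj, zero_smul, map_zero]
  rw [h3, map_sum]
  refine Finset.sum_eq_zero fun j _ => ?_
  split_ifs with hj
  · rw [map_smul, key j hj, smul_zero]
  · simp

include w in
/-- invariants vanishing on `H` vanish identically -/
theorem inv_vanish [Infinite F] (G : MvPolynomial ℕ F)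
    (hG : ∀ h ∈ H, eval (fun k => LinearMap.trace F L ((ad F L h) ^ k)) G = 0) (x : L) :
    eval (fun k => LinearMap.trace F L ((ad F L x) ^ k)) G = 0 := by
  letI : DecidableEq (Module.Dual F H) := Classical.decEq _
  set P : MvPolynomial ι F := aeval (tau w.b) G with hP
  have hev : ∀ c : ι → F, eval c P =
      eval (fun k => LinearMap.trace F L ((ad F L (∑ j, c j • w.b j)) ^ k)) G := by
    intro c
    have : (fun k => LinearMap.trace F L ((ad F L (∑ j, c j • w.b j)) ^ k)) =
      fun k => eval c (tau w.b k) := funext fun k => (eval_tau w.b c k).symm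
    rw [this, hP, eval_aeval']
  have hPz : P = 0 := by
    refine vanish (Z := fun i => w.wt i = 0) P ?_ (fun i j => vf w.b (w.b i) j)
      (fun i => aW w i) ?_ (fun i hi => resZ_aW_ne w hi) ?_ ?_
    · apply MvPolynomial.funext
      intro c
      rw [resZ, eval_aeval', map_zero, hev]
      apply hG
      refine H.toSubmodule.sum_mem fun j _ => ?_
      split_ifs with hj
      · exact H.toSubmodule.smul_mem _ (w.zero j hj)
      · simp
    · intro i hi
      rw [← Dy_eq, hP, Dy_aeval]
    · intro i hi
      rw [map_sub, resZ_vf, if_pos rfl, sub_self]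
    · intro i j hi hj
      rw [resZ_vf, if_neg hj]
  have := hev (w.b.repr x)
  rw [hPz, w.b.sum_repr] at this
  rw [← this]; simp

end WB
end E8P

set_option linter.unusedSectionVars false
set_option linter.style.haveILetI false

namespace E8P
open MvPolynomial

/-- extension of homs along integral extensions -/
lemma lift_integral {F S Ω : Type*} [Field F] [CommRing S] [IsDomain S] [Algebra F S] [Field Ω]
    [IsAlgClosed Ω] [Algebra F Ω] (A : Subalgebra F S) (hA : ∀ s : S, IsIntegral A s)
    (g : A →ₐ[F] Ω) (hg : Function.Injective g) :
    ∃ φ : S →ₐ[F] Ω, ∀ a : A, φ a = g a := by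
  letI : Algebra A Ω := g.toRingHom.toAlgebra
  haveI : Algebra.IsAlgebraic A S := ⟨fun s => (hA s).isAlgebraic⟩
  haveI : Module.IsTorsionFree A Ω := Module.isTorsionFree_iff_algebraMap_injective.2 hg
  haveI : Module.IsTorsionFree A S :=
    Module.isTorsionFree_iff_algebraMap_injective.2 Subtype.val_injective
  let ψ : S →ₐ[A] Ω := IsAlgClosed.lift
  have h1 : ∀ a : A, ψ (a : S) = g a := fun a => ψ.commutes a
  refine ⟨{ ψ.toRingHom with commutes' := ?_ }, h1⟩
  intro r
  have := h1 (algebraMap F A r)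
  rw [g.commutes] at this
  exact this

section Newton
variable {F S ι : Type*} [Field F] [CharZero F] [CommRing S] [Algebra F S] [Fintype ι]

lemma esymm_mem (A : Subalgebra F S) (a : ι → S) (h : ∀ k, ∑ i, a i ^ k ∈ A) (k : ℕ) :
    aeval a (esymm ι F k) ∈ A := by
  classical
  induction k using Nat.strong_induction_on with
  | _ k ih =>
  rcases Nat.eq_zero_or_pos k with rfl | hk
  · simp [esymm_zero]
  have h1 := congrArg (aeval (R := F) a) (mul_esymm_eq_sum ι F k)
  rw [map_mul, map_mul, map_sum] at h1
  have h2 : (k : S) * aeval a (esymm ι F k) ∈ A := by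
    have : (aeval (R := F) a) (k : MvPolynomial ι F) = (k : S) := by simp
    rw [← this, h1]
    refine A.mul_mem (by simp only [map_pow, map_neg, map_one]; exact A.pow_mem (A.neg_mem A.one_mem) _) (A.sum_mem fun c hc => ?_)
    rw [map_mul, map_mul]
    refine A.mul_mem (A.mul_mem (by simp only [map_pow, map_neg, map_one]; exact A.pow_mem (A.neg_mem A.one_mem) _)
      (ih _ (Finset.mem_filter.1 hc).2)) ?_
    rw [psum, map_sum]
    simpa using h c.2
  have h3 := A.smul_mem h2 ((k : F)⁻¹)
  have h4 : (k : S) = algebraMap F S k := by simp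
  rw [h4, ← Algebra.smul_def, smul_smul, inv_mul_cancel₀ (by exact_mod_cast hk.ne'), one_smul] at h3
  exact h3

lemma integral_of_psum [Nontrivial S] (A : Subalgebra F S) (a : ι → S) (h : ∀ k, ∑ i, a i ^ k ∈ A) (i : ι) :
    IsIntegral A (a i) := by
  classical
  let s : Multiset S := Finset.univ.val.map a
  let P : Polynomial S := (s.map fun t => Polynomial.X - Polynomial.C t).prod
  have hP : P.Monic := Polynomial.monic_multiset_prod_of_monic _ _ fun t _ => Polynomial.monic_X_sub_C t
  have hdeg : P.natDegree = Multiset.card s := Polynomial.natDegree_multiset_prod_X_sub_C_eq_card s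
  have hc : ∀ k, P.coeff k ∈ A := by
    intro k
    by_cases hk : k ≤ Multiset.card s
    · rw [Multiset.prod_X_sub_C_coeff s hk]
      refine A.mul_mem (A.pow_mem (A.neg_mem A.one_mem) _) ?_
      have := esymm_mem A a h (Multiset.card s - k)
      rwa [aeval_esymm_eq_multiset_esymm] at this
    · rw [Polynomial.coeff_eq_zero_of_natDegree_lt (by omega)]; exact A.zero_mem
  have hl : P ∈ Polynomial.lifts (algebraMap A S) := by
    rw [Polynomial.lifts_iff_coeff_lifts]
    exact fun n => ⟨⟨_, hc n⟩, rfl⟩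
  obtain ⟨q, hq, -, hm⟩ := Polynomial.lifts_and_natDegree_eq_and_monic hl hP
  refine ⟨q, hm, ?_⟩
  rw [← Polynomial.eval_map, hq, Polynomial.eval_multiset_prod]
  apply Multiset.prod_eq_zero
  simp only [Multiset.map_map, Multiset.mem_map, Function.comp]
  exact ⟨a i, Multiset.mem_map.2 ⟨i, by simp, rfl⟩, by simp⟩
end Newton

lemma psum_range {Ω ι κ : Type*} [Field Ω] [CharZero Ω] [Fintype ι] [Fintype κ] (a : ι → Ω)
    (b : κ → Ω) (h : ∀ k : ℕ, ∑ i, a i ^ k = ∑ j, b j ^ k) : Set.range a ⊆ Set.range b := by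
  classical
  rintro _ ⟨i0, rfl⟩
  by_contra hn
  have hp : ∀ p : Polynomial Ω, ∑ i, p.eval (a i) = ∑ j, p.eval (b j) := by
    intro p
    induction p using Polynomial.induction_on' with
    | add p q hp hq => simp only [Polynomial.eval_add, Finset.sum_add_distrib, hp, hq]
    | monomial n c => simp only [Polynomial.eval_monomial, ← Finset.mul_sum, h]
  let T : Finset Ω := (Finset.univ.image a ∪ Finset.univ.image b).erase (a i0)
  let p : Polynomial Ω := ∏ z ∈ T, (Polynomial.X - Polynomial.C z)
  have hz : ∀ z ∈ T, p.eval z = 0 := by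
    intro z hz
    rw [Polynomial.eval_prod]
    exact Finset.prod_eq_zero hz (by simp)
  have hnz : p.eval (a i0) ≠ 0 := by
    rw [Polynomial.eval_prod, Finset.prod_ne_zero_iff]
    intro z hz
    have := (Finset.mem_erase.1 hz).1
    simpa [sub_eq_zero] using this.symm
  have h1 : ∑ j, p.eval (b j) = 0 := by
    refine Finset.sum_eq_zero fun j _ => hz _ ?_
    refine Finset.mem_erase.2 ⟨fun hj => hn ⟨j, hj⟩, by simp⟩
  have h2 : ∑ i, p.eval (a i) = ∑ i, if a i = a i0 then p.eval (a i0) else 0 := by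
    refine Finset.sum_congr rfl fun i _ => ?_
    split_ifs with hi
    · rw [hi]
    · exact hz _ (Finset.mem_erase.2 ⟨hi, by simp⟩)
  rw [← hp, h2, ← Finset.sum_filter, Finset.sum_const, nsmul_eq_mul] at h1
  rcases mul_eq_zero.1 h1 with h | h
  · have : (Finset.univ.filter fun i => a i = a i0).card = 0 := by exact_mod_cast h
    rw [Finset.card_eq_zero] at this
    have h5 : i0 ∈ (Finset.univ.filter fun i => a i = a i0) := by simp
    rw [this] at h5; simp at h5
  · exact hnz h

section LF
variable {F W : Type*} [Field F] [CharZero F] [AddCommGroup W] [Module F W] {κ : Type*} [Fintype κ]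
  (B : Module.Basis κ F W)

/-- linear form as polynomial -/
noncomputable def lf : Module.Dual F W →ₗ[F] MvPolynomial κ F where
  toFun α := ∑ k, C (α (B k)) * X k
  map_add' α β := by simp [add_mul, Finset.sum_add_distrib]
  map_smul' c α := by simp [Finset.mul_sum, mul_assoc, smul_eq_C_mul]

lemma eval_lf (α : Module.Dual F W) (c : κ → F) : eval c (lf B α) = α (∑ k, c k • B k) := by
  simp [lf, mul_comm]

lemma lf_inj : Function.Injective (lf B) := by
  classical
  intro α β h
  refine B.ext fun k => ?_
  have := congrArg (eval (Pi.single k 1)) h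
  simpa [eval_lf, Pi.single_apply] using this

lemma lf_coord [DecidableEq κ] (k : κ) : lf B (B.coord k) = X k := by
  simp [lf, Finsupp.single_apply]

variable {ι : Type*} [Fintype ι] (wt : ι → Module.Dual F W)

/-- power sums hom -/
noncomputable def fH : MvPolynomial ℕ F →ₐ[F] MvPolynomial κ F :=
  aeval fun k => ∑ i, lf B (wt i) ^ k

/-- vanishing relation -/
def Van (G : MvPolynomial ℕ F) : Prop := ∀ h : W, eval (fun k => ∑ i, wt i h ^ k) G = 0

lemma fH_eq_zero (G : MvPolynomial ℕ F) : fH B wt G = 0 ↔ Van wt G := by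
  have key : ∀ c, eval c (fH B wt G) = eval (fun k => ∑ i, wt i (∑ k, c k • B k) ^ k) G := by
    intro c
    rw [fH]
    induction G using MvPolynomial.induction_on with
    | C a => simp
    | add p q hp hq => rw [map_add, map_add, map_add, hp, hq]
    | mul_X p n hp =>
      rw [map_mul, map_mul, map_mul, hp, aeval_X, eval_X]
      simp [eval_lf]
  constructor
  · intro h x
    have := key (B.repr x)
    rw [B.sum_repr, h, map_zero] at this
    exact this.symm
  · intro h
    apply MvPolynomial.funext
    intro c
    rw [key, map_zero]; exact h _

lemma fH_int (hs : Submodule.span F (Set.range wt) = ⊤) (s : MvPolynomial κ F) :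
    IsIntegral (fH B wt).range s := by
  classical
  have hps : ∀ k, ∑ i, lf B (wt i) ^ k ∈ (fH B wt).range := fun k => ⟨X k, by simp [fH]⟩
  have h1 : ∀ α, IsIntegral (fH B wt).range (lf B α) := by
    intro α
    have : α ∈ Submodule.span F (Set.range wt) := by rw [hs]; trivial
    induction this using Submodule.span_induction with
    | mem x hx => obtain ⟨i, rfl⟩ := hx; exact integral_of_psum _ (fun i => lf B (wt i)) hps i
    | zero => rw [map_zero]; exact isIntegral_zero
    | add x y _ _ hx hy => rw [map_add]; exact hx.add hy
    | smul c x _ hx => rw [map_smul]; exact hx.smul c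
  induction s using MvPolynomial.induction_on with
  | C a =>
    have : (C a : MvPolynomial κ F) = algebraMap (fH B wt).range _ (algebraMap F _ a) := rfl
    rw [this]; exact isIntegral_algebraMap
  | add p q hp hq => exact hp.add hq
  | mul_X p n hp => exact hp.mul (by rw [← lf_coord B]; exact h1 _)
end LF

lemma compare_half {F W1 W2 ι1 ι2 : Type*} [Field F] [CharZero F] [AddCommGroup W1] [Module F W1]
    [AddCommGroup W2] [Module F W2] [FiniteDimensional F W1] [FiniteDimensional F W2]
    [Fintype ι1] [Fintype ι2] (wt1 : ι1 → Module.Dual F W1) (wt2 : ι2 → Module.Dual F W2)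
    (h1 : Submodule.span F (Set.range wt1) = ⊤) (h2 : Submodule.span F (Set.range wt2) = ⊤)
    (hv : ∀ G, Van wt1 G ↔ Van wt2 G) :
    ∃ e : Module.Dual F W2 →ₗ[F] Module.Dual F W1, Function.Surjective e ∧
      e '' (Set.range wt2) = Set.range wt1 := by
  classical
  let B1 := Module.finBasis F W1
  let B2 := Module.finBasis F W2
  let S1 := MvPolynomial (Fin (Module.finrank F W1)) F
  let Ω := AlgebraicClosure (FractionRing S1)
  let ι : S1 →ₐ[F] Ω := IsScalarTower.toAlgHom F S1 Ω
  have hι : Function.Injective ι := by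
    have : Function.Injective (algebraMap S1 Ω) := by
      rw [IsScalarTower.algebraMap_eq S1 (FractionRing S1) Ω]
      exact (algebraMap (FractionRing S1) Ω).injective.comp (IsFractionRing.injective S1 _)
    exact this
  let f2 := (fH B2 wt2).rangeRestrict
  have hf2 : Function.Surjective f2 := (fH B2 wt2).rangeRestrict_surjective
  have hker : ∀ G, f2 G = 0 ↔ fH B1 wt1 G = 0 := by
    intro G
    rw [fH_eq_zero, hv, ← fH_eq_zero B2]
    exact ⟨fun h => congrArg Subtype.val h, fun h => Subtype.ext h⟩
  let g : (fH B2 wt2).range →ₐ[F] Ω := AlgHom.liftOfSurjective f2 hf2 (ι.comp (fH B1 wt1))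
    (by intro G hG
        have hG' : f2 G = 0 := hG
        change ι (fH B1 wt1 G) = 0
        rw [(hker G).1 hG', map_zero])
  have hgf : ∀ G, g (f2 G) = ι (fH B1 wt1 G) := fun G => AlgHom.liftOfSurjective_apply _ _ _ _ G
  have hg : Function.Injective g := by
    rw [injective_iff_map_eq_zero]
    intro a ha
    obtain ⟨G, rfl⟩ := hf2 a
    rw [hgf] at ha
    exact (hker G).2 (hι (by rw [ha, map_zero]))
  obtain ⟨φ, hφ⟩ := lift_integral (fH B2 wt2).range (fH_int B2 wt2 h2) g hg
  have hpow : ∀ k : ℕ, ∑ i, (φ (lf B2 (wt2 i))) ^ k = ∑ i, (ι (lf B1 (wt1 i))) ^ k := by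
    intro k
    have := hφ (f2 (X k))
    rw [hgf] at this
    have h3 : ((f2 (X k) : (fH B2 wt2).range) : MvPolynomial _ F) = ∑ i, lf B2 (wt2 i) ^ k := by
      change fH B2 wt2 (X k) = _
      simp [fH]
    have h4 : fH B1 wt1 (X k) = ∑ i, lf B1 (wt1 i) ^ k := by simp [fH]
    rw [h3, h4] at this
    simpa using this
  haveI : CharZero Ω := charZero_of_injective_algebraMap (algebraMap F Ω).injective
  have hr : Set.range (fun i => φ (lf B2 (wt2 i))) = Set.range (fun i => ι (lf B1 (wt1 i))) :=
    (psum_range _ _ hpow).antisymm (psum_range _ _ fun k => (hpow k).symm)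
  let J : Module.Dual F W1 →ₗ[F] Ω := ι.toLinearMap ∘ₗ lf B1
  have hJ : Function.Injective J := hι.comp (lf_inj B1)
  let K : Module.Dual F W2 →ₗ[F] Ω := φ.toLinearMap ∘ₗ lf B2
  have hr' : K '' Set.range wt2 = J '' Set.range wt1 := by
    rw [← Set.range_comp, ← Set.range_comp]; exact hr
  have hrange : LinearMap.range K = LinearMap.range J := by
    rw [LinearMap.range_eq_map, LinearMap.range_eq_map, ← h1, ← h2, Submodule.map_span,
      Submodule.map_span, hr']
  let e : Module.Dual F W2 →ₗ[F] Module.Dual F W1 :=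
    (LinearEquiv.ofInjective J hJ).symm.toLinearMap ∘ₗ
      (K.codRestrict (LinearMap.range J) fun x => hrange ▸ LinearMap.mem_range_self K x)
  have he : ∀ x, J (e x) = K x := by
    intro x
    have := (LinearEquiv.ofInjective J hJ).apply_symm_apply
      ((K.codRestrict (LinearMap.range J) fun x => hrange ▸ LinearMap.mem_range_self K x) x)
    exact congrArg Subtype.val this
  refine ⟨e, ?_, ?_⟩
  · intro y
    have : J y ∈ LinearMap.range K := by rw [hrange]; exact ⟨y, rfl⟩
    obtain ⟨x, hx⟩ := this
    exact ⟨x, hJ (by rw [he, hx])⟩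
  · apply hJ.image_injective
    rw [← Set.image_comp, ← hr']
    exact Set.image_congr fun x _ => he x

lemma compare {F W1 W2 ι1 ι2 : Type*} [Field F] [CharZero F] [AddCommGroup W1] [Module F W1]
    [AddCommGroup W2] [Module F W2] [FiniteDimensional F W1] [FiniteDimensional F W2]
    [Fintype ι1] [Fintype ι2] (wt1 : ι1 → Module.Dual F W1) (wt2 : ι2 → Module.Dual F W2)
    (h1 : Submodule.span F (Set.range wt1) = ⊤) (h2 : Submodule.span F (Set.range wt2) = ⊤)
    (hv : ∀ G, Van wt1 G ↔ Van wt2 G) :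
    ∃ e : Module.Dual F W2 ≃ₗ[F] Module.Dual F W1, e '' (Set.range wt2) = Set.range wt1 := by
  obtain ⟨e, he, her⟩ := compare_half wt1 wt2 h1 h2 hv
  obtain ⟨e', he', -⟩ := compare_half wt2 wt1 h2 h1 fun G => (hv G).symm
  have h3 := LinearMap.finrank_le_finrank_of_surjective he
  have h4 := LinearMap.finrank_le_finrank_of_surjective he'
  have hf := le_antisymm h4 h3
  have hinj := (LinearMap.injective_iff_surjective_of_finrank_eq_finrank hf).2 he
  exact ⟨LinearEquiv.ofBijective e ⟨hinj, he⟩, her⟩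

end E8P

set_option linter.unusedSectionVars false
set_option linter.style.haveILetI false

namespace E8P
open MvPolynomial LieAlgebra

section A
variable {F L : Type*} [Field F] [CharZero F] [LieRing L] [LieAlgebra F L]
variable {H : LieSubalgebra F L} {ι : Type*} [Fintype ι] [DecidableEq ι] (w : WBasis H ι)

lemma WBasis.pow_apply (h : H) (k : ℕ) (i : ι) : ((ad F L h) ^ k) (w.b i) = (w.wt i h) ^ k • w.b i := by
  induction k with
  | zero => simp
  | succ k ih =>
    rw [pow_succ', Module.End.mul_apply, ih, map_smul, ad_apply, w.mem i h, smul_smul, pow_succ]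

lemma WBasis.trace_pow (h : H) (k : ℕ) :
    LinearMap.trace F L ((ad F L h) ^ k) = ∑ i, w.wt i h ^ k := by
  rw [LinearMap.trace_eq_matrix_trace F w.b, Matrix.trace]
  refine Finset.sum_congr rfl fun i _ => ?_
  rw [Matrix.diag_apply, LinearMap.toMatrix_apply, w.pow_apply]
  simp

lemma WBasis.RS_ne_bot (χ : Module.Dual F H) : RS H χ ≠ ⊥ ↔ χ ∈ Set.range w.wt := by
  constructor
  · intro h
    obtain ⟨x, hx, hx0⟩ := (Submodule.ne_bot_iff _).1 h
    obtain ⟨j, hj⟩ : ∃ j, w.b.repr x j ≠ 0 := by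
      by_contra hc; push Not at hc
      exact hx0 (w.b.repr.injective (by ext j; simp [hc]))
    refine ⟨j, ?_⟩
    ext h
    have := w.repr_lie h x j
    rw [hx h] at this
    simp only [map_smul, Finsupp.smul_apply, smul_eq_mul] at this
    exact (mul_right_cancel₀ hj this).symm
  · rintro ⟨i, rfl⟩
    exact (Submodule.ne_bot_iff _).2 ⟨_, w.mem i, w.b.ne_zero i⟩

lemma WBasis.span [FiniteDimensional F L] (hc : ∀ h ∈ H, (∀ x : L, ⁅h, x⁆ = 0) → h = 0) :
    Submodule.span F (Set.range w.wt) = ⊤ := by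
  have h1 : (Submodule.span F (Set.range w.wt)).dualCoannihilator = ⊥ := by
    rw [eq_bot_iff]
    intro h hh
    rw [Submodule.mem_dualCoannihilator] at hh
    have h2 : ∀ i, w.wt i h = 0 := fun i => hh _ (Submodule.subset_span ⟨i, rfl⟩)
    have h3 : (h : L) = 0 := by
      refine hc _ h.2 fun x => ?_
      refine w.b.repr.injective ?_
      ext j
      rw [w.repr_lie, h2]; simp
    exact (Submodule.mem_bot F).2 (Subtype.ext h3)
  have h4 := Subspace.dualCoannihilator_dualAnnihilator_eq
    (W := Submodule.span F (Set.range w.wt))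
  rw [h1] at h4
  rw [← h4, Submodule.dualAnnihilator_bot]

lemma wbasis_compare [FiniteDimensional F L] (hc : ∀ h : L, (∀ x : L, ⁅h, x⁆ = 0) → h = 0)
    {H' : LieSubalgebra F L} {ι' : Type*} [Fintype ι'] [DecidableEq ι'] (w' : WBasis H' ι') :
    ∃ e : Module.Dual F H' ≃ₗ[F] Module.Dual F H, e '' (Set.range w'.wt) = Set.range w.wt := by
  refine compare w.wt w'.wt (w.span fun h _ => hc h) (w'.span fun h _ => hc h) fun G => ?_
  have k1 : Van w.wt G ↔ ∀ x : L, eval (fun k => LinearMap.trace F L ((ad F L x) ^ k)) G = 0 := by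
    constructor
    · intro h
      refine inv_vanish w G fun x hx => ?_
      have := h ⟨x, hx⟩
      simp only [← w.trace_pow] at this
      exact this
    · intro h x
      have := h x
      simp only [w.trace_pow] at this
      exact this
  have k2 : Van w'.wt G ↔ ∀ x : L, eval (fun k => LinearMap.trace F L ((ad F L x) ^ k)) G = 0 := by
    constructor
    · intro h
      refine inv_vanish w' G fun x hx => ?_
      have := h ⟨x, hx⟩
      simp only [← w'.trace_pow] at this
      exact this
    · intro h x
      have := h x
      simp only [w'.trace_pow] at this
      exact this
  rw [k1, k2]
end A

section B
variable {F L : Type*} [Field F] [CharZero F] [IsAlgClosed F] [LieRing L] [LieAlgebra F L]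
  [FiniteDimensional F L] [IsKilling F L]

variable (F) in
include F in
lemma center_zero (h : L) (hh : ∀ x : L, ⁅h, x⁆ = 0) : h = 0 := by
  have h1 : h ∈ LieAlgebra.center F L := by
    rw [LieModule.mem_maxTrivSubmodule]
    intro x; rw [← lie_skew, hh, neg_zero]
  rw [LieAlgebra.center_eq_bot] at h1
  simpa using h1

lemma csa_ab (H : LieSubalgebra F L) [H.IsCartanSubalgebra] : ∀ x ∈ H, ∀ y ∈ H, ⁅x, y⁆ = 0 := by
  intro x hx y hy
  have := (inferInstance : IsLieAbelian H).trivial ⟨x, hx⟩ ⟨y, hy⟩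
  exact congrArg Subtype.val this

lemma mem_RS_iff (H : LieSubalgebra F L) [H.IsCartanSubalgebra] (χ : Module.Dual F H) (x : L) :
    x ∈ RS H χ ↔ x ∈ rootSpace H χ := by
  constructor
  · intro hx
    rw [LieModule.mem_genWeightSpace]
    intro h
    refine ⟨1, ?_⟩
    rw [pow_one, LinearMap.sub_apply, LieModule.toEnd_apply_apply, LinearMap.smul_apply,
      Module.End.one_apply, sub_eq_zero]
    exact hx h
  · intro hx h
    exact IsKilling.lie_eq_smul_of_mem_rootSpace hx h

lemma exists_WBasis (H : LieSubalgebra F L) [H.IsCartanSubalgebra] :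
    ∃ (ι : Type) (_ : Fintype ι) (_ : DecidableEq ι), Nonempty (WBasis H ι) := by
  classical
  have : Fintype (LieModule.Weight F H L) := Fintype.ofFinite _
  let U : LieModule.Weight F H L → Submodule F L := fun χ => (rootSpace H χ).toSubmodule
  have hU : DirectSum.IsInternal U := by
    rw [DirectSum.isInternal_submodule_iff_iSupIndep_and_iSup_eq_top]
    refine ⟨?_, ?_⟩
    · exact LieSubmodule.iSupIndep_toSubmodule.2 (LieModule.iSupIndep_genWeightSpace' F H L)
    · have := LieModule.iSup_genWeightSpace_eq_top' F H L
      rw [← LieSubmodule.toSubmodule_inj, LieSubmodule.iSup_toSubmodule] at this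
      exact this
  let b := hU.collectedBasis fun χ => Module.finBasis F (U χ)
  let w0 : WBasis H (Σ χ : LieModule.Weight F H L, Fin (Module.finrank F (U χ))) :=
    { b := b
      wt := fun i => i.1.toLinear
      mem := fun i => by
        rw [mem_RS_iff]
        exact hU.collectedBasis_mem _ i
      zero := fun i hi => by
        have h1 : b i ∈ rootSpace H i.1 := hU.collectedBasis_mem _ i
        have h2 : (i.1 : H → F) = 0 := by
          ext h; exact LinearMap.congr_fun hi h
        rw [h2, LieAlgebra.rootSpace_zero_eq] at h1
        exact h1
      ab := csa_ab H }
  let e := Fintype.equivFin (Σ χ : LieModule.Weight F H L, Fin (Module.finrank F (U χ)))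
  exact ⟨Fin _, inferInstance, inferInstance, ⟨{
    b := w0.b.reindex e
    wt := fun i => w0.wt (e.symm i)
    mem := fun i => by simpa using w0.mem (e.symm i)
    zero := fun i hi => by simpa using w0.zero (e.symm i) hi
    ab := w0.ab }⟩⟩

lemma IsE8_transfer (H H' : LieSubalgebra F L) [H.IsCartanSubalgebra] [H'.IsCartanSubalgebra]
    (B' : Module.Basis (Fin 8) F (Module.Dual F H')) (hB : IsE8 B') :
    ∃ B : Module.Basis (Fin 8) F (Module.Dual F H), IsE8 B := by
  obtain ⟨ι, _, _, ⟨w⟩⟩ := exists_WBasis H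
  obtain ⟨ι', _, _, ⟨w'⟩⟩ := exists_WBasis H'
  obtain ⟨e, he⟩ := wbasis_compare w (center_zero F) w'
  have hev : ∀ v, ev (B'.map e) v = e (ev B' v) := by
    intro v; simp [ev]
  refine ⟨B'.map e, fun χ hχ => ?_⟩
  have h2 := hB (e.symm χ) (by simpa using hχ)
  rw [w'.RS_ne_bot] at h2
  rw [w.RS_ne_bot, ← he]
  have h3 : χ ∈ e '' Set.range w'.wt ↔ e.symm χ ∈ Set.range w'.wt := by
    constructor
    · rintro ⟨y, hy, rfl⟩; simpa using hy
    · intro h; exact ⟨_, h, by simp⟩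
  rw [h3, h2]
  refine exists_congr fun v => and_congr_right fun _ => ?_
  rw [hev, LinearEquiv.symm_apply_eq]
end B

/-- Every Cartan subalgebra of `e₈` has a root system of type `E₈`. -/
theorem e8_all (F : Type) [Field F] [CharZero F] [IsAlgClosed F] [Nontrivial (e₈ F)] :
    FiniteDimensional F (e₈ F) ∧ IsKilling F (e₈ F) ∧
    ∀ H : LieSubalgebra F (e₈ F), H.IsCartanSubalgebra →
      ∃ B : Module.Basis (Fin 8) F (Module.Dual F H), IsE8 B := by
  obtain ⟨h1, h2, H', h3, B', hB'⟩ := e8_main F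
  exact ⟨h1, h2, fun H hH => IsE8_transfer H H' B' hB'⟩

end E8P

set_option linter.unusedSectionVars false
set_option linter.style.haveILetI false

namespace E8P

/-- Isometries of the root lattice. -/
def Isom (g : V ≃+ V) : Prop := ∀ v w, Bf (g v) (g w) = Bf v w

lemma Isom.refl : Isom (AddEquiv.refl V) := fun _ _ => rfl

lemma Isom.rt {g : V ≃+ V} (hg : Isom g) (v : V) : g v ∈ Rt ↔ v ∈ Rt := by
  rw [mem_Rt, mem_Rt, hg]

lemma isom_rfE (a : V) (ha : Bf a a = 2) : Isom (rfE a ha) := fun v w => Bf_rf a ha v w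

lemma Isom.trans {g k : V ≃+ V} (hg : Isom g) (hk : Isom k) : Isom (g.trans k) := by
  intro v w
  simp [hk _ _, hg _ _]

lemma hom_sum {A : Type*} [AddCommGroup A] (u : V →+ A) (v : V) : u v = ∑ i, v i • u (sr i) := by
  conv_lhs => rw [sum_sr v]
  rw [map_sum]
  exact Finset.sum_congr rfl fun i _ => map_zsmul _ _ _

lemma hom_ext {A : Type*} [AddCommGroup A] (u u' : V →+ A) (h : ∀ i, u (sr i) = u' (sr i)) :
    u = u' := by
  refine DFunLike.ext _ _ fun v => ?_
  rw [hom_sum u, hom_sum u']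
  simp only [h]

/-- twice the half sum of the positive roots -/
def rho2 : V := ![92, 136, 182, 270, 220, 168, 114, 58]

lemma Bf_rho2 (i : Fin 8) : Bf (sr i) rho2 = 2 := by revert i; decide +kernel

lemma abs_le_sum (u : V →+ ℤ) (β : V) (hβ : β ∈ Rt) : |u β| ≤ ∑ b ∈ Rt, |u b| :=
  Finset.single_le_sum (f := fun b => |u b|) (fun _ _ => abs_nonneg _) hβ

lemma chamber (u : V →+ ℤ) : ∃ g : V ≃+ V, Isom g ∧ ∀ i, 0 ≤ u (g (sr i)) := by
  have key := Int.exists_greatest_of_bdd (P := fun z => ∃ g : V ≃+ V, Isom g ∧ u (g rho2) = z)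
    ?_ ⟨_, AddEquiv.refl V, Isom.refl, rfl⟩
  · obtain ⟨z, ⟨g, hg, rfl⟩, hmax⟩ := key
    refine ⟨g, hg, fun i => ?_⟩
    have := hmax _ ⟨(rfE (sr i) (Bf_sr i)).trans g, (isom_rfE _ _).trans hg, rfl⟩
    have e : ((rfE (sr i) (Bf_sr i)).trans g) rho2 = g (rho2 - (2 : ℤ) • sr i) := by
      show g (rf (sr i) rho2) = _
      rw [rf, Bf_rho2]
    rw [e, map_sub, map_sub, map_zsmul, map_zsmul, smul_eq_mul] at this
    linarith
  · refine ⟨∑ i, rho2 i * ∑ b ∈ Rt, |u b|, ?_⟩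
    rintro z ⟨g, hg, rfl⟩
    have := hom_sum (u.comp g.toAddMonoidHom) rho2
    simp only [AddMonoidHom.comp_apply, AddEquiv.coe_toAddMonoidHom, smul_eq_mul] at this
    rw [show u (g rho2) = _ from this]
    refine Finset.sum_le_sum fun i _ => mul_le_mul_of_nonneg_left ?_ ?_
    · refine (le_abs_self _).trans (abs_le_sum u _ ((hg.rt _).2 ((mem_Rt _).2 (Bf_sr i))))
    · revert i; decide +kernel

/-- fundamental weights -/
def om (i : Fin 8) : V := (![![4, 5, 7, 10, 8, 6, 4, 2], ![5, 8, 10, 15, 12, 9, 6, 3],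
  ![7, 10, 14, 20, 16, 12, 8, 4], ![10, 15, 20, 30, 24, 18, 12, 6], ![8, 12, 16, 24, 20, 15, 10, 5],
  ![6, 9, 12, 18, 15, 12, 8, 4], ![4, 6, 8, 12, 10, 8, 6, 3], ![2, 3, 4, 6, 5, 4, 3, 2]] :
  Fin 8 → Fin 8 → ℤ) i

lemma Bf_om (i j : Fin 8) : Bf (om i) (sr j) = if i = j then 1 else 0 := by
  revert i j; decide +kernel

lemma unimod (u : V →+ ℤ) : ∃ x : V, ∀ v, u v = Bf x v := by
  refine ⟨∑ i, u (sr i) • om i, fun v => ?_⟩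
  rw [hom_sum u v, Bf_comm, Bf_expand]
  refine Finset.sum_congr rfl fun i _ => ?_
  rw [Bf_comm, Bf_sum_left]
  simp only [Bf_smul_left, Bf_om]
  simp

lemma alcove (x : V) (m : ℤ) (hm : 0 < m) : ∃ y : V, ∀ β ∈ Rt, Bf (x + m • y) β ≤ m := by
  obtain ⟨y, hy⟩ : ∃ y : V, ∀ y', Bf (x + m • y) (x + m • y) ≤ Bf (x + m • y') (x + m • y') := by
    have key := Int.exists_least_of_bdd (P := fun z => ∃ y : V, Bf (x + m • y) (x + m • y) = z)
      ⟨0, by rintro z ⟨y, rfl⟩; exact Bf_nonneg _⟩ ⟨_, 0, rfl⟩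
    obtain ⟨z, ⟨y, rfl⟩, h⟩ := key
    exact ⟨y, fun y' => h _ ⟨y', rfl⟩⟩
  refine ⟨y, fun β hβ => ?_⟩
  have h := hy (y - β)
  rw [mem_Rt] at hβ
  have e : x + m • (y - β) = (x + m • y) - m • β := by rw [smul_sub]; abel
  rw [e, Bf_sub_left, Bf_sub_right, Bf_sub_right, Bf_smul_left, Bf_smul_left, Bf_smul_right,
    Bf_smul_right, hβ, Bf_comm β] at h
  by_contra hc
  push Not at hc
  nlinarith

lemma count58 : ∀ s0 ∈ [(0 : ℤ), 1, 2], ∀ s7 ∈ [(0 : ℤ), 1, 2], ∀ s1 ∈ [(0 : ℤ), 1],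
    ∀ s2 ∈ [(0 : ℤ), 1], ∀ s5 ∈ [(0 : ℤ), 1], ∀ s6 ∈ [(0 : ℤ), 1],
    2 * s0 + 3 * s1 + 4 * s2 + 4 * s5 + 3 * s6 + 2 * s7 ≤ 4 →
    rtL.countP (fun v => decide ((s0 * v 0 + s1 * v 1 + s2 * v 2 + s5 * v 5 + s6 * v 6 + s7 * v 7)
      % 4 = 0)) = 58 → s0 = 0 ∧ s1 = 0 ∧ s2 = 1 ∧ s5 = 0 ∧ s6 = 0 ∧ s7 = 0 := by
  decide +kernel

lemma card_isom {g : V ≃+ V} (hg : Isom g) (p : V → Prop) [DecidablePred p] :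
    (Rt.filter p).card = (Rt.filter fun v => p (g v)).card := by
  symm
  refine Finset.card_bij (fun v _ => g v) ?_ ?_ ?_
  · intro v hv
    rw [Finset.mem_filter] at hv ⊢
    exact ⟨(hg.rt _).2 hv.1, hv.2⟩
  · intro a _ b _ h
    exact g.injective h
  · intro v hv
    rw [Finset.mem_filter] at hv
    refine ⟨g.symm v, ?_, by simp⟩
    rw [Finset.mem_filter]
    refine ⟨(hg.rt _).1 (by simpa using hv.1), by simpa using hv.2⟩

lemma kac58 (c : V →+ ZMod 4) (hc : (Rt.filter fun v => c v = 0).card = 58) (f : V →+ ℤ) :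
    ∃ g : V ≃+ V, Isom g ∧ (∀ v, c (g v) = (v 2 : ZMod 4)) ∧ (∀ i, i ≠ 2 → 0 ≤ f (g (sr i))) ∧
      f (g hi) ≤ 0 := by
  obtain ⟨v0, hv0⟩ : ∃ v0 : V →+ ℤ, ∀ v, c v = (v0 v : ZMod 4) := by
    have : ∀ i, ∃ n : ℤ, (n : ZMod 4) = c (sr i) := fun i => ZMod.intCast_surjective _
    choose n hn using this
    refine ⟨{ toFun := fun v => ∑ i, v i * n i
              map_zero' := by simp
              map_add' := fun x y => by
                  simp [add_mul, Finset.sum_add_distrib] }, fun v => ?_⟩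
    rw [hom_sum c v]
    simp [hn]
  set N : ℤ := 1 + ∑ b ∈ Rt, |f b| with hN
  have hNpos : 0 < N := by
    have : 0 ≤ ∑ b ∈ Rt, |f b| := Finset.sum_nonneg fun _ _ => abs_nonneg _
    linarith
  have hfN : ∀ b ∈ Rt, |f b| < N := fun b hb => by
    have := abs_le_sum f b hb
    linarith
  obtain ⟨x, hx⟩ := unimod (N • v0 + f)
  obtain ⟨y, hy⟩ := alcove x (4 * N) (by linarith)
  let s : V →+ ℤ := v0 + { toFun := fun v => 4 * Bf y v, map_zero' := by simp [Bf_zero_right],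
                           map_add' := fun a b => by simp [Bf_add_right, mul_add] }
  have hs : ∀ v, s v = v0 v + 4 * Bf y v := fun v => rfl
  have hcs : ∀ v, c v = (s v : ZMod 4) := fun v => by
    rw [hs, hv0]; push_cast
    rw [show ((4 : ZMod 4)) = 0 from rfl]; simp
  obtain ⟨g, hg, hpos⟩ := chamber (N • s + f)
  have hu : ∀ v, N * s v + f v = Bf (x + (4 * N) • y) v := fun v => by
    rw [Bf_add_left, Bf_smul_left, ← hx, hs]
    simp; ring
  have hpos' : ∀ i, 0 ≤ N * s (g (sr i)) + f (g (sr i)) := fun i => by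
    simpa using hpos i
  have hsr : ∀ i, g (sr i) ∈ Rt := fun i => (hg.rt _).2 ((mem_Rt _).2 (Bf_sr i))
  have hhi : g hi ∈ Rt := (hg.rt _).2 ((mem_Rt _).2 (by decide +kernel))
  have hs0 : ∀ i, 0 ≤ s (g (sr i)) := fun i => by
    have h1 := hpos' i
    have h2 := (abs_lt.1 (hfN _ (hsr i))).2
    by_contra hc
    push Not at hc
    nlinarith
  have hs4 : s (g hi) ≤ 4 := by
    have h1 := hy _ hhi
    rw [← hu] at h1
    have h2 := (abs_lt.1 (hfN _ hhi)).1
    by_contra hc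
    push Not at hc
    nlinarith
  have hexp : ∀ v, s (g v) = ∑ i, v i * s (g (sr i)) := fun v => by
    have := hom_sum (s.comp g.toAddMonoidHom) v
    simpa using this
  have e4 : s (g hi) = 2 * s (g (sr 0)) + 3 * s (g (sr 1)) + 4 * s (g (sr 2)) + 6 * s (g (sr 3))
      + 5 * s (g (sr 4)) + 4 * s (g (sr 5)) + 3 * s (g (sr 6)) + 2 * s (g (sr 7)) := by
    rw [hexp, Fin.sum_univ_eight]; rfl
  have a0 := hs0 0
  have a1 := hs0 1
  have a2 := hs0 2
  have a3 := hs0 3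
  have a4 := hs0 4
  have a5 := hs0 5
  have a6 := hs0 6
  have a7 := hs0 7
  have z3 : s (g (sr 3)) = 0 := by omega
  have z4 : s (g (sr 4)) = 0 := by omega
  have e8 : ∀ v, s (g v) = s (g (sr 0)) * v 0 + s (g (sr 1)) * v 1 + s (g (sr 2)) * v 2
      + s (g (sr 5)) * v 5 + s (g (sr 6)) * v 6 + s (g (sr 7)) * v 7 := fun v => by
    rw [hexp, Fin.sum_univ_eight, z3, z4]; ring
  have hcard : rtL.countP (fun v => decide ((s (g (sr 0)) * v 0 + s (g (sr 1)) * v 1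
      + s (g (sr 2)) * v 2 + s (g (sr 5)) * v 5 + s (g (sr 6)) * v 6 + s (g (sr 7)) * v 7)
      % 4 = 0)) = 58 := by
    rw [← card_filter (fun v => (s (g (sr 0)) * v 0 + s (g (sr 1)) * v 1
      + s (g (sr 2)) * v 2 + s (g (sr 5)) * v 5 + s (g (sr 6)) * v 6 + s (g (sr 7)) * v 7)
      % 4 = 0), ← hc, card_isom hg (fun v => c v = 0)]
    refine congrArg Finset.card (Finset.filter_congr fun v _ => ?_)
    rw [← e8, hcs, ZMod.intCast_zmod_eq_zero_iff_dvd]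
    push_cast
    omega
  have key := count58 (s (g (sr 0))) (by simp; omega) (s (g (sr 7))) (by simp; omega)
    (s (g (sr 1))) (by simp; omega) (s (g (sr 2))) (by simp; omega) (s (g (sr 5)))
    (by simp; omega) (s (g (sr 6))) (by simp; omega) (by omega) hcard
  obtain ⟨k0, k1, k2, k5, k6, k7⟩ := key
  refine ⟨g, hg, fun v => ?_, fun i hi2 => ?_, ?_⟩
  · rw [hcs, e8, k0, k1, k2, k5, k6, k7]; simp
  · have h := hpos' i
    have : s (g (sr i)) = 0 := by
      fin_cases i <;> first | exact absurd rfl hi2 | assumption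
    rw [this] at h; linarith
  · have h := hy _ hhi
    rw [← hu] at h
    have : s (g hi) = 4 := by omega
    rw [this] at h; linarith

lemma indep_simple {g : V ≃+ V} (u : V →+ ℤ) (hw : ∀ v ∈ Rt, g v ∈ Rt)
    (hw' : ∀ v ∈ Rt, g.symm v ∈ Rt) (hu : ∀ v, u (g v) = u v) (hp : ∀ i, 0 < u (sr i)) :
    ∀ i, ∃ j, g (sr i) = sr j := by
  have hpos : ∀ v ∈ Rt, 0 < u v → 0 ≤ v := by
    intro v hv h
    rcases root_sign v ((mem_Rt v).1 hv) with h1 | h1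
    · exact h1
    · exfalso
      rw [hom_sum u v] at h
      have : ∑ i, v i • u (sr i) ≤ 0 := Finset.sum_nonpos fun i _ => by
        have h2 := h1 i
        have h3 := hp i
        simp only [Pi.zero_apply] at h2
        rw [smul_eq_mul]; nlinarith
      linarith
  have hneg : ∀ v ∈ Rt, 0 ≤ v → 0 < u v := by
    intro v hv h
    have h0 : 0 ≤ u v := by
      rw [hom_sum u v]
      exact Finset.sum_nonneg fun i _ => mul_nonneg (h i) (hp i).le
    rcases h0.lt_or_eq with h1 | h1
    · exact h1
    · exfalso
      apply root_ne_zero v ((mem_Rt v).1 hv)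
      rw [hom_sum u v, eq_comm] at h1
      simp only [smul_eq_mul] at h1
      rw [Finset.sum_eq_zero_iff_of_nonneg
        (fun i _ => mul_nonneg (h i) (hp i).le)] at h1
      ext i
      have := h1 i (Finset.mem_univ _)
      rcases mul_eq_zero.1 this with h2 | h2
      · exact h2
      · exact absurd h2 (hp i).ne'
  intro i
  have hi : sr i ∈ Rt := (mem_Rt _).2 (Bf_sr i)
  have h1 := hpos _ (hw _ hi) (by rw [hu]; exact hp i)
  rcases pos_root_split _ ((mem_Rt _).1 (hw _ hi)) h1 with h2 | ⟨j, h2, h3, -⟩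
  · exact h2
  · exfalso
    have husymm : ∀ v, u (g.symm v) = u v := fun v => by rw [← hu, g.apply_symm_apply]
    have hj : sr j ∈ Rt := (mem_Rt _).2 (Bf_sr j)
    have p1 := hpos _ (hw' _ hj) (by rw [husymm]; exact hp j)
    have p2 := hpos _ (hw' _ ((mem_Rt _).2 h2)) (by
      rw [husymm]; exact hneg _ ((mem_Rt _).2 h2) h3)
    have q1 := ht_pos _ p1 (root_ne_zero _ ((mem_Rt _).1 (hw' _ hj)))
    have q2 := ht_pos _ p2 (root_ne_zero _ ((mem_Rt _).1 (hw' _ ((mem_Rt _).2 h2))))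
    rw [map_sub, ht_sub, g.symm_apply_apply, ht_sr] at q2
    linarith

lemma hi_unique : ∀ v ∈ rtL, ht v = 29 → v = hi := by decide +kernel

lemma addE_sum (g : V ≃+ V) (v : V) : g v = ∑ i, v i • g (sr i) := by
  have := hom_sum g.toAddMonoidHom v
  simpa using this

lemma addE_id (g : V ≃+ V) (h : ∀ i, g (sr i) = sr i) (v : V) : g v = v := by
  rw [addE_sum]; simp only [h]; exact (sum_sr v).symm

lemma reg_id_aux {g : V ≃+ V} (u : V →+ ℤ) (hw : ∀ v ∈ Rt, g v ∈ Rt)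
    (hw' : ∀ v ∈ Rt, g.symm v ∈ Rt) (hu : ∀ v, u (g v) = u v) (hp : ∀ i, 0 < u (sr i)) :
    ∀ v, g v = v := by
  choose σ hσ using indep_simple u hw hw' hu hp
  have hinj : Function.Injective σ := fun i j h => by
    have : sr i = sr j := g.injective (by rw [hσ, hσ, h])
    by_contra hne
    have := congrFun this i
    simp [sr, hne] at this
  have e1 : g hi = hi := by
    apply hi_unique
    · rw [mem_rtL, ← mem_Rt]; exact hw _ ((mem_Rt _).2 (by decide +kernel))
    · rw [addE_sum, ht]
      simp only [hσ, Finset.sum_apply]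
      rw [Finset.sum_comm]
      have : ∀ y : Fin 8, ∑ x, (hi y • sr (σ y)) x = hi y := fun y => by
        simp [sr, Pi.single_apply]
      rw [Finset.sum_congr rfl fun y _ => this y]
      decide +kernel
  have hm : ∀ i, hi (σ i) = hi i := fun i => by
    conv_lhs => rw [← e1]
    rw [addE_sum, Finset.sum_apply, Finset.sum_eq_single i]
    · rw [hσ]; simp [sr]
    · intro j _ hj
      have : σ j ≠ σ i := fun h => hj (hinj h)
      rw [hσ]; simp [sr, this.symm]
    · simp
  have hadj : ∀ i j, Bf (sr i + sr j) (sr i + sr j) = 2 →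
      Bf (sr (σ i) + sr (σ j)) (sr (σ i) + sr (σ j)) = 2 := fun i j h => by
    rw [← hσ, ← hσ, ← map_add, ← mem_Rt]
    exact hw _ ((mem_Rt _).2 h)
  have A3 : σ 3 = 3 := (by decide +kernel : ∀ j, hi j = hi 3 → j = 3) _ (hm 3)
  have A4 : σ 4 = 4 := (by decide +kernel : ∀ j, hi j = hi 4 → j = 4) _ (hm 4)
  have A5 : σ 5 = 5 := (by decide +kernel : ∀ j, hi j = hi 5 →
    Bf (sr 4 + sr j) (sr 4 + sr j) = 2 → j = 5) _ (hm 5) (A4 ▸ hadj 4 5 (by decide +kernel))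
  have A6 : σ 6 = 6 := (by decide +kernel : ∀ j, hi j = hi 6 →
    Bf (sr 5 + sr j) (sr 5 + sr j) = 2 → j = 6) _ (hm 6) (A5 ▸ hadj 5 6 (by decide +kernel))
  have A7 : σ 7 = 7 := (by decide +kernel : ∀ j, hi j = hi 7 →
    Bf (sr 6 + sr j) (sr 6 + sr j) = 2 → j = 7) _ (hm 7) (A6 ▸ hadj 6 7 (by decide +kernel))
  have A2 : σ 2 = 2 := (by decide +kernel : ∀ j, hi j = hi 2 →
    Bf (sr 3 + sr j) (sr 3 + sr j) = 2 → j = 2) _ (hm 2) (A3 ▸ hadj 3 2 (by decide +kernel))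
  have A1 : σ 1 = 1 := (by decide +kernel : ∀ j, hi j = hi 1 →
    Bf (sr 3 + sr j) (sr 3 + sr j) = 2 → j = 1) _ (hm 1) (A3 ▸ hadj 3 1 (by decide +kernel))
  have A0 : σ 0 = 0 := (by decide +kernel : ∀ j, hi j = hi 0 →
    Bf (sr 2 + sr j) (sr 2 + sr j) = 2 → j = 0) _ (hm 0) (A2 ▸ hadj 2 0 (by decide +kernel))
  apply addE_id
  intro i
  rw [hσ]
  congr 1
  fin_cases i <;> assumption

lemma reg_id {w : V ≃+ V} (f : V →+ ℤ) (hw : ∀ v ∈ Rt, w v ∈ Rt)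
    (hw' : ∀ v ∈ Rt, w.symm v ∈ Rt) (hu : ∀ v, f (w v) = f v) (hp : ∀ v ∈ Rt, f v ≠ 0) :
    ∀ v, w v = v := by
  obtain ⟨g, hg, hpos⟩ := chamber f
  have hg' : ∀ v ∈ Rt, g.symm v ∈ Rt := fun v hv => (hg.rt _).1 (by simpa using hv)
  have := reg_id_aux (g := (g.trans w).trans g.symm) (f.comp g.toAddMonoidHom) ?_ ?_ ?_ ?_
  · intro v
    have h := this (g.symm v)
    simpa using h
  · intro v hv
    exact hg' _ (hw _ ((hg.rt _).2 hv))
  · intro v hv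
    exact hg' _ (hw' _ ((hg.rt _).2 hv))
  · intro v
    simp [hu]
  · intro i
    exact lt_of_le_of_ne (hpos i) (hp _ ((hg.rt _).2 ((mem_Rt _).2 (Bf_sr i)))).symm

end E8P

set_option linter.unusedSectionVars false
set_option linter.style.haveILetI false

namespace E8P

/-- simple roots of the fixed subalgebra -/
def De (i : Fin 8) : V := if i = 2 then -hi else sr i

/-- coordinates with respect to `De` -/
def co (v : V) (i : Fin 8) : ℤ := if i = 2 then - (v 2 / 4) else v i - (v 2 / 4) * hi i

lemma co_sum (v : V) (h : v 2 % 4 = 0) : v = ∑ i, co v i • De i := by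
  have h4 : v 2 = 4 * (v 2 / 4) := by omega
  ext j
  rw [Fin.sum_univ_eight]
  simp only [Pi.add_apply, Pi.smul_apply, smul_eq_mul]
  fin_cases j <;> simp [co, De, sr, hi] <;> linarith

lemma De_root (i : Fin 8) : De i ∈ Rt ∧ De i 2 % 4 = 0 := by
  rw [mem_Rt]; revert i; decide +kernel

lemma co_sign : ∀ v ∈ rtL, v 2 % 4 = 0 → (∀ i, 0 ≤ co v i) ∨ (∀ i, co v i ≤ 0) := by
  decide +kernel

lemma co_split : ∀ v ∈ rtL, v 2 % 4 = 0 → (∀ i, 0 ≤ co v i) →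
    (∃ i, ∀ j, v j = De i j) ∨
      ∃ i, Bf (v - De i) (v - De i) = 2 ∧ (∀ j, 0 ≤ co (v - De i) j) := by
  decide +kernel

lemma co_ht : ∀ v ∈ rtL, v 2 % 4 = 0 → (∀ i, 0 ≤ co v i) → 0 < ∑ i, co v i := by
  decide +kernel

lemma co_De : ∀ i, ∑ j, co (De i) j = 1 := by decide +kernel

/-- adjacency for the `De` diagram -/
def adj (i j : Fin 8) : Bool := decide (Bf (De i + De j) (De i + De j) = 2)

set_option synthInstance.maxHeartbeats 400000 in
set_option synthInstance.maxSize 3000 in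
lemma path_aux : ∀ a b, adj a b = true → ∀ c, c ≠ a → adj b c = true → ∀ d, d ≠ b →
    adj c d = true → ∀ e, e ≠ c → adj d e = true → ∀ f, f ≠ d → adj e f = true →
    ∀ g, g ≠ e → adj f g = true →
    (a = 2 ∧ b = 7 ∧ c = 6 ∧ d = 5 ∧ e = 4 ∧ f = 3 ∧ g = 1) ∨
    (a = 1 ∧ b = 3 ∧ c = 4 ∧ d = 5 ∧ e = 6 ∧ f = 7 ∧ g = 2) := by
  decide +kernel

lemma co_add (u v : V) (hu : u 2 % 4 = 0) (hv : v 2 % 4 = 0) (i : Fin 8) :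
    co (u + v) i = co u i + co v i := by
  have : (u 2 + v 2) / 4 = u 2 / 4 + v 2 / 4 := by omega
  unfold co
  split_ifs
  · simp only [Pi.add_apply, this]; ring
  · simp only [Pi.add_apply, this]; ring

lemma sub_simple {g : V ≃+ V} (u : V →+ ℤ) (hw : ∀ v ∈ Rt, g v ∈ Rt)
    (hw' : ∀ v ∈ Rt, g.symm v ∈ Rt) (hc : ∀ v, ((g v) 2 - v 2) % 4 = 0)
    (hu : ∀ v, u (g v) = u v) (hp : ∀ i, 0 < u (De i)) :
    ∀ i, ∃ j, g (De i) = De j := by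
  have hexp : ∀ v : V, v 2 % 4 = 0 → u v = ∑ i, co v i * u (De i) := fun v hv => by
    conv_lhs => rw [co_sum v hv]
    rw [map_sum]
    exact Finset.sum_congr rfl fun i _ => by rw [map_zsmul, smul_eq_mul]
  have hpos : ∀ v ∈ Rt, v 2 % 4 = 0 → 0 < u v → ∀ i, 0 ≤ co v i := by
    intro v hv h2 h
    rcases co_sign v ((mem_rtL v).2 ((mem_Rt v).1 hv)) h2 with h1 | h1
    · exact h1
    · exfalso
      rw [hexp v h2] at h
      have : ∑ i, co v i * u (De i) ≤ 0 := Finset.sum_nonpos fun i _ => by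
        have h2 := h1 i
        have h3 := hp i
        nlinarith
      linarith
  have hneg : ∀ v ∈ Rt, v 2 % 4 = 0 → (∀ i, 0 ≤ co v i) → 0 < u v := by
    intro v hv h2 h
    have h0 := co_ht v ((mem_rtL v).2 ((mem_Rt v).1 hv)) h2 h
    obtain ⟨i, -, hi⟩ := Finset.exists_lt_of_sum_lt (f := fun _ => (0 : ℤ)) (by simpa using h0)
    rw [hexp v h2]
    refine Finset.sum_pos' (fun i _ => mul_nonneg (h i) (hp i).le) ⟨i, Finset.mem_univ _, ?_⟩
    exact mul_pos hi (hp i)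
  have hc' : ∀ v, ((g.symm v) 2 - v 2) % 4 = 0 := fun v => by
    have := hc (g.symm v)
    rw [g.apply_symm_apply] at this
    omega
  have husymm : ∀ v, u (g.symm v) = u v := fun v => by rw [← hu, g.apply_symm_apply]
  intro i
  obtain ⟨d1, d2⟩ := De_root i
  have g1 := hw _ d1
  have g2 : (g (De i)) 2 % 4 = 0 := by have := hc (De i); omega
  have h1 := hpos _ g1 g2 (by rw [hu]; exact hp i)
  rcases co_split _ ((mem_rtL _).2 ((mem_Rt _).1 g1)) g2 h1 with ⟨j, hj⟩ | ⟨j, h2, h3⟩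
  · exact ⟨j, funext hj⟩
  · exfalso
    obtain ⟨j1, j2⟩ := De_root j
    have k1 : (g (De i) - De j) ∈ Rt := (mem_Rt _).2 h2
    have k2 : (g (De i) - De j) 2 % 4 = 0 := by rw [Pi.sub_apply]; omega
    have a2 : (g.symm (De j)) 2 % 4 = 0 := by have := hc' (De j); omega
    have b2 : (g.symm (g (De i) - De j)) 2 % 4 = 0 := by
      have := hc' (g (De i) - De j); omega
    have p1 := hpos _ (hw' _ j1) a2 (by rw [husymm]; exact hp j)
    have p2 := hpos _ (hw' _ k1) b2 (by rw [husymm]; exact hneg _ k1 k2 h3)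
    have q1 := co_ht _ ((mem_rtL _).2 ((mem_Rt _).1 (hw' _ j1))) a2 p1
    have q2 := co_ht _ ((mem_rtL _).2 ((mem_Rt _).1 (hw' _ k1))) b2 p2
    have e : De i = g.symm (De j) + g.symm (g (De i) - De j) := by
      rw [← map_add]; simp
    have := co_De i
    rw [e] at this
    simp only [co_add _ _ a2 b2, Finset.sum_add_distrib] at this
    omega

lemma sub_id_aux {g : V ≃+ V} (u : V →+ ℤ) (hw : ∀ v ∈ Rt, g v ∈ Rt)
    (hw' : ∀ v ∈ Rt, g.symm v ∈ Rt) (hc : ∀ v, ((g v) 2 - v 2) % 4 = 0)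
    (hu : ∀ v, u (g v) = u v) (hp : ∀ i, 0 < u (De i)) :
    ∀ v, g v = v := by
  choose σ hσ using sub_simple u hw hw' hc hu hp
  have Dinj : ∀ i j, De i = De j → i = j := by decide +kernel
  have hinj : Function.Injective σ := fun i j h => Dinj _ _ (g.injective (by rw [hσ, hσ, h]))
  have hadj : ∀ i j, adj i j = true → adj (σ i) (σ j) = true := fun i j h => by
    rw [adj, decide_eq_true_iff] at h ⊢
    rw [← hσ, ← hσ, ← map_add, ← mem_Rt]
    exact hw _ ((mem_Rt _).2 h)
  have hhi := addE_sum g hi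
  rw [Fin.sum_univ_eight] at hhi
  have hne : ∀ i j, i ≠ j → σ i ≠ σ j := fun i j h h' => h (hinj h')
  have hD : ∀ i, i ≠ 2 → g (sr i) = De (σ i) := fun i h => by
    rw [← hσ]; simp [De, h]
  have hD2 : g hi = - De (σ 2) := by
    rw [← hσ]; simp [De]
  rw [hD2, hD 0 (by decide), hD 1 (by decide), hD 3 (by decide), hD 4 (by decide),
    hD 5 (by decide), hD 6 (by decide), hD 7 (by decide)] at hhi
  rcases path_aux (σ 2) (σ 7) (hadj 2 7 (by decide +kernel)) (σ 6) (hne _ _ (by decide))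
    (hadj _ _ (by decide +kernel)) (σ 5) (hne _ _ (by decide)) (hadj _ _ (by decide +kernel))
    (σ 4) (hne _ _ (by decide)) (hadj _ _ (by decide +kernel)) (σ 3) (hne _ _ (by decide))
    (hadj _ _ (by decide +kernel)) (σ 1) (hne _ _ (by decide)) (hadj _ _ (by decide +kernel))
    with ⟨h2, h7, h6, h5, h4, h3, h1⟩ | ⟨h2, h7, h6, h5, h4, h3, h1⟩
  · have h0 : σ 0 = 0 := by
      have n1 := hne 0 1 (by decide)
      have n2 := hne 0 2 (by decide)
      have n3 := hne 0 3 (by decide)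
      have n4 := hne 0 4 (by decide)
      have n5 := hne 0 5 (by decide)
      have n6 := hne 0 6 (by decide)
      have n7 := hne 0 7 (by decide)
      rw [h1] at n1; rw [h2] at n2; rw [h3] at n3; rw [h4] at n4; rw [h5] at n5
      rw [h6] at n6; rw [h7] at n7
      generalize σ 0 = x at *
      omega
    apply addE_id
    intro i
    by_cases hi2 : i = 2
    · subst hi2
      rw [h0, h1, h2, h3, h4, h5, h6, h7] at hhi
      ext j
      have := congrFun hhi j
      simp only [Pi.add_apply, Pi.smul_apply, smul_eq_mul] at this
      revert this
      generalize g (sr 2) = z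
      fin_cases j <;> simp [De, sr, hi] <;> intro h <;> omega
    · rw [hD i hi2]
      have : σ i = i := by fin_cases i <;> first | assumption | exact absurd rfl hi2
      rw [this]; simp [De, hi2]
  · exfalso
    have h0 : σ 0 = 0 := by
      have n1 := hne 0 1 (by decide)
      have n2 := hne 0 2 (by decide)
      have n3 := hne 0 3 (by decide)
      have n4 := hne 0 4 (by decide)
      have n5 := hne 0 5 (by decide)
      have n6 := hne 0 6 (by decide)
      have n7 := hne 0 7 (by decide)
      rw [h1] at n1; rw [h2] at n2; rw [h3] at n3; rw [h4] at n4; rw [h5] at n5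
      rw [h6] at n6; rw [h7] at n7
      generalize σ 0 = x at *
      omega
    rw [h0, h1, h2, h3, h4, h5, h6, h7] at hhi
    have := congrFun hhi 2
    simp only [Pi.add_apply, Pi.smul_apply, smul_eq_mul] at this
    have hc2 := hc (sr 2)
    revert this hc2
    generalize g (sr 2) = z
    simp [De, sr, hi]
    intro h h'
    omega

lemma sub_id (c : V →+ ZMod 4) (hc : (Rt.filter fun v => c v = 0).card = 58) (w : V ≃+ V)
    (f : V →+ ℤ) (hw : ∀ v ∈ Rt, w v ∈ Rt) (hw' : ∀ v ∈ Rt, w.symm v ∈ Rt)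
    (hwc : ∀ v, c (w v) = c v) (hu : ∀ v, f (w v) = f v)
    (hp : ∀ v ∈ Rt, c v = 0 → f v ≠ 0) :
    (∀ v, w v = v) ∧ ∃ g : V ≃+ V, Isom g ∧ ∀ v, c (g v) = (v 2 : ZMod 4) := by
  obtain ⟨g, hg, hgc, hpos, hneg⟩ := kac58 c hc f
  refine ⟨?_, g, hg, hgc⟩
  have hg' : ∀ v ∈ Rt, g.symm v ∈ Rt := fun v hv => (hg.rt _).1 (by simpa using hv)
  have := sub_id_aux (g := (g.trans w).trans g.symm) (f.comp g.toAddMonoidHom) ?_ ?_ ?_ ?_ ?_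
  · intro v
    have h := this (g.symm v)
    simpa using h
  · intro v hv
    exact hg' _ (hw _ ((hg.rt _).2 hv))
  · intro v hv
    exact hg' _ (hw' _ ((hg.rt _).2 hv))
  · intro v
    have h1 := hgc ((g.trans w).trans g.symm v)
    have h2 := hgc v
    rw [show g (((g.trans w).trans g.symm) v) = w (g v) by simp, hwc, h2] at h1
    have h3 := (ZMod.intCast_eq_intCast_iff_dvd_sub _ _ _).1 h1
    push_cast at h3
    omega
  · intro v
    simp [hu]
  · intro i
    obtain ⟨d1, d2⟩ := De_root i
    have n0 : f (g (De i)) ≠ 0 := hp _ ((hg.rt _).2 d1) (by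
      rw [hgc, ZMod.intCast_zmod_eq_zero_iff_dvd]; push_cast; omega)
    refine lt_of_le_of_ne ?_ n0.symm
    show 0 ≤ f (g (De i))
    unfold De
    split_ifs with h
    · rw [map_neg, map_neg]; linarith
    · exact hpos i h

lemma a1_check : ∀ v ∈ rtL, v 2 % 4 = 0 → (∀ u ∈ rtL, u 2 % 4 = 0 → Bf (v + u) (v + u) ≠ 2) →
    (∀ j, v j = sr 0 j) ∨ (∀ j, v j = (- sr 0) j) := by
  decide +kernel

lemma a1_orth : ∀ u ∈ rtL, u 2 % 4 = 0 → Bf (u + sr 0) (u + sr 0) ≠ 2 ∧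
    Bf (u - sr 0) (u - sr 0) ≠ 2 := by
  decide +kernel

lemma a7_split : ∀ v ∈ rtL, v 2 % 4 = 0 → (∀ j, v j = sr 0 j) ∨ (∀ j, v j = (- sr 0) j) ∨
    ∃ u ∈ rtL, u 2 % 4 = 0 ∧ Bf (v - u) (v - u) = 2 ∧ (∃ j, u j ≠ -v j) ∧ ∃ j, u j ≠ 2 * v j := by
  decide +kernel

/-- A functional not vanishing on finitely many given non-zero vectors. -/
lemma generic (s : Finset V) (h : ∀ v ∈ s, v ≠ 0) : ∃ f : V →+ ℤ, ∀ v ∈ s, f v ≠ 0 := by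
  classical
  induction s using Finset.induction_on with
  | empty => exact ⟨0, by simp⟩
  | insert a s ha ih =>
    obtain ⟨f, hf⟩ := ih fun v hv => h v (Finset.mem_insert_of_mem hv)
    by_cases hfa : f a = 0
    · have : ∃ i, a i ≠ 0 := by
        by_contra hc
        push Not at hc
        exact h a (Finset.mem_insert_self _ _) (funext hc)
      obtain ⟨i, hi⟩ := this
      let N : ℤ := 1 + ∑ v ∈ s, |v i|
      refine ⟨N • f + Pi.evalAddMonoidHom (fun _ => ℤ) i, fun v hv => ?_⟩
      have e : (N • f + Pi.evalAddMonoidHom (fun _ => ℤ) i) v = N * f v + v i := rfl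
      rw [e]
      rcases Finset.mem_insert.1 hv with rfl | hv
      · rw [hfa]; simpa using hi
      · have h1 : |v i| ≤ ∑ v ∈ s, |v i| :=
          Finset.single_le_sum (f := fun v : V => |v i|) (fun _ _ => abs_nonneg _) hv
        have h2 : |v i| < N := by omega
        intro h0
        have h3 : |v i| = N * |f v| := by
          have : v i = - (N * f v) := by linarith
          rw [this, abs_neg, abs_mul, abs_of_pos (a := N)]
          exact lt_of_le_of_lt (abs_nonneg _) h2
        have h4 := abs_pos.2 (hf v hv)
        have h5 : N * 1 ≤ N * |f v| :=
          mul_le_mul_of_nonneg_left (by omega) ((abs_nonneg _).trans h2.le)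
        linarith
    · refine ⟨f, fun v hv => ?_⟩
      rcases Finset.mem_insert.1 hv with rfl | hv
      · exact hfa
      · exact hf v hv

end E8P

set_option linter.unusedSectionVars false
set_option linter.style.haveILetI false

namespace E8P

open Finset in
/-- `ε_i - ε_7` -/
def ep (i : Fin 8) : V :=
  (![-hi + sr 7 + sr 6 + sr 5 + sr 4 + sr 3 + sr 1, sr 7 + sr 6 + sr 5 + sr 4 + sr 3 + sr 1,
    sr 6 + sr 5 + sr 4 + sr 3 + sr 1, sr 5 + sr 4 + sr 3 + sr 1, sr 4 + sr 3 + sr 1, sr 3 + sr 1,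
    sr 1, 0] : Fin 8 → V) i

def kp : V := sr 0 + sr 2 - ep 6

def S2 : Finset (Finset (Fin 8)) := Finset.powersetCard 2 Finset.univ
def S4 : Finset (Finset (Fin 8)) := Finset.powersetCard 4 Finset.univ
def P2 : Finset (Fin 8 × Fin 8) := Finset.univ.filter fun p => p.1 ≠ p.2

/-- the root list in `A₁ + A₇` coordinates -/
def rtM : Multiset V :=
  ({sr 0, -sr 0} : Multiset V) + P2.val.map (fun p => ep p.1 - ep p.2)
    + S2.val.map (fun s => kp + ∑ i ∈ s, ep i) + S2.val.map (fun s => kp - sr 0 + ∑ i ∈ s, ep i)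
    + S2.val.map (fun s => -(kp + ∑ i ∈ s, ep i))
    + S2.val.map (fun s => -(kp - sr 0 + ∑ i ∈ s, ep i))
    + S4.val.map (fun s => kp + kp - sr 0 + ∑ i ∈ s, ep i)

lemma rtM_eq : (rtL : Multiset V) = rtM := by decide +kernel

end E8P

set_option linter.unusedSectionVars false
set_option linter.style.haveILetI false

namespace E8P

lemma card_perm (n : ℕ) (P : ZMod 4 → Prop) [DecidablePred P] (s : Fin 8 → ZMod 4)
    (π : Equiv.Perm (Fin 8)) :
    ((Finset.powersetCard n Finset.univ).filter fun S : Finset (Fin 8) =>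
      P (∑ i ∈ S, s (π i))).card =
    ((Finset.powersetCard n Finset.univ).filter fun S : Finset (Fin 8) =>
      P (∑ i ∈ S, s i)).card := by
  refine Finset.card_bij (fun S _ => S.map π.toEmbedding) ?_ ?_ ?_
  · intro S hS
    simp only [Finset.mem_filter, Finset.mem_powersetCard_univ, Finset.card_map,
      Finset.sum_map] at hS ⊢
    exact hS
  · intro a _ b _ h
    exact Finset.map_injective _ h
  · intro S hS
    refine ⟨S.map π.symm.toEmbedding, ?_, ?_⟩
    · simp only [Finset.mem_filter, Finset.mem_powersetCard_univ, Finset.card_map,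
        Finset.sum_map] at hS ⊢
      simpa using hS
    · ext x; simp

lemma card_perm2 (s : Fin 8 → ZMod 4) (π : Equiv.Perm (Fin 8)) :
    (P2.filter fun p => s (π p.1) - s (π p.2) = 0).card
      = (P2.filter fun p => s p.1 - s p.2 = 0).card := by
  refine Finset.card_bij (fun p _ => (π p.1, π p.2)) ?_ ?_ ?_
  · intro p hp
    simpa [P2] using hp
  · rintro ⟨a, b⟩ _ ⟨c, d⟩ _ h
    simpa using h
  · rintro ⟨a, b⟩ h
    refine ⟨(π.symm a, π.symm b), ?_, by simp⟩
    simpa [P2] using h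

def s00 : Fin 8 → ZMod 4 := ![0, 0, 1, 1, 2, 2, 3, 3]

lemma exists_perm (s : Fin 8 → ZMod 4) (h : ∀ z, (Finset.univ.filter fun i => s i = z).card = 2) :
    ∃ π : Equiv.Perm (Fin 8), ∀ i, s (π i) = s00 i := by
  have h0 : ∀ z, (Finset.univ.filter fun i => s00 i = z).card = 2 := by decide +kernel
  have e : ∀ z, Nonempty ({i // s00 i = z} ≃ {i // s i = z}) := fun z => by
    apply Fintype.card_eq.1
    rw [Fintype.card_subtype, Fintype.card_subtype, h, h0]
  have e := fun z => Classical.choice (e z)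
  let π : Fin 8 ≃ Fin 8 := (Equiv.sigmaFiberEquiv s00).symm.trans
    ((Equiv.sigmaCongrRight fun z => (e z)).trans (Equiv.sigmaFiberEquiv s))
  exact ⟨π, fun i => (e (s00 i) ⟨i, rfl⟩).2⟩

def cnt (τ : ZMod 4) (s : Fin 8 → ZMod 4) : ℕ :=
  (P2.filter fun p => s p.1 - s p.2 = 0).card
    + (S2.filter fun S => τ + ∑ i ∈ S, s i = 0).card
    + (S2.filter fun S => τ - 2 + ∑ i ∈ S, s i = 0).card
    + (S2.filter fun S => τ + ∑ i ∈ S, s i = 0).card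
    + (S2.filter fun S => τ - 2 + ∑ i ∈ S, s i = 0).card
    + (S4.filter fun S => τ + τ - 2 + ∑ i ∈ S, s i = 0).card

lemma cnt_s00 : cnt 0 s00 = 52 ∧ cnt 2 s00 = 52 := by decide +kernel

lemma cnt_eq (τ : ZMod 4) (hτ : τ = 0 ∨ τ = 2) (s : Fin 8 → ZMod 4)
    (h : ∀ z, (Finset.univ.filter fun i => s i = z).card = 2) : cnt τ s = 52 := by
  obtain ⟨π, hπ⟩ := exists_perm s h
  have : cnt τ s = cnt τ s00 := by
    have e : s00 = fun i => s (π i) := funext fun i => (hπ i).symm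
    rw [e]
    unfold cnt S2 S4
    rw [card_perm2, card_perm 2 (fun z => τ + z = 0) s π, card_perm 2 (fun z => τ - 2 + z = 0) s π,
      card_perm 4 (fun z => τ + τ - 2 + z = 0) s π]
  rw [this]
  rcases hτ with rfl | rfl
  · exact cnt_s00.1
  · exact cnt_s00.2

open Classical in
lemma count52 {A : Type*} [AddCommGroup A] (ι : ZMod 4 →+ A) (hι : Function.Injective ι)
    (u : V →+ A) (s : Fin 8 → ZMod 4) (τ : ZMod 4) (hτ : τ = 0 ∨ τ = 2)
    (h : ∀ z, (Finset.univ.filter fun i => s i = z).card = 2)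
    (h1 : ∀ i, u (ep i) = ι (s i - s 7)) (h2 : u kp = ι (τ + 2 * s 7)) (h3 : u (sr 0) = ι 2) :
    (Rt.filter fun v => u v = 0).card = 52 ∧ (∀ v, (4 : ℤ) • u v = 0) ∧ ∃ v, (2 : ℤ) • u v ≠ 0 := by
  have hz : ∀ z, ι z = 0 ↔ z = 0 := fun z => map_eq_zero_iff ι hι
  have hsum : ∀ S : Finset (Fin 8), u (∑ i ∈ S, ep i) = ι (∑ i ∈ S, s i - S.card * s 7) := by
    intro S
    rw [map_sum, Finset.sum_congr rfl fun i _ => h1 i, ← map_sum, Finset.sum_sub_distrib]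
    simp
  have hS2 : ∀ S ∈ S2, S.card = 2 := fun S hS => (Finset.mem_powersetCard.1 hS).2
  have hS4 : ∀ S ∈ S4, S.card = 4 := fun S hS => (Finset.mem_powersetCard.1 hS).2
  refine ⟨?_, ?_, ?_⟩
  · rw [← cnt_eq τ hτ s h]
    have e0 : (Rt.filter fun v => u v = 0).card = Multiset.countP (fun v => u v = 0) rtM := by
      rw [← rtM_eq, card_filter, Multiset.coe_countP]
    rw [e0, rtM]
    simp only [Multiset.countP_add, Multiset.countP_map]
    have c0 : Multiset.countP (fun v => u v = 0) ({sr 0, -sr 0} : Multiset V) = 0 := by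
      rw [Multiset.countP_eq_zero]
      intro a ha
      have h20 : ι 2 ≠ 0 := by rw [Ne, hz]; decide
      simp only [Multiset.insert_eq_cons, Multiset.mem_cons, Multiset.mem_singleton] at ha
      rcases ha with rfl | rfl
      · rw [h3]; exact h20
      · rw [map_neg, h3, neg_eq_zero]; exact h20
    rw [c0, zero_add]
    unfold cnt
    refine congrArg₂ HAdd.hAdd (congrArg₂ HAdd.hAdd (congrArg₂ HAdd.hAdd (congrArg₂ HAdd.hAdd
      (congrArg₂ HAdd.hAdd ?_ ?_) ?_) ?_) ?_) ?_
    · refine congrArg Multiset.card (Multiset.filter_congr fun p _ => ?_)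
      rw [map_sub, h1, h1, ← map_sub, hz]
      simp
    · refine congrArg Multiset.card (Multiset.filter_congr fun S hS => ?_)
      rw [map_add, hsum, h2, ← map_add, hz, hS2 S hS]
      push_cast
      rw [show τ + 2 * s 7 + (∑ i ∈ S, s i - 2 * s 7) = τ + ∑ i ∈ S, s i by ring]
    · refine congrArg Multiset.card (Multiset.filter_congr fun S hS => ?_)
      rw [map_add, map_sub, hsum, h2, h3, ← map_sub, ← map_add, hz, hS2 S hS]
      push_cast
      rw [show τ + 2 * s 7 - 2 + (∑ i ∈ S, s i - 2 * s 7) = τ - 2 + ∑ i ∈ S, s i by ring]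
    · refine congrArg Multiset.card (Multiset.filter_congr fun S hS => ?_)
      rw [map_neg, neg_eq_zero, map_add, hsum, h2, ← map_add, hz, hS2 S hS]
      push_cast
      rw [show τ + 2 * s 7 + (∑ i ∈ S, s i - 2 * s 7) = τ + ∑ i ∈ S, s i by ring]
    · refine congrArg Multiset.card (Multiset.filter_congr fun S hS => ?_)
      rw [map_neg, neg_eq_zero, map_add, map_sub, hsum, h2, h3, ← map_sub, ← map_add, hz, hS2 S hS]
      push_cast
      rw [show τ + 2 * s 7 - 2 + (∑ i ∈ S, s i - 2 * s 7) = τ - 2 + ∑ i ∈ S, s i by ring]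
    · refine congrArg Multiset.card (Multiset.filter_congr fun S hS => ?_)
      rw [map_add, map_sub, map_add, hsum, h2, h3, ← map_add, ← map_sub, ← map_add, hz, hS4 S hS]
      push_cast
      rw [show τ + 2 * s 7 + (τ + 2 * s 7) - 2 + (∑ i ∈ S, s i - 4 * s 7)
        = τ + τ - 2 + ∑ i ∈ S, s i by ring]
  · have k4 : ∀ z, (4 : ℤ) • ι z = 0 := fun z => by
      rw [← map_zsmul, hz, zsmul_eq_mul]
      exact mul_eq_zero_of_left (by decide) _
    have key : ∀ i, ∃ z, u (sr i) = ι z := by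
      have e1 : u (sr 1) = ι (s 6 - s 7) := h1 6
      have e3 : sr 3 = ep 5 - ep 6 := by decide +kernel
      have e4 : sr 4 = ep 4 - ep 5 := by decide +kernel
      have e5 : sr 5 = ep 3 - ep 4 := by decide +kernel
      have e6 : sr 6 = ep 2 - ep 3 := by decide +kernel
      have e7 : sr 7 = ep 1 - ep 2 := by decide +kernel
      have e2 : sr 2 = kp - sr 0 + ep 6 := by decide +kernel
      intro i
      fin_cases i
      · exact ⟨_, h3⟩
      · exact ⟨_, e1⟩
      · refine ⟨τ + 2 * s 7 - 2 + (s 6 - s 7), ?_⟩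
        show u (sr 2) = _
        rw [e2, map_add, map_sub, h1, h2, h3, ← map_sub, ← map_add]
      · refine ⟨(s 5 - s 7) - (s 6 - s 7), ?_⟩
        show u (sr 3) = _
        rw [e3, map_sub, h1, h1, ← map_sub]
      · refine ⟨(s 4 - s 7) - (s 5 - s 7), ?_⟩
        show u (sr 4) = _
        rw [e4, map_sub, h1, h1, ← map_sub]
      · refine ⟨(s 3 - s 7) - (s 4 - s 7), ?_⟩
        show u (sr 5) = _
        rw [e5, map_sub, h1, h1, ← map_sub]
      · refine ⟨(s 2 - s 7) - (s 3 - s 7), ?_⟩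
        show u (sr 6) = _
        rw [e6, map_sub, h1, h1, ← map_sub]
      · refine ⟨(s 1 - s 7) - (s 2 - s 7), ?_⟩
        show u (sr 7) = _
        rw [e7, map_sub, h1, h1, ← map_sub]
    intro v
    rw [hom_sum u v, Finset.smul_sum]
    refine Finset.sum_eq_zero fun i _ => ?_
    obtain ⟨z, hz'⟩ := key i
    rw [hz', smul_comm, k4, smul_zero]
  · obtain ⟨i, hi⟩ : ∃ i, s i = 0 := by
      have := h 0
      have h' : (Finset.univ.filter fun i => s i = 0).Nonempty := by
        rw [← Finset.card_pos, this]; norm_num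
      obtain ⟨i, hi⟩ := h'
      exact ⟨i, (Finset.mem_filter.1 hi).2⟩
    obtain ⟨j, hj⟩ : ∃ i, s i = 1 := by
      have := h 1
      have h' : (Finset.univ.filter fun i => s i = 1).Nonempty := by
        rw [← Finset.card_pos, this]; norm_num
      obtain ⟨i, hi⟩ := h'
      exact ⟨i, (Finset.mem_filter.1 hi).2⟩
    refine ⟨ep j - ep i, ?_⟩
    rw [map_sub, h1, h1, ← map_sub, hi, hj, ← map_zsmul, Ne, hz]
    rw [show (1 - s 7 - (0 - s 7)) = 1 by ring]
    decide

end E8P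

set_option linter.unusedSectionVars false
set_option linter.style.haveILetI false

namespace E8P

section numalg
variable {F : Type*} [Field F] [CharZero F]

lemma sum_fib {A : Type*} [AddCommMonoid A] (s : Fin 8 → ZMod 4) (f : ZMod 4 → A) :
    ∑ k, f (s k) = ∑ z, (Finset.univ.filter fun i => s i = z).card • f z := by
  rw [← Finset.sum_fiberwise Finset.univ s]
  refine Finset.sum_congr rfl fun z _ => ?_
  rw [← Finset.sum_const]
  refine Finset.sum_congr rfl fun k hk => ?_
  rw [(Finset.mem_filter.1 hk).2]

lemma sum_four {A : Type*} [AddCommMonoid A] (f : ZMod 4 → A) :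
    ∑ z, f z = f 0 + f 1 + f 2 + f 3 := Fin.sum_univ_four f

lemma balanced (s : Fin 8 → ZMod 4) (I : F) (hI : I * I = -1)
    (h1 : ∑ k, I ^ (s k).val = 0) (h2 : ∑ k, (I ^ (s k).val) ^ 2 = 0) :
    ∀ z, (Finset.univ.filter fun i => s i = z).card = 2 := by
  have h8 : ∑ k : Fin 8, (1 : ℕ) = 8 := by simp
  rw [sum_fib s fun z => I ^ z.val, sum_four] at h1
  rw [sum_fib s fun z => (I ^ z.val) ^ 2, sum_four] at h2
  rw [sum_fib s fun _ => (1 : ℕ), sum_four] at h8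
  have v0 : (0 : ZMod 4).val = 0 := rfl
  have v1 : (1 : ZMod 4).val = 1 := rfl
  have v2 : (2 : ZMod 4).val = 2 := rfl
  have v3 : (3 : ZMod 4).val = 3 := rfl
  have I2 : I ^ 2 = -1 := by rw [sq, hI]
  rw [v0, v1, v2, v3] at h1 h2
  set n0 := (Finset.univ.filter fun i => s i = 0).card with e0
  set n1 := (Finset.univ.filter fun i => s i = 1).card with e1
  set n2 := (Finset.univ.filter fun i => s i = 2).card with e2
  set n3 := (Finset.univ.filter fun i => s i = 3).card with e3
  simp only [nsmul_eq_mul] at h1 h2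
  have g2 : ((n0 : ℤ) - n1 + n2 - n3 : ℤ) = 0 := by
    have : ((((n0 : ℤ) - n1 + n2 - n3 : ℤ)) : F) = 0 := by
      push_cast
      rw [← h2]
      linear_combination (-n1 * (1 : F) - n2 * (I ^ 2 - 1) - n3 * (I ^ 4 - I ^ 2 + 1)) * I2
    exact_mod_cast this
  have g1 : ((n0 : ℤ) - n2) ^ 2 + ((n1 : ℤ) - n3) ^ 2 = 0 := by
    have : ((((n0 : ℤ) - n2) ^ 2 + ((n1 : ℤ) - n3) ^ 2 : ℤ) : F) = 0 := by
      push_cast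
      have e : ((n0 : F) - n2) = - I * (n1 - n3) := by
        linear_combination h1 - (n2 + n3 * I) * I2
      rw [e]
      linear_combination ((n1 : F) - n3) ^ 2 * I2
    exact_mod_cast this
  have a1 : (n0 : ℤ) - n2 = 0 := by
    have := sq_nonneg ((n0 : ℤ) - n2)
    have := sq_nonneg ((n1 : ℤ) - n3)
    exact pow_eq_zero_iff (two_ne_zero) |>.1 (by linarith)
  have a2 : (n1 : ℤ) - n3 = 0 := by
    have := sq_nonneg ((n0 : ℤ) - n2)
    have := sq_nonneg ((n1 : ℤ) - n3)
    exact pow_eq_zero_iff (two_ne_zero) |>.1 (by linarith)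
  simp only [smul_eq_mul, mul_one] at h8
  intro z
  have hz : z = 0 ∨ z = 1 ∨ z = 2 ∨ z = 3 := by revert z; decide
  rcases hz with rfl | rfl | rfl | rfl
  · rw [← e0]; omega
  · rw [← e1]; omega
  · rw [← e2]; omega
  · rw [← e3]; omega

lemma numalg (l : Fin 8 → F) (I : F) (hI : I * I = -1) (N : ℕ) (hN : 0 < N)
    (hl : ∀ i, (l i ^ 2) ^ N = 1) (hprod : ∏ i, l i = 1)
    (hA : (∑ i, l i) ^ 2 = ∑ i, l i ^ 2)
    (hB : ∀ k, l k ^ 2 * (∑ i, l i ^ 2 - l k ^ 2) = l 7 ^ 2 * (∑ i, l i ^ 2 - l 7 ^ 2)) :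
    ∃ (b : F) (s : Fin 8 → ZMod 4), (∀ i, l i = b * I ^ (s i).val) ∧ b ^ 8 = 1 ∧
      ∀ z, (Finset.univ.filter fun i => s i = z).card = 2 := by
  classical
  set P := ∑ i, l i ^ 2 with hP
  have hne : ∀ i, l i ≠ 0 := fun i h => by
    have := hl i
    rw [h] at this
    simp [hN.ne'] at this
  have I4 : I ^ 4 = 1 := by linear_combination (I * I - 1) * hI
  have I2 : I ^ 2 = -1 := by rw [sq, hI]
  have hyz : ∀ i j, l i ^ 2 = l j ^ 2 ∨ P - l i ^ 2 - l j ^ 2 = 0 := fun i j => by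
    have h : (l i ^ 2 - l j ^ 2) * (P - l i ^ 2 - l j ^ 2) = 0 := by
      linear_combination hB i - hB j
    rcases mul_eq_zero.1 h with h | h
    · exact Or.inl (sub_eq_zero.1 h)
    · exact Or.inr h
  by_cases hall : ∀ i, l i ^ 2 = l 0 ^ 2
  · exfalso
    have : ∀ i, ∃ e : ℤ, l i = e * l 0 := fun i => by
      rcases sq_eq_sq_iff_eq_or_eq_neg.1 (hall i) with h | h
      · exact ⟨1, by simp [h]⟩
      · exact ⟨-1, by simp [h]⟩
    choose e he using this
    have h1 : ∑ i, l i = ((∑ i, e i : ℤ) : F) * l 0 := by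
      push_cast
      rw [Finset.sum_mul]
      exact Finset.sum_congr rfl fun i _ => he i
    have h2 : P = 8 * l 0 ^ 2 := by
      rw [hP, Finset.sum_congr rfl fun i _ => hall i]
      simp
    rw [h1, h2, mul_pow] at hA
    have h3 := mul_right_cancel₀ (pow_ne_zero 2 (hne 0)) hA
    have h4 : (∑ i, e i : ℤ) ^ 2 = 8 := by exact_mod_cast h3
    generalize ∑ i, e i = n at h4
    have : n < 3 := by nlinarith
    have : -3 < n := by nlinarith
    interval_cases n <;> omega
  · push Not at hall
    obtain ⟨i, hi⟩ := hall
    have hPac : P = l i ^ 2 + l 0 ^ 2 := by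
      rcases hyz i 0 with h | h
      · exact absurd h hi
      · linear_combination h
    have hk : ∀ k, l k ^ 2 ≠ l i ^ 2 → l k ^ 2 = l 0 ^ 2 := fun k h => by
      rcases hyz k i with h' | h'
      · exact absurd h' h
      · linear_combination -h' + hPac
    set m := (Finset.univ.filter fun k => l k ^ 2 = l i ^ 2).card with hm
    have hmc : (Finset.univ.filter fun k => ¬ l k ^ 2 = l i ^ 2).card = 8 - m := by
      have := Finset.card_filter_add_card_filter_not (s := (Finset.univ : Finset (Fin 8)))
        (fun k => l k ^ 2 = l i ^ 2)
      rw [← hm] at this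
      simp only [Finset.card_univ, Fintype.card_fin] at this
      omega
    have hm1 : 1 ≤ m := Finset.card_pos.2 ⟨i, by simp⟩
    have hm2 : 1 ≤ 8 - m := by
      rw [← hmc]
      exact Finset.card_pos.2 ⟨0, by simpa using hi.symm⟩
    have hPm : P = m * l i ^ 2 + ((8 - m : ℕ) : F) * l 0 ^ 2 := by
      rw [hP, ← Finset.sum_filter_add_sum_filter_not Finset.univ (fun k => l k ^ 2 = l i ^ 2)]
      congr 1
      · rw [Finset.sum_congr rfl fun k hk' => (Finset.mem_filter.1 hk').2, Finset.sum_const,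
          nsmul_eq_mul]
      · rw [Finset.sum_congr rfl fun k hk' => hk k (Finset.mem_filter.1 hk').2, Finset.sum_const,
          nsmul_eq_mul, hmc]
    have hrel : ((m - 1 : ℕ) : F) * l i ^ 2 = - (((7 - m : ℕ) : F) * l 0 ^ 2) := by
      have e1 : ((m - 1 : ℕ) : F) = m - 1 := by push_cast [hm1]; ring
      have e2 : ((8 - m : ℕ) : F) = (7 - m : ℕ) + 1 := by
        have : 8 - m = (7 - m) + 1 := by omega
        rw [this]; push_cast; ring
      rw [e1]
      rw [e2] at hPm
      linear_combination hPac - hPm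
    have hm4 : m = 4 := by
      have h := congrArg (fun x => x ^ (N * 2)) hrel
      have q : ∀ j, (l j ^ 2) ^ (N * 2) = 1 := fun j => by rw [pow_mul, hl, one_pow]
      simp only [mul_pow, q, mul_one] at h
      rw [Even.neg_pow ⟨N, by ring⟩, mul_pow, q, mul_one] at h
      have h' : (m - 1) ^ (N * 2) = (7 - m) ^ (N * 2) := by exact_mod_cast h
      have := Nat.pow_left_injective (n := N * 2) (by omega) h'
      omega
    have h03 : l 0 ^ 2 = - l i ^ 2 := by
      rw [hm4] at hrel
      have h3 : (3 : F) ≠ 0 := by norm_num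
      apply mul_left_cancel₀ h3
      push_cast at hrel
      linear_combination hrel
    have hP0 : P = 0 := by rw [hPac, h03]; ring
    have hs : ∀ k, ∃ z : ZMod 4, l k = l i * I ^ z.val := fun k => by
      by_cases h : l k ^ 2 = l i ^ 2
      · rcases sq_eq_sq_iff_eq_or_eq_neg.1 h with h | h
        · exact ⟨0, by rw [h, show (0 : ZMod 4).val = 0 from rfl]; ring⟩
        · exact ⟨2, by rw [h, show (2 : ZMod 4).val = 2 from rfl, I2]; ring⟩
      · have h' : l k ^ 2 = (l i * I) ^ 2 := by rw [hk k h, h03, mul_pow, I2]; ring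
        rcases sq_eq_sq_iff_eq_or_eq_neg.1 h' with h | h
        · exact ⟨1, by rw [h, show (1 : ZMod 4).val = 1 from rfl]; ring⟩
        · exact ⟨3, by rw [h, show (3 : ZMod 4).val = 3 from rfl]; linear_combination -l i * I * I2⟩
    choose s hs using hs
    have hbal : ∀ z, (Finset.univ.filter fun i => s i = z).card = 2 := by
      refine balanced s I hI ?_ ?_
      · apply mul_left_cancel₀ (hne i)
        rw [Finset.mul_sum, ← Finset.sum_congr rfl fun k _ => hs k, mul_zero]
        rw [hP0] at hA
        exact pow_eq_zero_iff (two_ne_zero) |>.1 hA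
      · apply mul_left_cancel₀ (pow_ne_zero 2 (hne i))
        rw [Finset.mul_sum, mul_zero, ← hP0, hP]
        refine Finset.sum_congr rfl fun k _ => ?_
        rw [hs k]; ring
    refine ⟨l i, s, hs, ?_, hbal⟩
    have hv : ∑ k, (s k).val = 12 := by
      rw [sum_fib s fun z => z.val, Finset.sum_congr rfl fun z _ => by rw [hbal z]]
      decide
    rw [← hprod, Finset.prod_congr rfl fun k _ => hs k, Finset.prod_mul_distrib,
      Finset.prod_pow_eq_pow_sum, hv]
    simp only [Finset.prod_const, Finset.card_univ, Fintype.card_fin]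
    have : I ^ 12 = 1 := by rw [show 12 = 4 * 3 by norm_num, pow_mul, I4, one_pow]
    rw [this, mul_one]

end numalg

end E8P

set_option linter.unusedSectionVars false
set_option linter.style.haveILetI false

namespace E8P

section
variable {F : Type*} [Field F]

/-- value of a multiplicative character -/
def ch (u : V →+ Additive Fˣ) (v : V) : F := ((Additive.toMul (u v) : Fˣ) : F)

lemma ch_zero (u : V →+ Additive Fˣ) : ch u 0 = 1 := by simp [ch]
lemma ch_add (u : V →+ Additive Fˣ) (v w : V) : ch u (v + w) = ch u v * ch u w := by simp [ch]
lemma ch_ne (u : V →+ Additive Fˣ) (v : V) : ch u v ≠ 0 := Units.ne_zero _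
lemma ch_neg (u : V →+ Additive Fˣ) (v : V) : ch u (-v) = (ch u v)⁻¹ := by simp [ch]
lemma ch_sub (u : V →+ Additive Fˣ) (v w : V) : ch u (v - w) = ch u v * (ch u w)⁻¹ := by
  rw [sub_eq_add_neg, ch_add, ch_neg]

def P2l : List (Fin 8 × Fin 8) := [(0, 1), (0, 2), (0, 3), (0, 4), (0, 5), (0, 6), (0, 7), (1, 2),
  (1, 3), (1, 4), (1, 5), (1, 6), (1, 7), (2, 3), (2, 4), (2, 5), (2, 6), (2, 7), (3, 4), (3, 5),
  (3, 6), (3, 7), (4, 5), (4, 6), (4, 7), (5, 6), (5, 7), (6, 7)]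

def Gp (p : Fin 8 × Fin 8) : V := kp + ep p.1 + ep p.2

lemma filter_one : (rtL.filter fun v => decide (v 2 % 4 = 1)).Perm
    (P2l.map Gp ++ P2l.map fun p => Gp p - sr 0) := by
  decide +kernel

lemma sum_one (g : V → F) : ∑ v ∈ Rt.filter (fun v => v 2 % 4 = 1), g v
    = (P2l.map fun p => g (Gp p) + g (Gp p - sr 0)).sum := by
  have e : Rt.filter (fun v => v 2 % 4 = 1) = (rtL.filter fun v => decide (v 2 % 4 = 1)).toFinset := by
    rw [List.toFinset_filter, Rt]
    simp
  rw [e, List.sum_toFinset g (rtL_nodup.filter _), (filter_one.map g).sum_eq, List.map_append,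
    List.sum_append, List.map_map, List.map_map, ← List.sum_map_add]
  rfl

lemma Gp_sr0 : ∀ p ∈ P2l, Bf (Gp p) (sr 0) = 1 := by decide +kernel
lemma Gp_ep : ∀ k, ∀ p ∈ P2l, Bf (Gp p + (Gp p - sr 0)) (ep k) =
    2 * ((if p.1 = k then 1 else 0) + (if p.2 = k then 1 else 0) - (if p.1 = 7 then 1 else 0)
      - (if p.2 = 7 then 1 else 0)) := by decide +kernel

end

section
variable {F : Type*} [Field F] [CharZero F]

lemma algA (l : Fin 8 → F) (h : (P2l.map fun p => l p.1 * l p.2).sum = 0) :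
    (∑ i, l i) ^ 2 = ∑ i, l i ^ 2 := by
  simp only [P2l, List.map_cons, List.map_nil, List.sum_cons, List.sum_nil] at h
  rw [Fin.sum_univ_eight, Fin.sum_univ_eight]
  linear_combination 2 * h

lemma algB (y : Fin 8 → F) (k : Fin 8)
    (h : (P2l.map fun p => y p.1 * y p.2 * ((2 * ((if p.1 = k then 1 else 0)
      + (if p.2 = k then 1 else 0) - (if p.1 = 7 then 1 else 0)
      - (if p.2 = 7 then 1 else 0)) : ℤ) : F)).sum = 0) :
    y k * (∑ i, y i - y k) = y 7 * (∑ i, y i - y 7) := by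
  rw [Fin.sum_univ_eight]
  fin_cases k
  on_goal 8 => rfl
  all_goals
    simp only [P2l, List.map_cons, List.map_nil, List.sum_cons, List.sum_nil] at h
    simp at h
    simp only [Fin.zero_eta, Fin.mk_one, Fin.reduceFinMk]
    linear_combination h / 2

end

section
variable {F : Type*} [Field F] [CharZero F] [IsAlgClosed F]

open Classical in
lemma numbers (u ut : V →+ Additive Fˣ) (N : ℕ) (hN : 0 < N) (huN : ∀ v, ch u v ^ N = 1) (I : F)
    (hI : I * I = -1) (h0 : ch u (sr 0) = -1)
    (hk1 : ∀ w, ∑ v ∈ Rt.filter (fun v => v 2 % 4 = 1), ch u v * (Bf v w : F) = 0)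
    (hk2 : ∀ w, ∑ v ∈ Rt.filter (fun v => v 2 % 4 = 1), ch u v ^ 2 * (Bf v w : F) = 0)
    (hut : ∀ v, ch ut v = I ^ (v 2)) :
    ∃ u', (u' = u ∨ u' = u + ut) ∧ (Rt.filter fun v => ch u' v = 1).card = 52 ∧
      (∀ v, ch u' v ^ 4 = 1) ∧ ∃ v, ch u' v ^ 2 ≠ 1 := by
  have I4 : I ^ 4 = 1 := by linear_combination (I * I - 1) * hI
  have I2 : I ^ 2 = -1 := by rw [sq, hI]
  have I0 : I ≠ 0 := by rintro rfl; simp at hI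
  obtain ⟨l7, hl7⟩ := IsAlgClosed.exists_pow_nat_eq (ch u kp) (n := 2) (by norm_num)
  have l70 : l7 ≠ 0 := by
    rintro rfl
    exact ch_ne u kp (by rw [← hl7]; simp)
  let l : Fin 8 → F := fun i => l7 * ch u (ep i)
  have hl : ∀ i, l i = l7 * ch u (ep i) := fun i => rfl
  have e7 : ep 7 = 0 := rfl
  have hG : ∀ p, ch u (Gp p) = l p.1 * l p.2 := fun p => by
    rw [Gp, ch_add, ch_add, ← hl7, hl, hl]; ring
  have hG' : ∀ p, ch u (Gp p - sr 0) = - (l p.1 * l p.2) := fun p => by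
    rw [ch_sub, h0, hG, inv_neg, inv_one]; ring
  have n1 : ∀ i, (l i ^ 2) ^ N = 1 := by
    intro i
    rw [hl, mul_pow, hl7, mul_pow, huN, one_mul, ← pow_mul, mul_comm 2, pow_mul, huN, one_pow]
  have n2 : ∏ i, l i = 1 := by
    have e : Gp (0, 1) + Gp (2, 3) + Gp (4, 5) + Gp (6, 7) = sr 0 + sr 0 := by decide +kernel
    have := congrArg (ch u) e
    simp only [ch_add, hG, h0] at this
    rw [Fin.prod_univ_eight]
    linear_combination this
  have n3 : (∑ i, l i) ^ 2 = ∑ i, l i ^ 2 := by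
    apply algA
    have h := hk1 (sr 0)
    rw [sum_one] at h
    have h2 : (2 : F) ≠ 0 := two_ne_zero
    apply mul_left_cancel₀ h2
    rw [mul_zero, ← h, ← List.sum_map_mul_left]
    congr 1
    refine List.map_congr_left fun p hp => ?_
    rw [hG', hG, Bf_sub_left, Gp_sr0 p hp, Bf_sr]
    push_cast; ring
  have n4 : ∀ k, l k ^ 2 * (∑ i, l i ^ 2 - l k ^ 2) = l 7 ^ 2 * (∑ i, l i ^ 2 - l 7 ^ 2) := by
    intro k
    have := algB (fun i => l i ^ 2) k ?_
    · exact this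
    have h := hk2 (ep k)
    rw [sum_one] at h
    rw [← h]
    congr 1
    refine List.map_congr_left fun p hp => ?_
    rw [← Gp_ep k p hp, Bf_add_left, hG', hG]
    push_cast; ring

  obtain ⟨b, s, hs, hb, hbal⟩ := numalg l I hI N hN n1 n2 n3 n4
  have hprim : IsPrimitiveRoot I 4 := by
    rw [IsPrimitiveRoot.iff_def]
    refine ⟨I4, fun n hn => ?_⟩
    by_contra hc
    have hr : I ^ (n % 4) = 1 := by rw [← hn]; exact (pow_eq_pow_mod n I4).symm
    have h1 : n % 4 < 4 := Nat.mod_lt _ (by norm_num)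
    have h2 : n % 4 ≠ 0 := fun h => hc (Nat.dvd_of_mod_eq_zero h)
    have hm1 : (-1 : F) ≠ 1 := by
      intro h
      have : (2 : F) = 0 := by linear_combination -h
      exact two_ne_zero this
    have c1 : I ≠ 1 := fun h => hm1 (by rw [← I2, h]; ring)
    interval_cases hh : n % 4
    · exact h2 rfl
    · exact c1 (by simpa using hr)
    · exact hm1 (by rw [← I2, hr])
    · apply c1
      have : I ^ 3 = -I := by linear_combination I * I2
      rw [this] at hr
      exfalso
      apply hm1
      rw [← I2]
      have : I = -1 := by linear_combination -hr
      rw [this]; ring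
  obtain ⟨t, ht4, htb⟩ := hprim.eq_pow_of_pow_eq_one (ξ := b ^ 2) (by rw [← pow_mul]; exact hb)
  let Iu : Fˣ := Units.mk0 I I0
  have Iu4 : Iu ^ 4 = 1 := by ext; simpa [Iu] using I4
  let ι : ZMod 4 →+ Additive Fˣ :=
    { toFun := fun z => Additive.ofMul (Iu ^ z.val)
      map_zero' := by simp
      map_add' := fun x y => by
        rw [ZMod.val_add, ← pow_eq_pow_mod _ Iu4, pow_add]; rfl }
  have hιv : ∀ z, ((Additive.toMul (ι z) : Fˣ) : F) = I ^ z.val := fun z => by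
    show ((Iu ^ z.val : Fˣ) : F) = _
    simp [Iu]
  have hext : ∀ x y : Additive Fˣ, ((Additive.toMul x : Fˣ) : F) = ((Additive.toMul y : Fˣ) : F) →
      x = y := fun x y h => Additive.toMul.injective (Units.ext h)
  have hιinj : Function.Injective ι := by
    intro x y h
    have h' : I ^ x.val = I ^ y.val := by rw [← hιv, ← hιv, h]
    exact ZMod.val_injective 4 (hprim.pow_inj (ZMod.val_lt x) (ZMod.val_lt y) h')
  have hιadd : ∀ x y, I ^ (x + y : ZMod 4).val = I ^ x.val * I ^ y.val := fun x y => by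
    rw [← hιv, map_add]; simp [hιv]
  have hIn : ∀ n : ℕ, I ^ (n : ZMod 4).val = I ^ n := fun n => by
    rw [ZMod.val_natCast, ← pow_eq_pow_mod _ I4]
  have b0 : b ≠ 0 := by rintro rfl; simp at hb
  have hl7' : l7 = l 7 := by rw [hl, e7, ch_zero, mul_one]
  have hep : ∀ i, ch u (ep i) = I ^ (s i - s 7).val := fun i => by
    have h1 : ch u (ep i) * l7 = l i := by rw [hl]; ring
    rw [hl7', hs, hs] at h1
    have h2 := hιadd (s i - s 7) (s 7)
    rw [sub_add_cancel] at h2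
    rw [h2] at h1
    have : b * I ^ (s 7).val ≠ 0 := mul_ne_zero b0 (pow_ne_zero _ I0)
    apply mul_right_cancel₀ this
    linear_combination h1
  have hkp : ch u kp = I ^ t * I ^ (2 * s 7).val := by
    rw [← hl7, hl7', hs, mul_pow, htb, two_mul, hιadd]; ring
  have m1 : (-1 : F) = I ^ (2 : ZMod 4).val := by rw [show (2 : ZMod 4).val = 2 from rfl, I2]
  obtain ⟨u', hu', τ, hτ, k1, k2, k3⟩ : ∃ u', (u' = u ∨ u' = u + ut) ∧ ∃ τ : ZMod 4,
      (τ = 0 ∨ τ = 2) ∧ (∀ i, ch u' (ep i) = I ^ (s i - s 7).val) ∧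
        ch u' kp = I ^ (τ + 2 * s 7).val ∧ ch u' (sr 0) = I ^ (2 : ZMod 4).val := by
    have hadd : ∀ v, ch (u + ut) v = ch u v * ch ut v := fun v => by simp [ch]
    have hI4z : I ^ (-4 : ℤ) = 1 := by
      rw [zpow_neg, show (4 : ℤ) = ((4 : ℕ) : ℤ) from rfl, zpow_natCast, I4, inv_one]
    have hepz : ∀ i, ch ut (ep i) = 1 := fun i => by
      have : ep i 2 = 0 ∨ ep i 2 = -4 := by revert i; decide +kernel
      rw [hut]
      rcases this with h | h <;> rw [h]
      · exact zpow_zero I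
      · exact hI4z
    have hkz : ch ut kp = I := by
      rw [hut, show kp 2 = 1 by decide +kernel, zpow_one]
    have hsz : ch ut (sr 0) = 1 := by
      rw [hut, show sr 0 2 = 0 by decide +kernel, zpow_zero]
    have hkp' : ch u kp = I ^ ((t : ZMod 4) + 2 * s 7).val := by rw [hkp, hιadd, hIn]
    have hkp2 : ch (u + ut) kp = I ^ (((t + 1 : ℕ) : ZMod 4) + 2 * s 7).val := by
      rw [hadd, hkp, hkz, hιadd, hIn]; ring
    interval_cases t
    · exact ⟨u, Or.inl rfl, 0, Or.inl rfl, hep, by simpa using hkp', by rw [h0, m1]⟩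
    · exact ⟨u + ut, Or.inr rfl, 2, Or.inr rfl, fun i => by rw [hadd, hepz, hep, mul_one], hkp2,
        by rw [hadd, hsz, h0, m1, mul_one]⟩
    · exact ⟨u, Or.inl rfl, 2, Or.inr rfl, hep, by simpa using hkp', by rw [h0, m1]⟩
    · exact ⟨u + ut, Or.inr rfl, 0, Or.inl rfl, fun i => by rw [hadd, hepz, hep, mul_one], hkp2,
        by rw [hadd, hsz, h0, m1, mul_one]⟩
  obtain ⟨c1, c2, v, c3⟩ := count52 ι hιinj u' s τ hτ hbal
    (fun i => hext _ _ (by rw [hιv]; exact k1 i)) (hext _ _ (by rw [hιv]; exact k2))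
    (hext _ _ (by rw [hιv]; exact k3))
  have hz : ∀ x : Additive Fˣ, x = 0 ↔ ((Additive.toMul x : Fˣ) : F) = 1 := fun x =>
    ⟨fun h => by rw [h]; rfl, fun h => hext _ _ (by rw [h]; rfl)⟩
  refine ⟨u', hu', ?_, fun v => ?_, v, ?_⟩
  · rw [← c1]
    apply congrArg Finset.card
    ext v
    simp only [Finset.mem_filter, hz]
    rfl
  · have := (hz _).1 (c2 v)
    simpa [ch, ofNat_zsmul] using this
  · intro h
    apply c3
    rw [hz]
    simpa [ch, ofNat_zsmul] using h

end

end E8P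

set_option linter.unusedSectionVars false
set_option linter.style.haveILetI false

namespace E8P
open LieAlgebra

section grp
variable {F L : Type*} [Field F] [LieRing L] [LieAlgebra F L]

lemma mem_of_comm {G : Type*} [Group G] {Q : Subgroup G} (hQ : IsMaximalFiniteAbelian Q) (g : G)
    (hg : ∀ r ∈ Q, r * g = g * r) : g ∈ Q := by
  have h : ∀ x ∈ (Q : Set G) ∪ {g}, ∀ y ∈ (Q : Set G) ∪ {g}, x * y = y * x := by
    rintro x (hx | hx) y (hy | hy)
    · exact hQ.2.1 _ _ hx hy
    · rw [Set.mem_singleton_iff.1 hy]; exact hg x hx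
    · rw [Set.mem_singleton_iff.1 hx]; exact (hg y hy).symm
    · rw [Set.mem_singleton_iff.1 hx, Set.mem_singleton_iff.1 hy]
  have h2 := hQ.2.2 (Subgroup.closure ((Q : Set G) ∪ {g})) (fun a b ha hb => by
    letI := Subgroup.closureCommGroupOfComm h
    have := mul_comm (⟨a, ha⟩ : Subgroup.closure ((Q : Set G) ∪ {g})) ⟨b, hb⟩
    exact congrArg Subtype.val this)
    (fun x hx => Subgroup.subset_closure (Or.inl hx))
  rw [← h2]
  exact Subgroup.subset_closure (Or.inr rfl)

lemma pow_card {G : Type*} [Group G] {Q : Subgroup G} (hQ : IsMaximalFiniteAbelian Q) :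
    0 < Nat.card Q ∧ ∀ r ∈ Q, r ^ Nat.card Q = 1 := by
  have := hQ.1
  refine ⟨Nat.card_pos, fun r hr => ?_⟩
  have := pow_card_eq_one' (x := (⟨r, hr⟩ : Q))
  exact congrArg Subtype.val this

lemma aut_pow (r : lieAut F L) (n : ℕ) (x : L) (c : F) (h : r.1 x = c • x) :
    (r ^ n).1 x = c ^ n • x := by
  induction n with
  | zero => simp
  | succ n ih =>
    rw [pow_succ']
    show r.1 ((r ^ n).1 x) = _
    rw [ih, map_smul, h, smul_smul, pow_succ]

lemma aut_ext (r s : lieAut F L) (h : ∀ x, r.1 x = s.1 x) : r = s :=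
  Subtype.ext (LinearEquiv.ext h)

/-- as a Lie equivalence -/
def toLE (r : lieAut F L) : L ≃ₗ⁅F⁆ L := { r.1 with map_lie' := fun {x y} => r.2 x y }

lemma toLE_apply (r : lieAut F L) (x : L) : toLE r x = r.1 x := rfl

lemma aut_inv_apply (r : lieAut F L) (x : L) : (r⁻¹).1 (r.1 x) = x := r.1.symm_apply_apply x
lemma aut_apply_inv (r : lieAut F L) (x : L) : r.1 ((r⁻¹).1 x) = x := r.1.apply_symm_apply x

lemma killing_inv [FiniteDimensional F L] (r : lieAut F L) (x y : L) :
    killingForm F L (r.1 x) (r.1 y) = killingForm F L x y := by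
  exact LieAlgebra.killingForm_of_equiv_apply (toLE r) x y

end grp

section diag
variable {F M : Type*} [Field F] [AddCommGroup M] [Module F M]

lemma exists_diag {ι : Type*} (A : ι → Submodule F M) (hi : iSupIndep A) (ht : iSup A = ⊤)
    (s : ι → F) : ∃ T : M →ₗ[F] M, ∀ i, ∀ y ∈ A i, T y = s i • y := by
  classical
  have h : DirectSum.IsInternal A := (DirectSum.isInternal_submodule_iff_iSupIndep_and_iSup_eq_top A).2
    ⟨hi, ht⟩
  let v := fun i => Module.Basis.ofVectorSpace F (A i)
  let b := h.collectedBasis v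
  let T : M →ₗ[F] M := b.constr F fun x => s x.1 • b x
  refine ⟨T, fun i y hy => ?_⟩
  have : T ∘ₗ (A i).subtype = s i • (A i).subtype := by
    refine (v i).ext fun j => ?_
    have e : ((v i j : A i) : M) = b ⟨i, j⟩ := by simp [b]
    simp only [LinearMap.comp_apply, LinearMap.smul_apply, Submodule.subtype_apply]
    rw [e, b.constr_basis]
  exact LinearMap.congr_fun this ⟨y, hy⟩

lemma diag_ext {ι : Type*} (A : ι → Submodule F M) (ht : iSup A = ⊤) {M' : Type*} [AddCommGroup M']
    [Module F M'] (f g : M →ₗ[F] M') (h : ∀ i, ∀ y ∈ A i, f y = g y) : f = g := by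
  have : iSup A ≤ LinearMap.eqLocus f g := iSup_le fun i y hy => h i y hy
  rw [ht] at this
  exact LinearMap.ext fun x => this trivial
end diag

section der
variable {F L : Type*} [Field F] [LieRing L] [LieAlgebra F L]

lemma aut_ofdiag {ι : Type*} (A : ι → Submodule F L) (hi : iSupIndep A) (ht : iSup A = ⊤) (op : ι → ι → ι)
    (hl : ∀ i j, ∀ y ∈ A i, ∀ z ∈ A j, ⁅y, z⁆ ∈ A (op i j)) (s : ι → F) (hs0 : ∀ i, s i ≠ 0)
    (hs : ∀ i j, A i ≠ ⊥ → A j ≠ ⊥ → A (op i j) ≠ ⊥ → s (op i j) = s i * s j) :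
    ∃ σ : lieAut F L, ∀ i, ∀ y ∈ A i, σ.1 y = s i • y := by
  obtain ⟨T, hT⟩ := exists_diag A hi ht s
  obtain ⟨T', hT'⟩ := exists_diag A hi ht fun i => (s i)⁻¹
  have h1 : T ∘ₗ T' = LinearMap.id := diag_ext A ht _ _ fun i y hy => by
    rw [LinearMap.comp_apply, hT' i y hy, map_smul, hT i y hy, smul_smul, inv_mul_cancel₀ (hs0 i), one_smul]; rfl
  have h2 : T' ∘ₗ T = LinearMap.id := diag_ext A ht _ _ fun i y hy => by
    rw [LinearMap.comp_apply, hT i y hy, map_smul, hT' i y hy, smul_smul, mul_inv_cancel₀ (hs0 i), one_smul]; rfl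
  let e : L ≃ₗ[F] L := LinearEquiv.ofLinearMap T T' h1 h2
  have he : ∀ x, e x = T x := fun x => rfl
  refine ⟨⟨e, fun x y => ?_⟩, fun i y hy => hT i y hy⟩
  rw [he, he, he]
  have key : ∀ i, ∀ y ∈ A i, ∀ z, T ⁅y, z⁆ = ⁅T y, T z⁆ := by
    intro i y hy z
    have : T ∘ₗ (ad F L y : L →ₗ[F] L) = (ad F L (T y) : L →ₗ[F] L) ∘ₗ T := diag_ext A ht _ _ fun j z hz => by
      simp only [LinearMap.comp_apply, ad_apply]
      rw [hT i y hy, hT j z hz, hT _ _ (hl i j y hy z hz), smul_lie, lie_smul, smul_smul]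
      by_cases h0 : ⁅y, z⁆ = 0
      · rw [h0, smul_zero, smul_zero]
      · rw [hs i j]
        · rintro h; rw [h, Submodule.mem_bot] at hy; exact h0 (by rw [hy, zero_lie])
        · rintro h; rw [h, Submodule.mem_bot] at hz; exact h0 (by rw [hz, lie_zero])
        · rintro h; have := hl i j y hy z hz; rw [h, Submodule.mem_bot] at this; exact h0 this
    exact LinearMap.congr_fun this z
  have : iSup A ≤ LinearMap.eqLocus ((LieModule.toEnd F L L : L →ₗ[F] Module.End F L).flip y |> fun f => T ∘ₗ f)
      ((LieModule.toEnd F L L : L →ₗ[F] Module.End F L).flip (T y) ∘ₗ T) :=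
    iSup_le fun i z hz => by
      show T ⁅z, y⁆ = ⁅T z, T y⁆
      exact key i z hz y
  rw [ht] at this
  exact this (x := x) trivial

lemma der_ofdiag (A : F → Submodule F L) (hi : iSupIndep A) (ht : iSup A = ⊤)
    (hl : ∀ i j, ∀ y ∈ A i, ∀ z ∈ A j, ⁅y, z⁆ ∈ A (i + j)) :
    ∃ D : LieDerivation F L L, ∀ i, ∀ y ∈ A i, D y = i • y := by
  obtain ⟨T, hT⟩ := exists_diag A hi ht id
  have key : ∀ i, ∀ y ∈ A i, ∀ z, T ⁅y, z⁆ = ⁅y, T z⁆ + ⁅T y, z⁆ := by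
    intro i y hy z
    have : T ∘ₗ (ad F L y : L →ₗ[F] L) = (ad F L y : L →ₗ[F] L) ∘ₗ T + (ad F L (T y) : L →ₗ[F] L) :=
      diag_ext A ht _ _ fun j z hz => by
      simp only [LinearMap.comp_apply, ad_apply, LinearMap.add_apply]
      rw [hT i y hy, hT j z hz, hT _ _ (hl i j y hy z hz), smul_lie, lie_smul, ← add_smul, add_comm]
      simp
    exact LinearMap.congr_fun this z
  refine ⟨⟨T, fun x y => ?_⟩, fun i y hy => hT i y hy⟩
  have : iSup A ≤ LinearMap.eqLocus (T ∘ₗ (LieModule.toEnd F L L : L →ₗ[F] Module.End F L).flip y)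
      ((LieModule.toEnd F L L : L →ₗ[F] Module.End F L).flip (T y) + (LieModule.toEnd F L L : L →ₗ[F] Module.End F L).flip y ∘ₗ T) :=
    iSup_le fun i z hz => by
      show T ⁅z, y⁆ = ⁅z, T y⁆ + ⁅T z, y⁆
      exact key i z hz y
  rw [ht] at this
  have h3 : T ⁅x, y⁆ = ⁅x, T y⁆ + ⁅T x, y⁆ := this (x := x) trivial
  rw [h3, ← lie_skew (T x) y, sub_eq_add_neg]

end der

end E8P

set_option linter.unusedSectionVars false
set_option linter.style.haveILetI false

namespace E8P
open LieAlgebra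

/-- an integer-valued additive functional on a finite set of numbers -/
lemma exists_height {F : Type*} [Field F] [CharZero F] (E : Finset F) (c : F) (hcE : c ∈ E) (hc : c ≠ 0) :
    ∃ m : F → ℤ, m c ≠ 0 ∧ ∀ x ∈ E, ∀ y ∈ E, x + y ∈ E → m (x + y) = m x + m y := by
  obtain ⟨k, hk⟩ : ∃ k : Module.Dual ℚ F, k c ≠ 0 := by
    by_contra! h
    exact hc ((Module.forall_dual_apply_eq_zero_iff ℚ c).1 h)
  let D : ℤ := ∏ x ∈ E, ((k x).den : ℤ)
  have hD : D ≠ 0 := Finset.prod_ne_zero_iff.2 fun x _ => by exact_mod_cast (k x).den_nz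
  have hinteger : ∀ x ∈ E, ∃ n : ℤ, (n : ℚ) = D * k x := fun x hx => by
    obtain ⟨d, hd⟩ : ((k x).den : ℤ) ∣ D := Finset.dvd_prod_of_mem _ hx
    refine ⟨(k x).num * d, ?_⟩
    rw [hd]
    have h1 := Rat.mul_den_eq_num (k x)
    push_cast
    rw [← h1]; ring
  choose! m hm using hinteger
  refine ⟨m, fun h => ?_, fun x hx y hy hxy => ?_⟩
  · have := hm c hcE
    rw [h] at this
    have h2 : (D : ℚ) ≠ 0 := by exact_mod_cast hD
    exact mul_ne_zero h2 hk (by rw [← this]; simp)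
  · have : ((m (x + y) : ℤ) : ℚ) = (m x + m y : ℤ) := by
      push_cast
      rw [hm _ hx, hm _ hy, hm _ hxy, map_add]; ring
    exact_mod_cast this

section
variable {F L : Type*} [Field F] [CharZero F] [IsAlgClosed F] [LieRing L] [LieAlgebra F L]
  [FiniteDimensional F L] {Q : Subgroup (lieAut F L)}

lemma gen_lie (x : L) (i j : F) (y : L) (hy : y ∈ (ad F L x).maxGenEigenspace i) (z : L)
    (hz : z ∈ (ad F L x).maxGenEigenspace j) : ⁅y, z⁆ ∈ (ad F L x).maxGenEigenspace (i + j) :=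
  LieModule.lie_mem_maxGenEigenspace_toEnd hy hz

lemma ad_aut (r : lieAut F L) (x : L) (c : F) (hc : c ≠ 0) (h : r.1 x = c • x) (μ : F) (n : ℕ) (y : L) :
    ((ad F L x - algebraMap F (Module.End F L) μ) ^ n) y = 0 →
      ((ad F L x - algebraMap F (Module.End F L) (c⁻¹ * μ)) ^ n) (r.1 y) = 0 := by
  intro hy
  have : ∀ n : ℕ, ((ad F L x - algebraMap F (Module.End F L) (c⁻¹ * μ)) ^ n) (r.1 y)
      = (c⁻¹) ^ n • r.1 (((ad F L x - algebraMap F (Module.End F L) μ) ^ n) y) := by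
    intro n
    induction n with
    | zero => simp
    | succ n ih =>
      rw [pow_succ', Module.End.mul_apply, ih, pow_succ' (ad F L x - _), Module.End.mul_apply, map_smul]
      simp only [LinearMap.sub_apply, ad_apply, Module.algebraMap_end_apply, map_sub, map_smul]
      rw [r.2, h, smul_lie, pow_succ, mul_smul _ c⁻¹ (_ - _), smul_sub c⁻¹ (c • _), smul_smul c⁻¹ c, inv_mul_cancel₀ hc, one_smul,
        smul_smul c⁻¹]
  rw [this, hy, map_zero, smul_zero]

lemma gen_aut (r : lieAut F L) (x : L) (c : F) (hc : c ≠ 0) (h : r.1 x = c • x) (μ : F) (y : L)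
    (hy : y ∈ (ad F L x).maxGenEigenspace μ) : r.1 y ∈ (ad F L x).maxGenEigenspace (c⁻¹ * μ) := by
  rw [Module.End.mem_maxGenEigenspace] at hy ⊢
  obtain ⟨n, hn⟩ := hy
  have e : ∀ μ : F, (μ • (1 : Module.End F L)) = algebraMap F (Module.End F L) μ := fun μ =>
    (Algebra.algebraMap_eq_smul_one μ).symm
  rw [e] at hn
  refine ⟨n, ?_⟩
  rw [e]
  exact ad_aut r x c hc h μ n y hn

lemma exists_exp (x : L) (hnil : IsNilpotent (ad F L x)) : ∃ (E : L ≃ₗ⁅F⁆ L) (k : ℕ), (ad F L x) ^ k = 0 ∧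
    ∀ y, E y = ∑ i ∈ Finset.range (k + 2), ((i.factorial : F)⁻¹) • ((ad F L x) ^ i) y := by
  letI : Module ℚ L := Module.compHom L (algebraMap ℚ F)
  have hsm : ∀ (q : ℚ) (y : L), q • y = (q : F) • y := fun q y => rfl
  haveI : IsScalarTower ℚ F L := ⟨fun q a y => by
    rw [hsm, smul_smul, Algebra.smul_def]; rfl⟩
  letI : LieAlgebra ℚ L := { lie_smul := fun q x y => by rw [hsm, hsm, lie_smul] }
  have hd : ∀ y, (LieDerivation.ad F L x : LieDerivation F L L) y = ⁅x, y⁆ := fun y => by simp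
  have e0 : (LieDerivation.ad F L x : LieDerivation F L L).toLinearMap = ad F L x := by
    ext y; exact hd y
  have hnil' : IsNilpotent (LieDerivation.ad F L x : LieDerivation F L L).toLinearMap := by
    rw [e0]; exact hnil
  obtain ⟨k, hk⟩ := hnil
  have hk2 : (ad F L x) ^ (k + 2) = 0 := by rw [pow_add, hk, zero_mul]
  refine ⟨LieDerivation.exp (LieDerivation.ad F L x) hnil', k, hk, fun y => ?_⟩
  rw [LieDerivation.exp_map_apply, e0, IsNilpotent.exp_eq_sum hk2, LinearMap.sum_apply]
  refine Finset.sum_congr rfl fun i _ => ?_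
  rw [LinearMap.smul_apply, hsm]
  push_cast
  rfl

lemma fix_zero [IsKilling F L] (hQ : IsMaximalFiniteAbelian Q) (x : L) (hx : ∀ r ∈ Q, r.1 x = x) : x = 0 := by
  classical
  obtain ⟨hN, hpow⟩ := pow_card hQ
  set N := Nat.card Q
  have htop := Module.End.iSup_maxGenEigenspace_eq_top (ad F L x)
  have hind := Module.End.independent_maxGenEigenspace (ad F L x)
  by_cases hc : ∃ c, c ≠ 0 ∧ (ad F L x).maxGenEigenspace c ≠ ⊥
  · exfalso
    obtain ⟨c, hc0, hc⟩ := hc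
    have hfin : {μ | (ad F L x).maxGenEigenspace μ ≠ ⊥}.Finite :=
      WellFoundedGT.finite_ne_bot_of_iSupIndep hind
    obtain ⟨m, hm0, hm⟩ := exists_height hfin.toFinset c (by simpa using hc) hc0
    obtain ⟨σ, hσ⟩ := aut_ofdiag (ad F L x).maxGenEigenspace hind htop (· + ·) (gen_lie x)
      (fun μ => (2 : F) ^ m μ) (fun μ => zpow_ne_zero _ two_ne_zero) (fun i j hi hj hij => by
        rw [hm i (by simpa using hi) j (by simpa using hj) (by simpa using hij),
          zpow_add₀ two_ne_zero])
    have hσQ : σ ∈ Q := by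
      refine mem_of_comm hQ σ fun r hr => ?_
      apply aut_ext
      intro z
      have : (r.1 : L →ₗ[F] L) ∘ₗ (σ.1 : L →ₗ[F] L) = (σ.1 : L →ₗ[F] L) ∘ₗ (r.1 : L →ₗ[F] L) := by
        refine diag_ext _ htop _ _ fun μ y hy => ?_
        show r.1 (σ.1 y) = σ.1 (r.1 y)
        have h := gen_aut r x 1 one_ne_zero (by rw [one_smul]; exact hx r hr) μ y hy
        rw [inv_one, one_mul] at h
        rw [hσ μ y hy, hσ μ _ h, map_smul]
      exact LinearMap.congr_fun this z
    obtain ⟨y, hy, hy0⟩ := (Submodule.ne_bot_iff _).1 hc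
    have h1 := aut_pow σ N y _ (hσ c y hy)
    rw [hpow σ hσQ] at h1
    have h2 : ((2 : F) ^ m c) ^ N = 1 := by
      have h3 : (((2 : F) ^ m c) ^ N - 1) • y = 0 := by
        rw [sub_smul, ← h1, one_smul]; exact sub_self _
      exact sub_eq_zero.1 ((smul_eq_zero.1 h3).resolve_right hy0)
    rw [← zpow_natCast, ← zpow_mul] at h2
    have h4 : ((2 : ℚ) ^ (m c * (N : ℤ)) : ℚ) = 1 := by
      have : (((2 : ℚ) ^ (m c * (N : ℤ)) : ℚ) : F) = ((1 : ℚ) : F) := by push_cast; exact h2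
      exact_mod_cast this
    have h5 := (zpow_eq_one_iff_right₀ (by norm_num : (0:ℚ) ≤ 2) (by norm_num)).1 h4
    rcases mul_eq_zero.1 h5 with h | h
    · exact hm0 h
    · omega
  · push Not at hc
    have h0 : (ad F L x).maxGenEigenspace 0 = ⊤ := by
      rw [eq_top_iff, ← htop]
      refine iSup_le fun μ => ?_
      by_cases h : μ = 0
      · rw [h]
      · rw [hc μ h]; exact bot_le
    have hnil : IsNilpotent (ad F L x) := by
      rw [Module.End.maxGenEigenspace_eq_genEigenspace_finrank] at h0
      refine ⟨Module.finrank F L, ?_⟩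
      ext y
      have : y ∈ (⊤ : Submodule F L) := trivial
      rw [← h0, Module.End.mem_genEigenspace_nat] at this
      simpa using this
    by_contra hx0
    have hne : ad F L x ≠ 0 := fun h => hx0 (by
      have : x ∈ LieAlgebra.center F L := fun y => by
        rw [← lie_skew]
        have h2 : ⁅x, y⁆ = 0 := LinearMap.congr_fun h y
        rw [h2, neg_zero]
      simpa using this)
    obtain ⟨E, k, hk, hE⟩ := exists_exp x hnil
    let σ : lieAut F L := ⟨E.toLinearEquiv, fun x y => E.map_lie x y⟩
    have hσ : ∀ y, σ.1 y = E y := fun y => rfl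
    have hσQ : σ ∈ Q := by
      refine mem_of_comm hQ σ fun r hr => ?_
      apply aut_ext
      intro z
      show r.1 (σ.1 z) = σ.1 (r.1 z)
      have hc : ∀ i : ℕ, r.1 (((ad F L x) ^ i) z) = ((ad F L x) ^ i) (r.1 z) := by
        intro i
        induction i with
        | zero => simp
        | succ i ih =>
          rw [pow_succ', Module.End.mul_apply, Module.End.mul_apply, ad_apply, r.2, hx r hr, ih, ad_apply]
      rw [hσ, hσ, hE, hE, map_sum]
      refine Finset.sum_congr rfl fun i _ => ?_
      rw [← hc, map_smul]
    obtain ⟨z, hz, hz2⟩ : ∃ z : L, ⁅x, z⁆ ≠ 0 ∧ ⁅x, ⁅x, z⁆⁆ = 0 := by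
      by_contra! hcon
      obtain ⟨w, hw⟩ : ∃ w : L, ⁅x, w⁆ ≠ 0 := by
        by_contra! h
        exact hne (LinearMap.ext h)
      have : ∀ n : ℕ, ((ad F L x) ^ (n + 1)) w ≠ 0 := by
        intro n
        induction n with
        | zero => simpa using hw
        | succ n ih =>
          rw [pow_succ', Module.End.mul_apply, ad_apply] at ih ⊢
          rw [pow_succ', Module.End.mul_apply, ad_apply]
          exact hcon _ ih
      exact this k (by rw [pow_succ', hk, mul_zero]; rfl)
    have hz3 : ∀ i : ℕ, ((ad F L x) ^ (i + 2)) z = 0 := fun i => by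
      rw [pow_add, Module.End.mul_apply, sq, Module.End.mul_apply, ad_apply, ad_apply, hz2, map_zero]
    have hEz : E z = z + ⁅x, z⁆ := by
      rw [hE, Finset.sum_range_succ', Finset.sum_range_succ', Finset.sum_eq_zero]
      · simp [add_comm]
      · intro i _
        rw [hz3, smul_zero]
    have hEz2 : E ⁅x, z⁆ = ⁅x, z⁆ := by
      rw [hE, Finset.sum_range_succ', Finset.sum_eq_zero]
      · simp
      · intro i _
        have : ((ad F L x) ^ (i + 1)) ⁅x, z⁆ = ((ad F L x) ^ (i + 2)) z := by
          rw [pow_succ _ (i+1), Module.End.mul_apply, ad_apply]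
        rw [this, hz3, smul_zero]
    have hp : ∀ n : ℕ, (σ ^ n).1 z = z + (n : F) • ⁅x, z⁆ := by
      intro n
      induction n with
      | zero => simp
      | succ n ih =>
        rw [pow_succ']
        show σ.1 ((σ ^ n).1 z) = _
        rw [ih, map_add, map_smul, hσ, hσ, hEz, hEz2]
        push_cast
        rw [add_smul, one_smul]; abel
    have h6 := hp N
    rw [hpow σ hσQ] at h6
    have h7 : (N : F) • ⁅x, z⁆ = 0 := by
      have : z = z + (N : F) • ⁅x, z⁆ := h6
      simpa using this
    rcases smul_eq_zero.1 h7 with h | h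
    · have : N = 0 := by exact_mod_cast h
      omega
    · exact hz h
end
end E8P

set_option linter.unusedSectionVars false
set_option linter.style.haveILetI false

namespace E8P
open LieAlgebra

section
variable {F L : Type*} [Field F] [CharZero F] [IsAlgClosed F] [LieRing L] [LieAlgebra F L]
  [FiniteDimensional F L] {Q : Subgroup (lieAut F L)}

/-- homogeneous vectors -/
def Hg (Q : Subgroup (lieAut F L)) (x : L) : Prop := ∀ r ∈ Q, ∃ c : F, r.1 x = c • x

lemma hom_ss [IsKilling F L] (hQ : IsMaximalFiniteAbelian Q) (x : L) (hx : Hg Q x) (n : ℕ) (y : L)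
    (hy : ((ad F L x) ^ n) y = 0) : ⁅x, y⁆ = 0 := by
  classical
  by_cases hx0 : x = 0
  · rw [hx0, zero_lie]
  have hx' : ∀ r : lieAut F L, ∃ c : F, r ∈ Q → r.1 x = c • x := fun r => by
    by_cases hr : r ∈ Q
    · obtain ⟨c, hc⟩ := hx r hr; exact ⟨c, fun _ => hc⟩
    · exact ⟨0, fun h => absurd h hr⟩
  choose c hc using hx'
  have hcu : ∀ a b : F, a • x = b • x → a = b := fun a b h => by
    have : (a - b) • x = 0 := by rw [sub_smul, h, sub_self]
    exact sub_eq_zero.1 ((smul_eq_zero.1 this).resolve_right hx0)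
  have hc0 : ∀ r ∈ Q, c r ≠ 0 := fun r hr h => by
    have := hc r hr
    rw [h, zero_smul] at this
    exact hx0 (r.1.injective (by rw [this, map_zero]))
  have hcm : ∀ r ∈ Q, ∀ s ∈ Q, c (r * s) = c r * c s := fun r hr s hs => by
    apply hcu
    rw [← hc _ (Q.mul_mem hr hs)]
    show r.1 (s.1 x) = _
    rw [hc s hs, map_smul, hc r hr, smul_smul, mul_comm]
  have htop := Module.End.iSup_maxGenEigenspace_eq_top (ad F L x)
  have hind := Module.End.independent_maxGenEigenspace (ad F L x)
  obtain ⟨D, hD⟩ := der_ofdiag (ad F L x).maxGenEigenspace hind htop (gen_lie x)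
  obtain ⟨xs, hxs⟩ := LieDerivation.IsKilling.exists_eq_ad D
  have hs : ∀ μ, ∀ z ∈ (ad F L x).maxGenEigenspace μ, ⁅xs, z⁆ = μ • z := fun μ z hz => by
    rw [← hD μ z hz, ← hxs]; simp
  have hz0 : ∀ h : L, (∀ x : L, ⁅h, x⁆ = 0) → h = 0 := fun h hh => by
    have h1 : h ∈ LieAlgebra.center F L := by
      rw [LieModule.mem_maxTrivSubmodule]
      intro x; rw [← lie_skew, hh, neg_zero]
    rw [LieAlgebra.center_eq_bot] at h1
    simpa using h1
  have hrs : ∀ r ∈ Q, r.1 xs = c r • xs := fun r hr => by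
    rw [← sub_eq_zero]
    apply hz0
    have : (ad F L (r.1 xs - c r • xs) : L →ₗ[F] L) = 0 := diag_ext _ htop _ _ fun μ z hz => by
      have h1 := gen_aut r⁻¹ x (c r)⁻¹ (inv_ne_zero (hc0 r hr))
        (by
          have := aut_inv_apply r x
          rw [hc r hr, map_smul] at this
          conv_rhs => rw [← this, smul_smul, inv_mul_cancel₀ (hc0 r hr), one_smul])
        μ z hz
      rw [inv_inv] at h1
      have h2 := hs _ _ h1
      have h3 := congrArg r.1 h2
      rw [r.2, map_smul, aut_apply_inv] at h3
      rw [ad_apply, sub_lie, h3, smul_lie, hs μ z hz, smul_smul, sub_self]; rfl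
    exact fun z : L => LinearMap.congr_fun this z
  set y0 := x - xs with hy0
  have hr0 : ∀ r ∈ Q, r.1 y0 = c r • y0 := fun r hr => by
    rw [hy0, map_sub, hc r hr, hrs r hr, smul_sub]
  have hnil : IsNilpotent (ad F L y0) := by
    refine ⟨Module.finrank F L, ?_⟩
    refine diag_ext _ htop _ _ fun μ z hz => ?_
    have : ∀ k : ℕ, ((ad F L x - μ • 1) ^ k) z ∈ (ad F L x).maxGenEigenspace μ ∧
        ((ad F L y0) ^ k) z = ((ad F L x - μ • 1) ^ k) z := by
      intro k
      induction k with
      | zero => exact ⟨by simpa using hz, by simp⟩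
      | succ k ih =>
        have e : ad F L x ((((ad F L x - μ • 1) ^ k)) z) ∈ (ad F L x).maxGenEigenspace μ :=
          Module.End.mapsTo_maxGenEigenspace_of_comm (Commute.refl (ad F L x)) μ ih.1
        rw [pow_succ', Module.End.mul_apply, pow_succ', Module.End.mul_apply, ih.2]
        constructor
        · rw [LinearMap.sub_apply]
          exact Submodule.sub_mem _ e (by simpa using Submodule.smul_mem _ μ ih.1)
        · rw [hy0, map_sub, LinearMap.sub_apply, LinearMap.sub_apply, ad_apply F L xs, hs μ _ ih.1]
          simp
    rw [(this _).2]
    rw [Module.End.maxGenEigenspace_eq_genEigenspace_finrank, Module.End.mem_genEigenspace_nat] at hz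
    simpa using hz
  have hk : ∀ z, killingForm F L y0 z = 0 := by
    intro z
    haveI := hQ.1
    haveI : Fintype Q := Fintype.ofFinite Q
    let z' : L := ∑ r : Q, c r.1 • r.1.1 z
    have hz' : ∀ t ∈ Q, t.1 z' = (c t)⁻¹ • z' := fun t ht => by
      have : c t • t.1 z' = z' := by
        rw [map_sum, Finset.smul_sum]
        refine Eq.trans ?_ (Equiv.sum_comp (Equiv.mulLeft (⟨t, ht⟩ : Q)) fun r : Q => c r.1 • r.1.1 z)
        refine Finset.sum_congr rfl fun r _ => ?_
        simp only [Equiv.coe_mulLeft]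
        rw [map_smul, smul_smul, ← hcm t ht r.1 r.2]
        rfl
      rw [← this, smul_smul, inv_mul_cancel₀ (hc0 t ht), one_smul, this]
    have hbr : ⁅y0, z'⁆ = 0 := fix_zero hQ _ fun t ht => by
      rw [t.2, hr0 t ht, hz' t ht, smul_lie, lie_smul, smul_smul, mul_inv_cancel₀ (hc0 t ht), one_smul]
    have h1 : killingForm F L y0 z' = 0 := by
      rw [killingForm_apply_apply]
      have hcomm : Commute (ad F L y0) (ad F L z') := by
        refine LinearMap.ext fun w => ?_
        have := lie_lie y0 z' w
        rw [hbr, zero_lie] at this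
        exact sub_eq_zero.1 this.symm
      exact (LinearMap.isNilpotent_trace_of_isNilpotent (hcomm.isNilpotent_mul_right hnil)).eq_zero
    have h2 : killingForm F L y0 z' = (Fintype.card Q : F) * killingForm F L y0 z := by
      rw [map_sum]
      have : ∀ r : Q, killingForm F L y0 (c r.1 • r.1.1 z) = killingForm F L y0 z := fun r => by
        rw [map_smul, ← killing_inv r.1 y0 z, hr0 r.1 r.2, map_smul]; rfl
      rw [Finset.sum_congr rfl fun r _ => this r]
      simp
    rw [h1] at h2
    have h3 : (Fintype.card Q : F) ≠ 0 := by exact_mod_cast Fintype.card_ne_zero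
    exact (mul_eq_zero.1 h2.symm).resolve_left h3
  have : y0 = 0 := by
    have := LieAlgebra.IsKilling.killingForm_nondegenerate F L
    exact this.1 y0 hk
  have hyx : y ∈ (ad F L x).maxGenEigenspace 0 := by
    rw [Module.End.mem_maxGenEigenspace]
    exact ⟨n, by simpa using hy⟩
  have hx2 : x = xs := sub_eq_zero.1 this
  rw [hx2, hs 0 y hyx, zero_smul]

lemma hom_ind (hQ : IsMaximalFiniteAbelian Q) (Z W : Submodule F L) (hZ : ∀ r ∈ Q, ∀ z ∈ Z, r.1 z ∈ Z)
    (h : ∀ z ∈ Z, Hg Q z → z ∈ W) : Z ≤ W := by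
  obtain ⟨hN, hpow⟩ := pow_card hQ
  set N := Nat.card Q
  let f : Q → Module.End F Z := fun r => (r.1.1 : L →ₗ[F] L).restrict (fun z hz => hZ r.1 r.2 z hz)
  have hf : ∀ r : Q, ∀ z : Z, ((f r z : Z) : L) = r.1.1 (z : L) := fun r z => rfl
  have hfp : ∀ r : Q, ∀ n : ℕ, ∀ z : Z, (((f r) ^ n) z : L) = (r.1 ^ n).1 (z : L) := by
    intro r n z
    induction n with
    | zero => simp
    | succ n ih => rw [pow_succ', Module.End.mul_apply, hf, ih, pow_succ']; rfl
  have hss : ∀ r : Q, (f r).IsSemisimple := fun r => by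
    refine Module.End.isSemisimple_of_squarefree_aeval_eq_zero (p := Polynomial.X ^ N - 1)
      (Polynomial.Separable.squarefree ?_) ?_
    · rw [Polynomial.X_pow_sub_one_separable_iff]
      exact_mod_cast hN.ne'
    · rw [map_sub, map_pow, Polynomial.aeval_X, map_one, sub_eq_zero]
      ext z
      rw [hfp, hpow r.1 r.2]; rfl
  have key := Module.End.iSup_iInf_maxGenEigenspace_eq_top_of_forall_mapsTo f
    (fun i j φ => Module.End.mapsTo_maxGenEigenspace_of_comm (by
      show f j * f i = f i * f j
      ext z
      show j.1.1 (i.1.1 (z : L)) = i.1.1 (j.1.1 (z : L))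
      have := hQ.2.1 j.1 i.1 j.2 i.2
      exact congrArg (fun g : lieAut F L => g.1 (z : L)) this) φ)
    (fun i => Module.End.iSup_maxGenEigenspace_eq_top (f i))
  intro z hz
  have hle : (⨆ χ : Q → F, ⨅ i, (f i).maxGenEigenspace (χ i)) ≤ W.comap Z.subtype := by
    refine iSup_le fun χ z hz => ?_
    refine h z z.2 fun r hr => ⟨χ ⟨r, hr⟩, ?_⟩
    have h1 := (Submodule.mem_iInf _).1 hz ⟨r, hr⟩
    rw [(hss _).isFinitelySemisimple.maxGenEigenspace_eq_eigenspace, Module.End.mem_eigenspace_iff] at h1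
    exact congrArg Subtype.val h1
  rw [key] at hle
  exact hle (x := ⟨z, hz⟩) trivial

lemma two_cyc {a b : F} {m : ℕ} (ha : a ^ 2 ^ m = 1) (hb : b ^ 2 ^ m = 1) :
    (∃ k : ℕ, a ^ k * b = 1) ∨ ∃ k : ℕ, b ^ k * a = 1 := by
  have aux : ∀ a b : F, orderOf b ∣ orderOf a → a ^ 2 ^ m = 1 → b ^ 2 ^ m = 1 → ∃ k : ℕ, a ^ k * b = 1 := by
    intro a b h ha hb
    have b0 : b ≠ 0 := by rintro rfl; simp at hb
    have hprim := IsPrimitiveRoot.orderOf a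
    haveI : NeZero (orderOf a) := ⟨fun h0 => by
      rw [orderOf_eq_zero_iff'] at h0
      exact h0 (2 ^ m) (by positivity) ha⟩
    obtain ⟨k, -, hk⟩ := hprim.eq_pow_of_pow_eq_one (ξ := b⁻¹) (by
      rw [inv_pow, orderOf_dvd_iff_pow_eq_one.1 h, inv_one])
    exact ⟨k, by rw [hk, inv_mul_cancel₀ b0]⟩
  obtain ⟨i, -, hi⟩ := (Nat.dvd_prime_pow Nat.prime_two).1 (orderOf_dvd_of_pow_eq_one ha)
  obtain ⟨j, -, hj⟩ := (Nat.dvd_prime_pow Nat.prime_two).1 (orderOf_dvd_of_pow_eq_one hb)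
  rcases le_total i j with h | h
  · right; exact aux b a (by rw [hi, hj]; exact pow_dvd_pow 2 h) hb ha
  · left; exact aux a b (by rw [hi, hj]; exact pow_dvd_pow 2 h) ha hb

lemma lemP [IsKilling F L] (hQ : IsMaximalFiniteAbelian Q) (Z : Submodule F L)
    (hZ : ∀ r ∈ Q, ∀ z ∈ Z, r.1 z ∈ Z) (hl : ∀ x ∈ Z, ∀ y ∈ Z, ⁅x, y⁆ ∈ Z) (q : lieAut F L) (hq : q ∈ Q)
    (m : ℕ) (hm : q ^ 2 ^ m = 1) (hc : ∀ x ∈ Z, q.1 x = x → ∀ y ∈ Z, ⁅x, y⁆ = 0) :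
    ∀ x ∈ Z, ∀ y ∈ Z, ⁅x, y⁆ = 0 := by
  have aux : ∀ x ∈ Z, Hg Q x → ∀ y ∈ Z, ∀ a b : F, q.1 x = a • x → q.1 y = b • y → ∀ k : ℕ, a ^ k * b = 1 →
      ⁅x, y⁆ = 0 := by
    intro x hx hxg y hy a b ha hb k hk
    have h1 : ∀ i : ℕ, ((ad F L x) ^ i) y ∈ Z ∧ q.1 (((ad F L x) ^ i) y) = (a ^ i * b) • ((ad F L x) ^ i) y := by
      intro i
      induction i with
      | zero => exact ⟨by simpa using hy, by simpa using hb⟩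
      | succ i ih =>
        rw [pow_succ', Module.End.mul_apply, ad_apply]
        refine ⟨hl _ hx _ ih.1, ?_⟩
        rw [q.2, ih.2, ha, smul_lie, lie_smul, smul_smul]
        congr 1; ring
    refine hom_ss hQ x hxg (k + 1) y ?_
    obtain ⟨h2, h3⟩ := h1 k
    rw [hk, one_smul] at h3
    rw [pow_succ', Module.End.mul_apply, ad_apply, ← lie_skew, hc _ h2 h3 x hx, neg_zero]
  have ev1 : ∀ x, ∀ a : F, x ≠ 0 → q.1 x = a • x → a ^ 2 ^ m = 1 := fun x a hx0 h => by
    have h1 := aut_pow q (2 ^ m) x a h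
    rw [hm] at h1
    have h3 : (a ^ 2 ^ m - 1) • x = 0 := by
      rw [sub_smul, ← h1, one_smul]; exact sub_self _
    exact sub_eq_zero.1 ((smul_eq_zero.1 h3).resolve_right hx0)
  intro x hx
  have : Z ≤ LinearMap.ker (ad F L x : L →ₗ[F] L) := by
    refine hom_ind hQ Z _ hZ fun y hy hyg => ?_
    have h2 : Z ≤ LinearMap.ker (ad F L y : L →ₗ[F] L) := by
      refine hom_ind hQ Z _ hZ fun x hx hxg => ?_
      rw [LinearMap.mem_ker, ad_apply]
      by_cases hx0 : x = 0
      · rw [hx0, lie_zero]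
      by_cases hy0 : y = 0
      · rw [hy0, zero_lie]
      obtain ⟨a, ha⟩ := hxg q hq
      obtain ⟨b, hb⟩ := hyg q hq
      rcases two_cyc (ev1 x a hx0 ha) (ev1 y b hy0 hb) with ⟨k, hk⟩ | ⟨k, hk⟩
      · rw [← lie_skew, aux x hx hxg y hy a b ha hb k hk, neg_zero]
      · exact aux y hy hyg x hx b a hb ha k hk
    have h3 : ⁅y, x⁆ = 0 := h2 hx
    rw [LinearMap.mem_ker, ad_apply, ← lie_skew, h3, neg_zero]
  exact fun y hy => this hy
end
end E8P

set_option linter.unusedSectionVars false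
set_option linter.style.haveILetI false

namespace E8P
open LieAlgebra

section
variable {F L : Type*} [Field F] [LieRing L] [LieAlgebra F L]

/-- A root frame of type `E₈`. -/
structure Fr (H : LieSubalgebra F L) (E : V →+ Module.Dual F H) : Prop where
  ab : ∀ x ∈ H, ∀ y ∈ H, ⁅x, y⁆ = 0
  cent : ∀ x : L, (∀ h ∈ H, ⁅h, x⁆ = 0) → x ∈ H
  inj : Function.Injective E
  span : Submodule.span F (Set.range E) = ⊤
  fr8 : Module.finrank F H = 8
  one : ∀ v ∈ Rt, Module.finrank F (RS H (E v)) = 1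
  root : ∀ χ, χ ≠ 0 → RS H χ ≠ ⊥ → ∃ v ∈ Rt, χ = E v
  top : ⨆ χ, RS H χ = ⊤
  sl2 : ∀ v ∈ Rt, ∃ e ∈ RS H (E v), ∃ f ∈ RS H (E (-v)), ∃ h : H, (h : L) = ⁅e, f⁆ ∧ E v h = 2

lemma Fr.trans {H : LieSubalgebra F L} {E : V →+ Module.Dual F H} (hE : Fr H E) (g : V ≃+ V)
    (hg : ∀ v, v ∈ Rt ↔ g v ∈ Rt) : Fr H (E.comp g.toAddMonoidHom) where
  ab := hE.ab
  cent := hE.cent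
  inj := hE.inj.comp g.injective
  span := by
    rw [← hE.span]
    congr 1
    exact g.surjective.range_comp E
  fr8 := hE.fr8
  one v hv := hE.one _ ((hg v).1 hv)
  root χ h0 h := by
    obtain ⟨v, hv, h⟩ := hE.root χ h0 h
    refine ⟨g.symm v, (hg _).2 (by simpa using hv), ?_⟩
    rw [h]; simp
  top := hE.top
  sl2 v hv := by
    have := hE.sl2 _ ((hg v).1 hv)
    rw [← map_neg] at this
    exact this
end

section
variable {F L : Type*} [Field F] [CharZero F] [IsAlgClosed F] [LieRing L] [LieAlgebra F L]
  [FiniteDimensional F L]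

lemma fr_of_csa [IsKilling F L] (H : LieSubalgebra F L) [H.IsCartanSubalgebra]
    (B : Module.Basis (Fin 8) F (Module.Dual F H)) (hB : IsE8 B) :
    ∃ E, Fr H E := by
  let E : V →+ Module.Dual F H :=
    { toFun := ev B, map_zero' := ev_zero B, map_add' := ev_add B }
  have hEv : ∀ v, E v = ev B v := fun v => rfl
  have hne : ∀ v ∈ Rt, E v ≠ 0 := fun v hv h => by
    rw [← map_zero E] at h
    exact root_ne_zero v ((mem_Rt v).1 hv) (ev_inj B h)
  have hRS : ∀ v ∈ Rt, RS H (E v) ≠ ⊥ := fun v hv =>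
    (hB _ (hne v hv)).2 ⟨v, (mem_Rt v).1 hv, rfl⟩
  have hgs : ∀ v ∈ Rt, LieModule.genWeightSpace L (E v : H → F) ≠ ⊥ := fun v hv h => by
    obtain ⟨x, hx, hx0⟩ := (Submodule.ne_bot_iff _).1 (hRS v hv)
    rw [mem_RS_iff] at hx
    apply hx0
    have : x ∈ LieModule.genWeightSpace L (E v : H → F) := hx
    rw [h] at this
    simpa using this
  refine ⟨E, ⟨csa_ab H, fun x hx => ?_, ev_inj B, ?_, ?_, fun v hv => ?_, fun χ h0 h => ?_, ?_, fun v hv => ?_⟩⟩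
  · have h1 : x ∈ RS H (0 : Module.Dual F H) := by
      rw [mem_RS]
      intro h
      rw [hx h h.2]; simp
    rw [mem_RS_iff] at h1
    have h2 : x ∈ LieAlgebra.rootSpace H (0 : H → F) := h1
    rw [LieAlgebra.rootSpace_zero_eq] at h2
    simpa using h2
  · rw [eq_top_iff, ← B.span_eq]
    apply Submodule.span_mono
    rintro _ ⟨i, rfl⟩
    exact ⟨sr i, ev_sr B i⟩
  · have := Module.finrank_eq_card_basis B
    rw [Subspace.dual_finrank_eq] at this
    simpa using this
  · let α : LieModule.Weight F H L := ⟨E v, hgs v hv⟩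
    have hα : α.IsNonZero := fun h => hne v hv (by
      ext y
      exact congrFun h y)
    have h1 := IsKilling.finrank_rootSpace_eq_one α hα
    rw [← h1]
    have : RS H (E v) = (LieAlgebra.rootSpace H (E v)).toSubmodule := by
      ext x
      rw [mem_RS_iff]; rfl
    rw [this]; rfl
  · obtain ⟨v, hv, h⟩ := (hB χ h0).1 h
    exact ⟨v, (mem_Rt v).2 hv, h⟩
  · obtain ⟨ι, _, _, ⟨w⟩⟩ := exists_WBasis H
    rw [eq_top_iff, ← w.b.span_eq, Submodule.span_le]
    rintro _ ⟨i, rfl⟩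
    exact Submodule.mem_iSup_of_mem (w.wt i) (w.mem i)
  · let α : LieModule.Weight F H L := ⟨E v, hgs v hv⟩
    have hα : α.IsNonZero := fun h => hne v hv (by
      ext y
      exact congrFun h y)
    obtain ⟨h, e, f, ht, he, hf⟩ := IsKilling.exists_isSl2Triple_of_weight_isNonZero hα
    have he' : e ∈ RS H (E v) := by rw [mem_RS_iff]; exact he
    have hf' : f ∈ RS H (E (-v)) := by
      rw [mem_RS_iff, map_neg]; exact hf
    have hh : h ∈ RS H (E v + E (-v)) := by
      rw [← ht.lie_e_f]; exact lie_RS H he' hf'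
    rw [← map_add, add_neg_cancel, map_zero, mem_RS_iff] at hh
    have hh2 : h ∈ LieAlgebra.rootSpace H (0 : H → F) := hh
    rw [LieAlgebra.rootSpace_zero_eq] at hh2
    have hh3 : h ∈ H := by simpa using hh2
    refine ⟨e, he', f, hf', ⟨h, hh3⟩, ht.lie_e_f.symm, ?_⟩
    have h1 := (mem_RS H).1 he' ⟨h, hh3⟩
    have h2 : ⁅h, e⁆ = (2 : F) • e := by rw [ht.lie_h_e_nsmul, two_smul, two_smul]
    rw [h2] at h1
    have h3 : (E v ⟨h, hh3⟩ - 2) • e = 0 := by rw [sub_smul, ← h1, sub_self]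
    exact sub_eq_zero.1 ((smul_eq_zero.1 h3).resolve_right ht.e_ne_zero)

variable {H : LieSubalgebra F L} {E : V →+ Module.Dual F H}

lemma Fr.ne (hE : Fr H E) {v : V} (hv : v ≠ 0) : E v ≠ 0 := fun h => hv (hE.inj (by rw [h, map_zero]))

lemma rt_ne {v : V} (hv : v ∈ Rt) : v ≠ 0 := root_ne_zero v ((mem_Rt v).1 hv)

lemma Fr.bot (hE : Fr H E) {v : V} (h0 : v ≠ 0) (hv : v ∉ Rt) {x : L} (hx : x ∈ RS H (E v)) : x = 0 := by
  by_contra hx0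
  obtain ⟨w, hw, h⟩ := hE.root (E v) (hE.ne h0) (fun h => by rw [h] at hx; exact hx0 (by simpa using hx))
  rw [hE.inj h] at hv
  exact hv hw

lemma Fr.mem (hE : Fr H E) {v : V} (hv : v ∈ Rt) {e x : L} (he : e ∈ RS H (E v)) (he0 : e ≠ 0)
    (hx : x ∈ RS H (E v)) : ∃ c : F, x = c • e := by
  have h1 := hE.one v hv
  obtain ⟨c, hc⟩ := (finrank_eq_one_iff_of_nonzero' (⟨e, he⟩ : RS H (E v))
    (fun h => he0 (congrArg Subtype.val h))).1 h1 ⟨x, hx⟩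
  exact ⟨c, (congrArg Subtype.val hc).symm⟩

lemma Fr.ex (hE : Fr H E) {v : V} (hv : v ∈ Rt) : ∃ e ∈ RS H (E v), e ≠ 0 := by
  have h1 := hE.one v hv
  obtain ⟨e, he, -⟩ := finrank_eq_one_iff'.1 h1
  exact ⟨e, e.2, fun h => he (Subtype.ext h)⟩

lemma Fr.not_mem (hE : Fr H E) {v : V} (hv : v ∈ Rt) {e : L} (he : e ∈ RS H (E v)) (he0 : e ≠ 0) : e ∉ H := by
  intro hH
  apply hE.ne (rt_ne hv)
  ext h
  have := (mem_RS H).1 he h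
  rw [hE.ab h h.2 e hH] at this
  simpa [he0] using this.symm

lemma Fr.RS0 (hE : Fr H E) {x : L} : x ∈ RS H (0 : Module.Dual F H) ↔ x ∈ H := by
  constructor
  · intro hx
    exact hE.cent x fun h hh => by
      rw [(mem_RS H).1 hx ⟨h, hh⟩]; simp
  · intro hx
    rw [mem_RS]
    intro h
    rw [hE.ab h h.2 x hx]; simp

lemma Fr.sep (hE : Fr H E) (h : H) (h0 : ∀ v, E v h = 0) : h = 0 := by
  have : ∀ χ : Module.Dual F H, χ h = 0 := by
    intro χ
    have h1 : (⊤ : Submodule F (Module.Dual F H)) ≤ LinearMap.ker (Module.Dual.eval F H h) := by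
      rw [← hE.span, Submodule.span_le]
      rintro _ ⟨v, rfl⟩
      exact h0 v
    exact h1 (x := χ) trivial
  exact (Module.forall_dual_apply_eq_zero_iff F h).1 this

lemma Fr.brk (hE : Fr H E) {v w : V} (hv : v ∈ Rt) (hw : w ∈ Rt) (hvw : v + w ∈ Rt) {a b : L}
    (ha : a ∈ RS H (E v)) (ha0 : a ≠ 0) (hb : b ∈ RS H (E w)) (hb0 : b ≠ 0) : ⁅a, b⁆ ≠ 0 := by
  intro hab
  obtain ⟨e, he, f, hf, h, hh, h2⟩ := hE.sl2 v hv
  have nv := (mem_Rt _).1 hv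
  have nw := (mem_Rt _).1 hw
  have nvw := (mem_Rt _).1 hvw
  rw [Bf_add_left, Bf_add_right, Bf_add_right, nv, nw, Bf_comm w v] at nvw
  have hB : Bf v w = -1 := by omega
  obtain ⟨c, rfl⟩ := hE.mem hv ha ha0 he
  have he1 : ⁅c • a, b⁆ = 0 := by rw [smul_lie, hab, smul_zero]
  have hfb : ⁅f, b⁆ = 0 := by
    have := lie_RS H hf hb
    rw [← map_add] at this
    refine hE.bot ?_ ?_ this
    · intro h0
      have h3 : w = v := by rw [neg_add_eq_zero] at h0; exact h0.symm
      rw [h3, nv] at hB; omega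
    · rw [mem_Rt, Bf_add_left, Bf_add_right, Bf_add_right, Bf_neg_left, Bf_neg_right, Bf_neg_right, Bf_neg_left,
        Bf_comm w v, nv, nw, hB]; norm_num
  have hEw : E w h = 0 := by
    have h1 := (mem_RS H).1 hb h
    rw [hh, lie_lie, hfb, he1, lie_zero, lie_zero, sub_zero] at h1
    exact (smul_eq_zero.1 h1.symm).resolve_right hb0
  obtain ⟨d, hd, hd0⟩ := hE.ex hvw
  have hed : ⁅c • a, d⁆ = 0 := by
    have := lie_RS H he hd
    rw [← map_add] at this
    refine hE.bot ?_ ?_ this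
    · intro h0
      have : Bf (v + (v + w)) v = 0 := by rw [h0]; exact Bf_zero_left v
      rw [Bf_add_left, Bf_add_left, Bf_comm w v, nv, hB] at this; omega
    · rw [mem_Rt]
      simp only [Bf_add_left, Bf_add_right]
      rw [Bf_comm w v, nv, nw, hB]; norm_num
  have h1 := (mem_RS H).1 hd h
  rw [hh, lie_lie, hed, lie_zero, sub_zero, map_add, LinearMap.add_apply, h2, hEw, add_zero] at h1
  have hfd : ⁅f, d⁆ ∈ RS H (E w) := by
    have := lie_RS H hf hd
    rwa [← map_add, neg_add_cancel_left] at this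
  obtain ⟨k, hk⟩ := hE.mem hw hb hb0 hfd
  rw [hk, lie_smul, he1, smul_zero] at h1
  rcases smul_eq_zero.1 h1.symm with h | h
  · exact two_ne_zero h
  · exact hd0 h

lemma fix_count {ι M : Type*} [Fintype ι] [AddCommGroup M] [Module F M] (b : Module.Basis ι F M)
    (φ : M →ₗ[F] M) (s : ι → F) (hφ : ∀ i, φ (b i) = s i • b i) :
    Module.finrank F (LinearMap.eqLocus φ LinearMap.id) = Nat.card {i // s i = 1} := by
  classical
  have e : LinearMap.eqLocus φ LinearMap.id = Submodule.span F (Set.range fun i : {i // s i = 1} => b i) := by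
    apply le_antisymm
    · intro x hx
      have hx' : φ x = x := hx
      have hc : ∀ i, s i * b.repr x i = b.repr x i := fun i => by
        have h1 : φ x = ∑ j, (b.repr x j * s j) • b j := by
          conv_lhs => rw [← b.sum_repr x, map_sum]
          refine Finset.sum_congr rfl fun j _ => ?_
          rw [map_smul, hφ, smul_smul]
        have h2 := congrArg (fun y => b.repr y i) h1
        beta_reduce at h2
        rw [hx', b.repr_sum_self] at h2
        rw [mul_comm]; exact h2.symm
      rw [← b.sum_repr x]
      refine Submodule.sum_mem _ fun i _ => ?_
      by_cases hi : s i = 1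
      · exact Submodule.smul_mem _ _ (Submodule.subset_span ⟨⟨i, hi⟩, rfl⟩)
      · have : b.repr x i = 0 := by
          have h3 : (s i - 1) * b.repr x i = 0 := by rw [sub_mul, hc, one_mul, sub_self]
          exact (mul_eq_zero.1 h3).resolve_left (sub_ne_zero.2 hi)
        rw [this, zero_smul]; exact Submodule.zero_mem _
    · rw [Submodule.span_le]
      rintro _ ⟨i, rfl⟩
      show φ (b i) = b i
      rw [hφ, i.2, one_smul]
  rw [e, finrank_span_eq_card, Nat.card_eq_fintype_card]
  exact b.linearIndependent.comp _ Subtype.val_injective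

open Classical in
lemma cnt_aux {α : Type*} (R : Finset α) (n : Option R → ℕ) (t : Option R → F) (s : α → F) (h0 : n none = 8)
    (h1 : ∀ v, n (some v) = 1) (ht0 : t none = 1) (ht : ∀ v : R, t (some v) = s v) :
    Nat.card {x : Σ i, Fin (n i) // t x.1 = 1} = 8 + (R.filter fun v => s v = 1).card := by
  rw [Nat.card_eq_fintype_card, Fintype.card_subtype, Finset.card_filter, Fintype.sum_sigma, Fintype.sum_option]
  simp only [ht0, ht, Finset.sum_const, Finset.card_univ, Fintype.card_fin, h0, h1]
  rw [Finset.card_filter, ← Finset.sum_coe_sort R]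
  simp

open Classical in
lemma Fr.count (hE : Fr H E) (φ : L →ₗ[F] L) (s : V → F) (h0 : ∀ h ∈ H, φ h = h)
    (h1 : ∀ v ∈ Rt, ∀ e ∈ RS H (E v), φ e = s v • e) :
    Module.finrank F (LinearMap.eqLocus φ LinearMap.id) = 8 + (Rt.filter fun v => s v = 1).card := by
  let A : Option Rt → Submodule F L := fun i => RS H (i.elim 0 fun v => E v)
  let n : Option Rt → ℕ := fun i => i.elim 8 fun _ => 1
  let t : Option Rt → F := fun i => i.elim 1 fun v => s v
  have hinj : Function.Injective (fun i : Option Rt => i.elim (0 : Module.Dual F H) fun v => E v) := by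
    rintro (_ | v) (_ | w) h
    · rfl
    · exact absurd h.symm (hE.ne (rt_ne w.2))
    · exact absurd h (hE.ne (rt_ne v.2))
    · have := hE.inj h
      rw [Subtype.ext this]
  have hA : iSupIndep A := (RS_indep H hE.ab).comp hinj
  have hT : iSup A = ⊤ := by
    rw [eq_top_iff, ← hE.top]
    refine iSup_le fun χ => ?_
    by_cases h : χ = 0
    · rw [h]; exact le_iSup A none
    · by_cases hb : RS H χ = ⊥
      · rw [hb]; exact bot_le
      · obtain ⟨v, hv, rfl⟩ := hE.root χ h hb
        exact le_iSup A (some ⟨v, hv⟩)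
  have hI : DirectSum.IsInternal A := (DirectSum.isInternal_submodule_iff_iSupIndep_and_iSup_eq_top A).2
    ⟨hA, hT⟩
  have hn : ∀ i, Module.finrank F (A i) = n i := by
    rintro (_ | v)
    · have : A none = H.toSubmodule := by
        ext x
        exact hE.RS0
      rw [this]; exact hE.fr8
    · exact hE.one v.1 v.2
  let b := hI.collectedBasis fun i => Module.finBasisOfFinrankEq F (A i) (hn i)
  have hb : ∀ x, b x ∈ A x.1 := fun x => hI.collectedBasis_mem _ x
  rw [fix_count b φ (fun x => t x.1) ?_]
  · exact cnt_aux Rt n t s rfl (fun _ => rfl) rfl (fun _ => rfl)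
  · rintro ⟨i, j⟩
    have hm := hb ⟨i, j⟩
    rcases i with (_ | v)
    · rw [h0 _ (hE.RS0.1 hm)]; simp [t]
    · exact h1 v.1 v.2 _ hm
end
end E8P

set_option linter.unusedSectionVars false
set_option linter.style.haveILetI false

namespace E8P
open LieAlgebra

section
variable {F L : Type*} [Field F] [CharZero F] [IsAlgClosed F] [LieRing L] [LieAlgebra F L]
  [FiniteDimensional F L]
variable {H : LieSubalgebra F L} {E : V →+ Module.Dual F H}

lemma sr_Rt (i : Fin 8) : sr i ∈ Rt := (mem_Rt _).2 (by revert i; decide +kernel)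

lemma neg_Rt {v : V} (h : v ∈ Rt) : -v ∈ Rt := by
  rw [mem_Rt] at h ⊢
  rw [Bf_neg_left, Bf_neg_right, h]; norm_num

/-- `w` is the action of `r` on the root lattice. -/
structure Wr (H : LieSubalgebra F L) (E : V →+ Module.Dual F H) (r : lieAut F L) (w : V ≃+ V) : Prop where
  eq : ∀ v (h k : H), r.1 (k : L) = h → E (w v) h = E v k
  rt : ∀ v ∈ Rt, w v ∈ Rt
  rt' : ∀ v ∈ Rt, w.symm v ∈ Rt
  mem : ∀ v, ∀ e ∈ RS H (E v), r.1 e ∈ RS H (E (w v))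

lemma w_half (hE : Fr H E) (r : lieAut F L) (hs : ∀ h ∈ H, r.1 h ∈ H) (hs' : ∀ h ∈ H, (r⁻¹).1 h ∈ H) :
    ∃ w : V →+ V, (∀ v (h k : H), r.1 (k : L) = h → E (w v) h = E v k) ∧ (∀ v ∈ Rt, w v ∈ Rt) ∧
      (∀ v, ∀ e ∈ RS H (E v), r.1 e ∈ RS H (E (w v))) := by
  let R : H →ₗ[F] H := ((r⁻¹).1 : L →ₗ[F] L).restrict (p := H.toSubmodule) (q := H.toSubmodule) hs'
  have hR : ∀ h : H, ((R h : H) : L) = (r⁻¹).1 (h : L) := fun h => rfl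
  let D : Module.Dual F H →ₗ[F] Module.Dual F H := LinearMap.lcomp F F R
  have hD : ∀ χ h, D χ h = χ (R h) := fun χ h => rfl
  have hRS : ∀ χ, ∀ e ∈ RS H χ, r.1 e ∈ RS H (D χ) := by
    intro χ e he
    rw [mem_RS] at he ⊢
    intro h
    have h1 : (h : L) = r.1 (R h : L) := by rw [hR, aut_apply_inv]
    conv_lhs => rw [h1]
    rw [← r.2, he, map_smul, hD]
  have hrt : ∀ v ∈ Rt, ∃ u ∈ Rt, D (E v) = E u := by
    intro v hv
    obtain ⟨e, he, he0⟩ := hE.ex hv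
    refine hE.root _ ?_ ?_
    · intro h0
      apply hE.ne (rt_ne hv)
      ext k
      have h2 := congrArg (fun χ : Module.Dual F H => χ ⟨r.1 k, hs k k.2⟩) h0
      have h3 : R ⟨r.1 k, hs k k.2⟩ = k := Subtype.ext (by rw [hR]; exact aut_inv_apply r k)
      beta_reduce at h2
      rw [hD, h3] at h2
      exact h2
    · intro h0
      have := hRS _ e he
      rw [h0, Submodule.mem_bot] at this
      exact he0 ((map_eq_zero_iff _ r.1.injective).1 this)
  have hall : ∀ v, ∃ u, E u = D (E v) := by
    intro v
    have h1 : D (E v) = ∑ i, v i • D (E (sr i)) := by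
      exact hom_sum (D.toAddMonoidHom.comp E) v
    choose t ht1 ht2 using fun i => hrt (sr i) (sr_Rt i)
    refine ⟨∑ i, v i • t i, ?_⟩
    rw [h1, map_sum]
    refine Finset.sum_congr rfl fun i _ => ?_
    rw [map_zsmul, ht2]
  choose w hw using hall
  refine ⟨{ toFun := w, map_zero' := hE.inj (by rw [hw]; simp), map_add' := fun a b => hE.inj (by
    rw [hw, map_add, map_add, map_add, hw, hw]) }, ?_, ?_, ?_⟩
  · intro v h k hk
    show E (w v) h = _
    rw [hw, hD]
    congr 1
    apply Subtype.ext
    rw [hR, ← hk]; exact aut_inv_apply r k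
  · intro v hv
    obtain ⟨u, hu, h⟩ := hrt v hv
    show w v ∈ Rt
    rw [← hw] at h
    rw [hE.inj h]; exact hu
  · intro v e he
    show r.1 e ∈ RS H (E (w v))
    rw [hw]; exact hRS _ e he

lemma wr_ex (hE : Fr H E) (r : lieAut F L) (hs : ∀ h ∈ H, r.1 h ∈ H) (hs' : ∀ h ∈ H, (r⁻¹).1 h ∈ H) :
    ∃ w, Wr H E r w := by
  obtain ⟨w, h1, h2, h3⟩ := w_half hE r hs hs'
  obtain ⟨w', h1', h2', -⟩ := w_half hE r⁻¹ hs' (by rw [inv_inv]; exact hs)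
  refine ⟨{ w with invFun := w', left_inv := fun v => hE.inj ?_, right_inv := fun v => hE.inj ?_ }, ⟨h1, h2, h2', h3⟩⟩
  · ext k
    show E (w' (w v)) k = E v k
    rw [h1' (w v) k ⟨r.1 k, hs k k.2⟩ (aut_inv_apply r k)]
    exact h1 v _ k rfl
  · ext k
    show E (w (w' v)) k = E v k
    rw [h1 (w' v) k ⟨(r⁻¹).1 k, hs' k k.2⟩ (aut_apply_inv r k)]
    exact h1' v _ k rfl

lemma aut_char (hE : Fr H E) (φ : lieAut F L) (h0 : ∀ h ∈ H, φ.1 h = h) :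
    ∃ u : V →+ Additive Fˣ, ∀ v ∈ Rt, ∀ e ∈ RS H (E v), φ.1 e = ch u v • e := by
  have hs : ∀ v, ∃ s : Fˣ, v ∈ Rt → ∀ e ∈ RS H (E v), φ.1 e = (s : F) • e := by
    intro v
    by_cases hv : v ∈ Rt
    · obtain ⟨e, he, he0⟩ := hE.ex hv
      have hm : φ.1 e ∈ RS H (E v) := by
        rw [mem_RS] at he ⊢
        intro h
        conv_lhs => rw [← h0 h h.2]
        rw [← φ.2, he, map_smul]
      obtain ⟨c, hc⟩ := hE.mem hv he he0 hm
      have hc0 : c ≠ 0 := by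
        rintro rfl
        rw [zero_smul] at hc
        exact he0 ((map_eq_zero_iff _ φ.1.injective).1 hc)
      refine ⟨Units.mk0 c hc0, fun _ x hx => ?_⟩
      obtain ⟨d, rfl⟩ := hE.mem hv he he0 hx
      rw [map_smul, hc, smul_comm]; rfl
    · exact ⟨1, fun h => absurd h hv⟩
  choose s hs using hs
  let u : V →+ Additive Fˣ :=
    { toFun := fun v => ∑ i, v i • Additive.ofMul (s (sr i))
      map_zero' := by simp
      map_add' := fun a b => by
        rw [← Finset.sum_add_distrib]
        exact Finset.sum_congr rfl fun i _ => add_zsmul (Additive.ofMul (s (sr i))) (a i) (b i) }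
  have husr : ∀ i, ch u (sr i) = s (sr i) := by
    intro i
    have : u (sr i) = Additive.ofMul (s (sr i)) := by
      show ∑ j, (sr i) j • Additive.ofMul (s (sr j)) = _
      rw [Finset.sum_eq_single i]
      · simp [sr]
      · intro j _ hj
        simp [sr, hj]
      · simp
    rw [ch, this]; rfl
  have hpos : ∀ n : ℕ, ∀ v : V, Bf v v = 2 → 0 ≤ v → ht v ≤ n → (s v : F) = ch u v := by
    intro n
    induction n with
    | zero =>
      intro v h hv hn
      have := ht_pos v hv (root_ne_zero v h)
      push_cast at hn; omega
    | succ n ih =>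
      intro v h hv hn
      rcases pos_root_split v h hv with ⟨i, rfl⟩ | ⟨i, h1, h2, -⟩
      · exact (husr i).symm
      · have h3 := ih (v - sr i) h1 h2 (by rw [ht_sub, ht_sr]; push_cast at hn; omega)
        have hvR : v ∈ Rt := (mem_Rt v).2 h
        have hv2 : v - sr i ∈ Rt := (mem_Rt _).2 h1
        obtain ⟨a, ha, ha0⟩ := hE.ex hv2
        obtain ⟨b, hb, hb0⟩ := hE.ex (sr_Rt i)
        have hab := hE.brk hv2 (sr_Rt i) (by rw [sub_add_cancel]; exact hvR) ha ha0 hb hb0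
        have hm := lie_RS H ha hb
        rw [← map_add, sub_add_cancel] at hm
        have h4 := hs v hvR _ hm
        rw [φ.2, hs _ hv2 a ha, hs _ (sr_Rt i) b hb, smul_lie, lie_smul, smul_smul] at h4
        have h5 := smul_left_injective F hab h4
        have : v = (v - sr i) + sr i := by rw [sub_add_cancel]
        conv_rhs => rw [this]
        rw [ch_add, ← h3, husr]; exact h5.symm
  refine ⟨u, fun v hv e he => ?_⟩
  rw [hs v hv e he]
  congr 1
  have h2 := (mem_Rt v).1 hv
  rcases root_sign v h2 with h | h
  · exact hpos (ht v).toNat v h2 h (by simp)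
  · have h3 := hpos (ht (-v)).toNat (-v) ((mem_Rt _).1 (neg_Rt hv)) (by simpa using h) (by simp)
    obtain ⟨a, ha, b, hb, k, hk, hk2⟩ := hE.sl2 v hv
    have h4 := h0 k k.2
    rw [hk, φ.2, hs v hv a ha, hs _ (neg_Rt hv) b hb, smul_lie, lie_smul, smul_smul] at h4
    have hk0 : (⁅a, b⁆ : L) ≠ 0 := by
      rw [← hk]
      intro h5
      have : k = 0 := Subtype.ext h5
      rw [this, map_zero] at hk2
      exact two_ne_zero hk2.symm
    have h6 : (s v : F) * s (-v) = 1 := by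
      apply smul_left_injective F hk0
      beta_reduce
      rw [h4, one_smul]
    rw [h3, ch_neg] at h6
    exact (mul_inv_eq_one₀ (ch_ne _ _)).1 h6

lemma ch_ext {u u' : V →+ Additive Fˣ} (h : ∀ v ∈ Rt, ch u v = ch u' v) (v : V) : ch u v = ch u' v := by
  have h1 : u v = u' v := by
    rw [hom_sum u, hom_sum u']
    refine Finset.sum_congr rfl fun i _ => ?_
    congr 1
    exact Additive.toMul.injective (Units.ext (h _ (sr_Rt i)))
  rw [ch, h1]; rfl

/-- invariance of characters under commuting elements -/
lemma ch_inv (hE : Fr H E) (φ : lieAut F L) (u : V →+ Additive Fˣ)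
    (hu : ∀ v ∈ Rt, ∀ e ∈ RS H (E v), φ.1 e = ch u v • e) (r : lieAut F L) (w : V ≃+ V) (hw : Wr H E r w)
    (hr : r * φ = φ * r) (v : V) : ch u (w v) = ch u v := by
  have key : ∀ v ∈ Rt, ch u (w v) = ch u v := by
    intro v hv
    obtain ⟨e, he, he0⟩ := hE.ex hv
    have h1 := hu _ (hw.rt v hv) _ (hw.mem v e he)
    have h2 : φ.1 (r.1 e) = r.1 (φ.1 e) := by
      have := congrArg (fun t : lieAut F L => t.1 e) hr
      exact this.symm
    rw [h2, hu v hv e he, map_smul] at h1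
    exact (smul_left_injective F (fun h => he0 ((map_eq_zero_iff _ r.1.injective).1 h)) h1).symm
  exact ch_ext (u := u.comp w.toAddMonoidHom) (u' := u) key v

end
end E8P

set_option linter.unusedSectionVars false
set_option linter.style.haveILetI false

namespace E8P
open LieAlgebra

section
variable {F L : Type*} [Field F] [CharZero F] [IsAlgClosed F] [LieRing L] [LieAlgebra F L]
  [FiniteDimensional F L] {Q : Subgroup (lieAut F L)}

lemma comm_apply (hQ : IsMaximalFiniteAbelian Q) {r s : lieAut F L} (hr : r ∈ Q) (hs : s ∈ Q) (x : L) :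
    r.1 (s.1 x) = s.1 (r.1 x) :=
  congrArg (fun t : lieAut F L => t.1 x) (hQ.2.1 r s hr hs)

/-- stable abelian submodules fixed by two automorphisms -/
structure PP (Q : Subgroup (lieAut F L)) (θ q : lieAut F L) (M : Submodule F L) : Prop where
  st : ∀ r ∈ Q, ∀ z ∈ M, r.1 z ∈ M
  ab : ∀ x ∈ M, ∀ y ∈ M, ⁅x, y⁆ = 0
  fx : ∀ x ∈ M, θ.1 x = x ∧ q.1 x = x

lemma PP.sup {θ q : lieAut F L} {M : Submodule F L} (hM : PP Q θ q M) (y : L) (hy : Hg Q y)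
    (h1 : θ.1 y = y) (h2 : q.1 y = y) (hc : ∀ h ∈ M, ⁅h, y⁆ = 0) : PP Q θ q (M ⊔ Submodule.span F {y}) where
  st r hr z hz := by
    obtain ⟨a, ha, b, hb, rfl⟩ := Submodule.mem_sup.1 hz
    obtain ⟨t, rfl⟩ := Submodule.mem_span_singleton.1 hb
    obtain ⟨c, hcc⟩ := hy r hr
    rw [map_add, map_smul, hcc]
    exact Submodule.add_mem_sup (hM.st r hr a ha)
      (Submodule.smul_mem _ _ (Submodule.smul_mem _ _ (Submodule.mem_span_singleton_self y)))
  ab x hx z hz := by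
    obtain ⟨a, ha, b, hb, rfl⟩ := Submodule.mem_sup.1 hz
    obtain ⟨t, rfl⟩ := Submodule.mem_span_singleton.1 hb
    obtain ⟨a', ha', b, hb, rfl⟩ := Submodule.mem_sup.1 hx
    obtain ⟨t', rfl⟩ := Submodule.mem_span_singleton.1 hb
    have h3 : ⁅y, a⁆ = 0 := by rw [← lie_skew, hc a ha, neg_zero]
    simp [hM.ab a' ha' a ha, hc a' ha', h3]
  fx z hz := by
    obtain ⟨a, ha, b, hb, rfl⟩ := Submodule.mem_sup.1 hz
    obtain ⟨t, rfl⟩ := Submodule.mem_span_singleton.1 hb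
    rw [map_add, map_smul, h1, map_add, map_smul, h2, (hM.fx a ha).1, (hM.fx a ha).2]
    exact ⟨rfl, rfl⟩

lemma PP.ex (θ q : lieAut F L) (x : L) (hx : Hg Q x) (h1 : θ.1 x = x) (h2 : q.1 x = x) :
    ∃ M, PP Q θ q M ∧ x ∈ M ∧ ∀ y, Hg Q y → θ.1 y = y → q.1 y = y → (∀ h ∈ M, ⁅h, y⁆ = 0) → y ∈ M := by
  have hb : PP Q θ q (⊥ : Submodule F L) := by
    refine ⟨?_, ?_, ?_⟩
    · intro r _ z hz
      rw [Submodule.mem_bot] at hz ⊢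
      rw [hz, map_zero]
    · intro a ha b _
      rw [Submodule.mem_bot] at ha
      rw [ha, zero_lie]
    · intro a ha
      rw [Submodule.mem_bot] at ha
      rw [ha, map_zero, map_zero]; exact ⟨rfl, rfl⟩
  have hs := hb.sup x hx h1 h2 (fun h hh => by rw [Submodule.mem_bot] at hh; rw [hh, zero_lie])
  let S : Set (Submodule F L) := {M | PP Q θ q M ∧ x ∈ M}
  obtain ⟨M, hM, hmax⟩ := (wellFounded_gt (α := Submodule F L)).has_min S
    ⟨_, hs, Submodule.mem_sup_right (Submodule.mem_span_singleton_self x)⟩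
  refine ⟨M, hM.1, hM.2, fun y hy a b c => ?_⟩
  by_contra hyM
  apply hmax (M ⊔ Submodule.span F {y}) ⟨hM.1.sup y hy a b c, Submodule.mem_sup_left hM.2⟩
  refine lt_of_le_of_ne le_sup_left fun h => hyM ?_
  rw [h]
  exact Submodule.mem_sup_right (Submodule.mem_span_singleton_self y)

lemma csa_ex [IsKilling F L] (hQ : IsMaximalFiniteAbelian Q) {θ q : lieAut F L} (hθ : θ ∈ Q) (hq : q ∈ Q)
    (h4 : θ ^ 2 ^ 2 = 1) {m : ℕ} (hm : q ^ 2 ^ m = 1) (x : L) (hx : Hg Q x) (h1 : θ.1 x = x) (h2 : q.1 x = x) :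
    ∃ (M Z : Submodule F L) (H : LieSubalgebra F L), H.IsCartanSubalgebra ∧ (∀ r ∈ Q, ∀ h ∈ H, r.1 h ∈ H) ∧
      x ∈ M ∧ M ≤ Z ∧ (∀ z ∈ Z, z ∈ H) ∧ (∀ z, z ∈ Z ↔ θ.1 z = z ∧ ∀ h ∈ M, ⁅h, z⁆ = 0) ∧
      (∀ y, y ∈ H ↔ ∀ z ∈ Z, ⁅z, y⁆ = 0) ∧ ∀ y ∈ M, q.1 y = y := by
  obtain ⟨M, hM, hxM, hmax⟩ := PP.ex θ q x hx h1 h2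
  let Z : Submodule F L :=
    { carrier := {z | θ.1 z = z ∧ ∀ h ∈ M, ⁅h, z⁆ = 0}
      zero_mem' := ⟨map_zero _, fun h _ => lie_zero h⟩
      add_mem' := fun {a b} ha hb => ⟨by rw [map_add, ha.1, hb.1], fun h hh => by
        rw [lie_add, ha.2 h hh, hb.2 h hh, add_zero]⟩
      smul_mem' := fun c a ha => ⟨by rw [map_smul, ha.1], fun h hh => by
        rw [lie_smul, ha.2 h hh, smul_zero]⟩ }
  have hZ : ∀ z, z ∈ Z ↔ θ.1 z = z ∧ ∀ h ∈ M, ⁅h, z⁆ = 0 := fun z => Iff.rfl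
  have hMZ : M ≤ Z := fun z hz => ⟨(hM.fx z hz).1, fun h hh => hM.ab h hh z hz⟩
  have hZs : ∀ r ∈ Q, ∀ z ∈ Z, r.1 z ∈ Z := fun r hr z hz => by
    refine ⟨by rw [comm_apply hQ hθ hr, hz.1], fun h hh => ?_⟩
    have h3 := hz.2 _ (hM.st r⁻¹ (Q.inv_mem hr) h hh)
    have h5 := congrArg r.1 h3
    rw [r.2, aut_apply_inv, map_zero] at h5
    exact h5
  have hZl : ∀ x ∈ Z, ∀ y ∈ Z, ⁅x, y⁆ ∈ Z := fun a ha b hb => by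
    refine ⟨by rw [θ.2, ha.1, hb.1], fun h hh => ?_⟩
    rw [leibniz_lie, ha.2 h hh, hb.2 h hh, lie_zero, zero_lie, add_zero]
  have hZc : ∀ x ∈ Z, q.1 x = x → ∀ y ∈ Z, ⁅x, y⁆ = 0 := fun a ha haq b hb => by
    refine hb.2 a ?_
    have := hom_ind hQ (Z ⊓ LinearMap.eqLocus (q.1 : L →ₗ[F] L) LinearMap.id) M (fun r hr z hz => ?_)
      (fun z hz hg => hmax z hg hz.1.1 hz.2 hz.1.2)
    · exact this ⟨ha, haq⟩
    · refine ⟨hZs r hr z hz.1, ?_⟩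
      show q.1 (r.1 z) = r.1 z
      have h3 : q.1 z = z := hz.2
      rw [comm_apply hQ hq hr, h3]
  have hZab := lemP hQ Z hZs hZl q hq m hm hZc
  let H : LieSubalgebra F L :=
    { carrier := {y | ∀ z ∈ Z, ⁅z, y⁆ = 0}
      zero_mem' := fun h _ => lie_zero h
      add_mem' := fun {a b} ha hb => fun h hh => by
        rw [lie_add, ha h hh, hb h hh, add_zero]
      smul_mem' := fun c a ha => fun h hh => by
        rw [lie_smul, ha h hh, smul_zero]
      lie_mem' := fun {a b} ha hb => fun h hh => by
        have ha' := ha h hh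
        have hb' := hb h hh
        rw [leibniz_lie, ha', hb', lie_zero, zero_lie, add_zero] }
  have hH : ∀ y, y ∈ H ↔ ∀ z ∈ Z, ⁅z, y⁆ = 0 := fun z => Iff.rfl
  have hZH : ∀ z ∈ Z, z ∈ H := fun z hz y hy => hZab y hy z hz
  have hHs : ∀ r ∈ Q, ∀ z ∈ H, r.1 z ∈ H := fun r hr z hz h hh => by
    have h3 := hz _ (hZs r⁻¹ (Q.inv_mem hr) h hh)
    have h5 := congrArg r.1 h3
    rw [r.2, aut_apply_inv, map_zero] at h5
    exact h5
  have hHab : ∀ x ∈ H, ∀ y ∈ H, ⁅x, y⁆ = 0 := by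
    refine lemP hQ H.toSubmodule hHs (fun a ha b hb => H.lie_mem ha hb) θ hθ 2 h4 (fun a ha haθ b hb => ?_)
    have : a ∈ Z := ⟨haθ, fun h hh => ha h (hMZ hh)⟩
    exact hb a this
  refine ⟨M, Z, H, ⟨?_, ?_⟩, hHs, hxM, hMZ, hZH, hZ, hH, fun y hy => (hM.fx y hy).2⟩
  · have : IsLieAbelian H := ⟨fun a b => Subtype.ext (hHab a a.2 b b.2)⟩
    infer_instance
  · apply le_antisymm
    · intro y hy
      rw [LieSubalgebra.mem_normalizer_iff] at hy
      have h3 : Z ≤ LinearMap.ker (ad F L y : L →ₗ[F] L) := by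
        refine hom_ind hQ Z _ hZs fun z hz hg => ?_
        have h5 : ⁅z, y⁆ = 0 := by
          refine hom_ss hQ z hg 2 y ?_
          rw [pow_two]
          show ⁅z, ⁅z, y⁆⁆ = 0
          refine hHab z (hZH z hz) _ ?_
          rw [← lie_skew]
          exact H.neg_mem (hy z (hZH z hz))
        show ⁅y, z⁆ = 0
        rw [← lie_skew, h5, neg_zero]
      intro z hz
      have h5 : ⁅y, z⁆ = 0 := h3 hz
      rw [← lie_skew, h5, neg_zero]
    · exact LieSubalgebra.le_normalizer H

variable {H : LieSubalgebra F L} {E : V →+ Module.Dual F H}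

lemma w_gen (hE : Fr H E) (r : lieAut F L) (w : V ≃+ V) (hw : Wr H E r w) (hs : ∀ h ∈ H, r.1 h ∈ H) (n : ℕ)
    (hn : 0 < n) (hr : r ^ n = 1) (s : Finset V) (hsv : ∀ v ∈ s, ∃ z : H, r.1 (z : L) = z ∧ E v z ≠ 0) :
    ∃ f : V →+ ℤ, (∀ v, f (w v) = f v) ∧ ∀ v ∈ s, f v ≠ 0 := by
  classical
  let W : AddMonoid.End V := w.toAddMonoidHom
  have hW : ∀ v, W v = w v := fun v => rfl
  have hk : ∀ (k : ℕ) (v : V) (a : H), ∀ b : H, (r ^ k).1 (a : L) = b → E ((W ^ k) v) b = E v a := by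
    intro k
    induction k with
    | zero =>
      intro v a b hab
      have : a = b := Subtype.ext hab
      rw [this]; rfl
    | succ k ih =>
      intro v a b hab
      have hm : (r ^ k).1 (a : L) ∈ H := by
        clear hab ih
        induction k with
        | zero => exact a.2
        | succ k ih =>
          rw [pow_succ']
          exact hs _ ih
      have h1 := ih v a ⟨_, hm⟩ rfl
      rw [← h1, pow_succ']
      refine hw.eq ((W ^ k) v) b ⟨_, hm⟩ ?_
      rw [← hab, pow_succ']; rfl
  have hWn : W ^ n = 1 := by
    ext1 v
    apply hE.inj
    ext a
    rw [hk n v a a (by rw [hr]; rfl)]; rfl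
  let S : AddMonoid.End V := ∑ k ∈ Finset.range n, W ^ k
  have hS : S * W = S := by
    have := geom_sum_mul W n
    rw [hWn, sub_self, mul_sub, mul_one] at this
    exact sub_eq_zero.1 this
  have hS0 : ∀ v ∈ s, S v ≠ 0 := by
    intro v hv h0
    obtain ⟨z, hz, hz0⟩ := hsv v hv
    have h1 : E (S v) z = n * E v z := by
      have : S v = ∑ k ∈ Finset.range n, (W ^ k) v := AddMonoidHom.finsetSum_apply _ _ _
      rw [this, map_sum, LinearMap.sum_apply, Finset.sum_congr rfl (g := fun _ => E v z)]
      · simp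
      · intro k _
        refine hk k v z z ?_
        have := aut_pow r k z 1 (by rw [hz, one_smul])
        rw [this, one_pow, one_smul]
    rw [h0, map_zero] at h1
    exact mul_ne_zero (Nat.cast_ne_zero.2 hn.ne') hz0 h1.symm
  obtain ⟨g, hg⟩ := generic (s.image S) (fun v hv => by
    obtain ⟨u, hu, rfl⟩ := Finset.mem_image.1 hv
    exact hS0 u hu)
  refine ⟨g.comp S, fun v => ?_, fun v hv => hg _ (Finset.mem_image_of_mem _ hv)⟩
  show g (S (w v)) = g (S v)
  conv_rhs => rw [← hS]
  rfl

lemma w_triv (hE : Fr H E) (r : lieAut F L) (w : V ≃+ V) (hw : Wr H E r w) (hs : ∀ h ∈ H, r.1 h ∈ H)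
    (h1 : ∀ v, w v = v) : ∀ h ∈ H, r.1 h = h := by
  intro h hh
  have := hE.sep (⟨r.1 h, hs h hh⟩ - ⟨h, hh⟩) (fun v => by
    rw [map_sub, sub_eq_zero]
    have := hw.eq v ⟨r.1 h, hs h hh⟩ ⟨h, hh⟩ rfl
    rwa [h1] at this)
  rw [sub_eq_zero] at this
  exact congrArg Subtype.val this

lemma four_root {I t : F} (hI : I * I = -1) (ht : t ^ 4 = 1) : ∃ k : ℕ, t = I ^ k := by
  have h : (t - 1) * ((t + 1) * ((t - I) * (t + I))) = 0 := by linear_combination ht + (1 - t ^ 2) * hI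
  rcases mul_eq_zero.1 h with h | h
  · exact ⟨0, by linear_combination h⟩
  rcases mul_eq_zero.1 h with h | h
  · exact ⟨2, by linear_combination h - hI⟩
  rcases mul_eq_zero.1 h with h | h
  · exact ⟨1, by linear_combination h⟩
  · exact ⟨3, by linear_combination h - I * hI⟩

lemma I_pow_one {I : F} (hI : I * I = -1) (k : ℤ) : I ^ k = 1 ↔ (k : ZMod 4) = 0 := by
  have I0 : I ≠ 0 := by rintro rfl; simp at hI
  have hp : IsPrimitiveRoot I 4 := by
    have h2 : I ^ 2 = -1 := by rw [pow_two, hI]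
    have h3 : orderOf I = 2 ^ (1 + 1) := by
      refine orderOf_eq_prime_pow ?_ ?_
      · rw [pow_one, h2]
        intro h
        have : (2 : F) = 0 := by linear_combination -h
        exact two_ne_zero this
      · show I ^ (2 * 2) = 1
        rw [pow_mul, h2]; norm_num
    rw [IsPrimitiveRoot.iff_orderOf, h3]; norm_num
  rw [hp.zpow_eq_one_iff_dvd, ZMod.intCast_zmod_eq_zero_iff_dvd]

lemma char_four {I : F} (hI : I * I = -1) (u : V →+ Additive Fˣ) (hu : ∀ v ∈ Rt, ch u v ^ 4 = 1) :
    ∃ c : V →+ ZMod 4, (∀ v, ch u v = 1 ↔ c v = 0) ∧ ∀ v (k : ℤ), c v = k → ch u v = I ^ k := by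
  have I0 : I ≠ 0 := by rintro rfl; simp at hI
  choose k hk using fun i => four_root hI (hu (sr i) (sr_Rt i))
  let d : V →+ ℤ :=
    { toFun := fun v => ∑ i, v i * (k i : ℤ)
      map_zero' := by simp
      map_add' := fun a b => by
        rw [← Finset.sum_add_distrib]
        exact Finset.sum_congr rfl fun i _ => add_mul (a i) (b i) _ }
  have hd : ∀ v, ch u v = I ^ d v := by
    let ui : V →+ Additive Fˣ := (zmultiplesHom (Additive Fˣ) (Additive.ofMul (Units.mk0 I I0))).comp d
    have hui : ∀ v, ch ui v = I ^ d v := by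
      intro v
      show ((Additive.toMul (d v • Additive.ofMul (Units.mk0 I I0)) : Fˣ) : F) = _
      rw [toMul_zsmul]; simp
    intro v
    rw [← hui]
    have h1 : u v = ui v := by
      rw [hom_sum u, hom_sum ui]
      refine Finset.sum_congr rfl fun i _ => ?_
      congr 1
      apply Additive.toMul.injective
      apply Units.ext
      have h2 := hui (sr i)
      have h3 : d (sr i) = k i := by
        show ∑ j, (sr i) j * (k j : ℤ) = _
        rw [Finset.sum_eq_single i]
        · simp [sr]
        · intro j _ hj
          simp [sr, hj]
        · simp
      rw [h3, zpow_natCast, ← hk i] at h2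
      exact h2.symm
    rw [ch, h1]; rfl
  refine ⟨(Int.castAddHom (ZMod 4)).comp d, fun v => ?_, fun v j hj => ?_⟩
  · rw [hd, I_pow_one hI]; rfl
  · rw [hd]
    have h1 : I ^ (d v - j) = 1 := by
      rw [I_pow_one hI, Int.cast_sub, sub_eq_zero]; exact hj
    rw [zpow_sub₀ I0, div_eq_one_iff_eq (zpow_ne_zero _ I0)] at h1
    exact h1
end
end E8P

set_option linter.unusedSectionVars false
set_option linter.style.haveILetI false

namespace E8P
open LieAlgebra

section
variable {F L : Type*} [Field F] [CharZero F] [IsAlgClosed F] [LieRing L] [LieAlgebra F L]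
  [FiniteDimensional F L] {Q : Subgroup (lieAut F L)}

/-- the output of the main construction -/
structure Good (Q : Subgroup (lieAut F L)) (I : F) (θ q : lieAut F L) (H : LieSubalgebra F L)
    (E : V →+ Module.Dual F H) : Prop where
  fr : Fr H E
  st : ∀ r ∈ Q, ∀ h ∈ H, r.1 h ∈ H
  th : ∀ h ∈ H, θ.1 h = h
  qh : ∀ h ∈ H, q.1 h = h
  ch : ∀ v ∈ Rt, ∀ e ∈ RS H (E v), θ.1 e = I ^ (v 2) • e

open Classical in
lemma csa_thm [IsKilling F L] (hQ : IsMaximalFiniteAbelian Q)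
    (hcsa : ∀ H : LieSubalgebra F L, H.IsCartanSubalgebra → ∃ E, Fr H E)
    {θ q : lieAut F L} (hθ : θ ∈ Q) (hq : q ∈ Q)
    (h4 : θ ^ 2 ^ 2 = 1) (h66 : Module.finrank F (LinearMap.eqLocus (θ.1 : L →ₗ[F] L) LinearMap.id) = 66)
    {m : ℕ} (hm : q ^ 2 ^ m = 1) {I : F} (hI : I * I = -1)
    (x : L) (hx : Hg Q x) (h1 : θ.1 x = x) (h2 : q.1 x = x) :
    ∃ H E, Good Q I θ q H E ∧ x ∈ H := by
  obtain ⟨M, Z, H, hC, hst, hxM, hMZ, hZH, hZ, hH, hqM⟩ := csa_ex hQ hθ hq h4 hm x hx h1 h2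
  obtain ⟨E, hE⟩ := hcsa H hC
  have hthH : ∀ h ∈ H, θ.1 h = h := by
    obtain ⟨w, hw⟩ := wr_ex hE θ (hst θ hθ) (hst _ (Q.inv_mem hθ))
    obtain ⟨f, hf, hf0⟩ := w_gen hE θ w hw (hst θ hθ) (2 ^ 2) (by norm_num) h4 Rt (fun v hv => by
      by_contra hcon
      push Not at hcon
      obtain ⟨e, he, he0⟩ := hE.ex hv
      refine hE.not_mem hv he he0 ((hH e).2 fun z hz => ?_)
      have h3 := (mem_RS H).1 he ⟨z, hZH z hz⟩
      rw [hcon ⟨z, hZH z hz⟩ ((hZ z).1 hz).1, zero_smul] at h3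
      exact h3)
    exact w_triv hE θ w hw (hst θ hθ) (reg_id f hw.rt hw.rt' hf hf0)
  have hHZ : ∀ y ∈ H, y ∈ Z := fun y hy => (hZ y).2 ⟨hthH y hy, fun h hh => (hH y).1 hy h (hMZ hh)⟩
  obtain ⟨u, hu⟩ := aut_char hE θ hthH
  obtain ⟨c, hc, hcI⟩ := char_four hI u (fun v hv => by
    obtain ⟨e, he, he0⟩ := hE.ex hv
    have h3 := aut_pow θ 4 e _ (hu v hv e he)
    have h5 : θ ^ 4 = 1 := h4
    rw [h5] at h3
    have h6 : (1 : F) • e = ch u v ^ 4 • e := by rw [one_smul]; exact h3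
    exact (smul_left_injective F he0 h6).symm)
  have hcount := hE.count (θ.1 : L →ₗ[F] L) (ch u) hthH hu
  rw [h66] at hcount
  have h58 : (Rt.filter fun v => c v = 0).card = 58 := by
    have : (Rt.filter fun v => c v = 0).card = (Rt.filter fun v => ch u v = 1).card :=
      congrArg Finset.card (Finset.filter_congr fun v _ => (hc v).symm)
    omega
  obtain ⟨w, hw⟩ := wr_ex hE q (hst q hq) (hst _ (Q.inv_mem hq))
  obtain ⟨f, hf, hf0⟩ := w_gen hE q w hw (hst q hq) (2 ^ m) (by positivity) hm (Rt.filter fun v => c v = 0)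
    (fun v hv => by
      rw [Finset.mem_filter] at hv
      by_contra hcon
      push Not at hcon
      obtain ⟨e, he, he0⟩ := hE.ex hv.1
      refine hE.not_mem hv.1 he he0 (hZH e ((hZ e).2 ⟨?_, fun z hz => ?_⟩))
      · rw [hu v hv.1 e he, (hc v).2 hv.2, one_smul]
      · have h3 := (mem_RS H).1 he ⟨z, hZH z (hMZ hz)⟩
        rw [hcon ⟨z, hZH z (hMZ hz)⟩ (hqM z hz), zero_smul] at h3
        exact h3)
  have hwc : ∀ v, c (w v) = c v := fun v => by
    rw [← sub_eq_zero, ← map_sub, ← hc, ch_sub, ch_inv hE θ u hu q w hw (hQ.2.1 q θ hq hθ),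
      mul_inv_cancel₀ (ch_ne u v)]
  have h58' : (Rt.filter fun v => c v = 0).card = 58 := h58
  obtain ⟨hid, g, hg, hgc⟩ := sub_id c (by convert h58') w f hw.rt hw.rt' hwc hf
    (fun v hv h => hf0 v (Finset.mem_filter.2 ⟨hv, h⟩))
  refine ⟨H, E.comp g.toAddMonoidHom, ⟨hE.trans g fun v => (hg.rt v).symm, hst, hthH, w_triv hE q w hw (hst q hq) hid,
    fun v hv e he => ?_⟩, hZH x (hMZ hxM)⟩
  rw [hu (g v) ((hg.rt v).2 hv) e he, hcI (g v) (v 2) (hgc v)]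

end
end E8P

set_option linter.unusedSectionVars false
set_option linter.style.haveILetI false

namespace E8P
open LieAlgebra

section
variable {F L : Type*} [Field F] [CharZero F] [IsAlgClosed F] [LieRing L] [LieAlgebra F L]
  [FiniteDimensional F L] {Q : Subgroup (lieAut F L)}
variable {H : LieSubalgebra F L} {E : V →+ Module.Dual F H}

lemma Fr.li (hE : Fr H E) : LinearIndependent F (fun i : Fin 8 => E (sr i)) := by
  apply linearIndependent_of_top_le_span_of_card_eq_finrank
  · rw [← hE.span, Submodule.span_le]
    rintro _ ⟨v, rfl⟩
    have h1 := hom_sum E v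
    show E v ∈ Submodule.span F (Set.range fun i : Fin 8 => E (sr i))
    rw [h1]
    refine Submodule.sum_mem _ fun i _ => ?_
    have hm : E (sr i) ∈ Submodule.span F (Set.range fun i : Fin 8 => E (sr i)) := Submodule.subset_span ⟨i, rfl⟩
    exact zsmul_mem hm _
  · rw [Subspace.dual_finrank_eq, hE.fr8]; rfl

lemma ut_ex {I : F} (hI : I * I = -1) : ∃ ut : V →+ Additive Fˣ, ∀ v, ch ut v = I ^ (v 2) := by
  have I0 : I ≠ 0 := by rintro rfl; simp at hI
  refine ⟨(zmultiplesHom (Additive Fˣ) (Additive.ofMul (Units.mk0 I I0))).comp (Pi.evalAddMonoidHom _ 2), fun v => ?_⟩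
  show ((Additive.toMul (v 2 • Additive.ofMul (Units.mk0 I I0)) : Fˣ) : F) = _
  rw [toMul_zsmul]; simp

variable {I : F} {θ q : lieAut F L}

lemma Good.w2 (hQ : IsMaximalFiniteAbelian Q) (hI : I * I = -1) (hθ : θ ∈ Q) (G : Good Q I θ q H E)
    {r : lieAut F L} (hr : r ∈ Q) {w : V ≃+ V} (hw : Wr H E r w) (v : V) : (w v) 2 % 4 = v 2 % 4 := by
  have I0 : I ≠ 0 := by rintro rfl; simp at hI
  obtain ⟨ut, hut⟩ := ut_ex hI
  have h1 := ch_inv G.fr θ ut (fun v hv e he => by rw [hut]; exact G.ch v hv e he) r w hw (hQ.2.1 r θ hr hθ) v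
  rw [hut, hut] at h1
  have h2 : I ^ ((w v) 2 - v 2) = 1 := by
    rw [zpow_sub₀ I0, h1, div_self (zpow_ne_zero _ I0)]
  rw [I_pow_one hI, ZMod.intCast_zmod_eq_zero_iff_dvd] at h2
  push_cast at h2
  omega

lemma Good.wr (G : Good Q I θ q H E) {r : lieAut F L} (hr : r ∈ Q) : ∃ w, Wr H E r w :=
  wr_ex G.fr r (G.st r hr) (G.st _ (Q.inv_mem hr))

lemma dual_inv (hQ : IsMaximalFiniteAbelian Q) [IsKilling F L] (hst : ∀ r ∈ Q, ∀ h ∈ H, r.1 h ∈ H) (X : Module.Dual F H)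
    (hX : ∀ r, ∀ hr : r ∈ Q, ∀ k : H, X ⟨r.1 k, hst r hr k k.2⟩ = X k) : X = 0 := by
  have := hQ.1
  haveI := Fintype.ofFinite Q
  ext k
  let y : H := ∑ r : Q, ⟨r.1.1 k, hst r.1 r.2 k k.2⟩
  have hy : (y : L) = ∑ r : Q, r.1.1 (k : L) := by
    have := map_sum H.toSubmodule.subtype (fun r : Q => (⟨r.1.1 k, hst r.1 r.2 k k.2⟩ : H)) Finset.univ
    exact this
  have hy0 : (y : L) = 0 := by
    refine fix_zero hQ _ fun r hr => ?_
    rw [hy, map_sum]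
    exact Fintype.sum_equiv (Equiv.mulLeft (⟨r, hr⟩ : Q)) _ _ (fun s => rfl)
  have h0 : y = 0 := Subtype.ext hy0
  have h1 : X y = Fintype.card Q * X k := by
    rw [map_sum, Finset.sum_congr rfl (g := fun _ => X k)]
    · simp
    · intro r _
      exact hX r.1 r.2 k
  rw [h0, map_zero] at h1
  exact (mul_eq_zero.1 h1.symm).resolve_left (Nat.cast_ne_zero.2 Fintype.card_ne_zero)

lemma inv_sum (hQ : IsMaximalFiniteAbelian Q) [IsKilling F L] (hI : I * I = -1) (hθ : θ ∈ Q) (hq : q ∈ Q)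
    (G : Good Q I θ q H E) (u : V →+ Additive Fˣ)
    (hu : ∀ v ∈ Rt, ∀ e ∈ RS H (E v), q.1 e = ch u v • e) (k : ℕ) (z : V) :
    ∑ v ∈ Rt.filter (fun v => v 2 % 4 = 1), ch u v ^ k * (Bf v z : F) = 0 := by
  obtain ⟨s, hs'⟩ : ∃ s, s = Rt.filter (fun v => v 2 % 4 = 1) := ⟨_, rfl⟩
  have hs : ∀ v, v ∈ s ↔ v ∈ Rt ∧ v 2 % 4 = 1 := fun v => by rw [hs']; exact Finset.mem_filter
  rw [← hs']
  let X : Module.Dual F H := ∑ v ∈ s, ch u v ^ k • E v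
  have hX0 : X = 0 := by
    refine dual_inv hQ G.st X fun r hr a => ?_
    obtain ⟨w, hw⟩ := G.wr hr
    have hXa : ∀ b : H, X b = ∑ v ∈ s, ch u v ^ k * E v b := fun b => by
      rw [LinearMap.sum_apply]; rfl
    rw [hXa, hXa]
    symm
    refine Finset.sum_equiv w.toEquiv (fun v => ?_) (fun v hv => ?_)
    · show v ∈ s ↔ w v ∈ s
      rw [hs, hs, Good.w2 hQ hI hθ G hr hw]
      refine and_congr_left fun _ => ⟨hw.rt v, fun h => ?_⟩
      have := hw.rt' _ h
      rwa [w.symm_apply_apply] at this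
    · show ch u v ^ k * E v a = ch u (w v) ^ k * E (w v) _
      rw [ch_inv G.fr q u hu r w hw (hQ.2.1 r q hr hq), hw.eq v _ a rfl]
  have hXs : X = ∑ i, (∑ v ∈ s, ch u v ^ k * (v i : F)) • E (sr i) := by
    have : ∀ v, ch u v ^ k • E v = ∑ i, (ch u v ^ k * (v i : F)) • E (sr i) := by
      intro v
      conv_lhs => rw [hom_sum E v, Finset.smul_sum]
      refine Finset.sum_congr rfl fun i _ => ?_
      rw [mul_smul, Int.cast_smul_eq_zsmul]
    show ∑ v ∈ s, ch u v ^ k • E v = _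
    rw [Finset.sum_congr rfl fun v _ => this v, Finset.sum_comm]
    refine Finset.sum_congr rfl fun i _ => ?_
    rw [Finset.sum_smul]
  have hi := Fintype.linearIndependent_iff.1 G.fr.li _ (hXs.symm.trans hX0)
  have h1 : ∀ v ∈ s, ch u v ^ k * (Bf v z : F) = ∑ i, ch u v ^ k * (v i : F) * (Bf (sr i) z : F) := by
    intro v _
    rw [Bf_expand v z]
    push_cast
    rw [Finset.mul_sum]
    exact Finset.sum_congr rfl fun i _ => by ring
  rw [Finset.sum_congr rfl h1, Finset.sum_comm]
  refine Finset.sum_eq_zero fun i _ => ?_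
  rw [← Finset.sum_mul, hi i, zero_mul]

/-- brackets of an element of `H` with the fixed subalgebra of `θ` -/
lemma Pker (hI : I * I = -1) (G : Good Q I θ q H E) {x : L} (hx : x ∈ H) (W : Submodule F L)
    (hW : ∀ v ∈ Rt, v 2 % 4 = 0 → ∀ b ∈ RS H (E v), ⁅x, b⁆ ∈ W) (y : L) (hy : θ.1 y = y) : ⁅x, y⁆ ∈ W := by
  have I0 : I ≠ 0 := by rintro rfl; simp at hI
  let t : L →ₗ[F] L := (θ.1 : L →ₗ[F] L)
  have ht : ∀ y, t y = θ.1 y := fun _ => rfl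
  let P : L →ₗ[F] L := LinearMap.id + t + t ∘ₗ t + t ∘ₗ t ∘ₗ t
  have hP : ∀ y, P y = y + t y + t (t y) + t (t (t y)) := fun y => rfl
  let A : L →ₗ[F] L := (ad F L x : L →ₗ[F] L) ∘ₗ P
  have hA : ∀ y, A y = ⁅x, P y⁆ := fun y => rfl
  have hall : (⊤ : Submodule F L) ≤ W.comap A := by
    rw [← G.fr.top]
    refine iSup_le fun χ b hb => ?_
    show A b ∈ W
    by_cases h0 : χ = 0
    · rw [h0] at hb
      have hbH := G.fr.RS0.1 hb
      have h1 : t b = b := G.th b hbH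
      rw [hA, hP, h1, h1, h1]
      have h2 : ⁅x, b⁆ = 0 := G.fr.ab x hx b hbH
      simp only [lie_add, h2, add_zero]
      exact W.zero_mem
    by_cases hbot : RS H χ = ⊥
    · rw [hbot, Submodule.mem_bot] at hb
      rw [hb, map_zero]; exact W.zero_mem
    obtain ⟨v, hv, rfl⟩ := G.fr.root χ h0 hbot
    have h1 : t b = I ^ (v 2) • b := G.ch v hv b hb
    rw [hA, hP, h1, map_smul, h1, map_smul, map_smul, h1]
    by_cases hc : v 2 % 4 = 0
    · have hm := hW v hv hc b hb
      simp only [lie_add, lie_smul]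
      exact W.add_mem (W.add_mem (W.add_mem hm (W.smul_mem _ hm)) (W.smul_mem _ (W.smul_mem _ hm)))
        (W.smul_mem _ (W.smul_mem _ (W.smul_mem _ hm)))
    · set j := I ^ (v 2) with hj
      have hj1 : j ≠ 1 := fun h => hc (by
        rw [hj, I_pow_one hI, ZMod.intCast_zmod_eq_zero_iff_dvd] at h
        push_cast at h; omega)
      have hj4 : j ^ 4 = 1 := by
        have I4 : I ^ (4 : ℤ) = 1 := by rw [I_pow_one hI]; decide
        rw [hj, ← zpow_natCast, ← zpow_mul, mul_comm, zpow_mul]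
        push_cast
        rw [I4, one_zpow]
      have hs : 1 + j + j * j + j * (j * j) = 0 := by
        have : (j - 1) * (1 + j + j * j + j * (j * j)) = 0 := by linear_combination hj4
        exact (mul_eq_zero.1 this).resolve_left (sub_ne_zero.2 hj1)
      have : b + j • b + j • j • b + j • j • j • b = 0 := by
        rw [smul_smul, smul_smul]
        have h2 : (1 + j + j * j + j * (j * j)) • b = 0 := by rw [hs, zero_smul]
        rw [add_smul, add_smul, add_smul, one_smul] at h2
        exact h2
      rw [this, lie_zero]; exact W.zero_mem
  have h1 : A y ∈ W := hall (x := y) trivial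
  have h2 : t y = y := hy
  rw [hA, hP, h2, h2, h2] at h1
  have h3 : ⁅x, y + y + y + y⁆ = (4 : F) • ⁅x, y⁆ := by
    simp only [lie_add]
    module
  rw [h3] at h1
  exact (W.smul_mem_iff (by norm_num)).1 h1
end
end E8P

set_option linter.unusedSectionVars false
set_option linter.style.haveILetI false

namespace E8P
open LieAlgebra

section
variable {F L : Type*} [Field F] [CharZero F] [IsAlgClosed F] [LieRing L] [LieAlgebra F L]
  [FiniteDimensional F L] {Q : Subgroup (lieAut F L)}
variable {H : LieSubalgebra F L} {E : V →+ Module.Dual F H} {I : F} {θ q : lieAut F L}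

lemma sr02 : (sr 0 : V) 2 = 0 := by decide

lemma rtL_of {v : V} (h : v ∈ Rt) : v ∈ rtL := (mem_rtL v).2 ((mem_Rt v).1 h)

lemma w_sr0 (hQ : IsMaximalFiniteAbelian Q) (hI : I * I = -1) (hθ : θ ∈ Q) (G : Good Q I θ q H E)
    {r : lieAut F L} (hr : r ∈ Q) {w : V ≃+ V} (hw : Wr H E r w) : w (sr 0) = sr 0 ∨ w (sr 0) = - sr 0 := by
  have h2 := Good.w2 hQ hI hθ G hr hw (sr 0)
  have hz : (w (sr 0)) 2 % 4 = 0 := by rw [h2, sr02]; rfl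
  have key : ∀ u ∈ rtL, u 2 % 4 = 0 → Bf (w (sr 0) + u) (w (sr 0) + u) ≠ 2 := by
    intro u hu hu2 hB
    have huR : u ∈ Rt := (mem_Rt u).2 ((mem_rtL u).1 hu)
    have h3 := Good.w2 hQ hI hθ G hr hw (w.symm u)
    rw [w.apply_symm_apply] at h3
    have h5 := hw.rt' _ ((mem_Rt _).2 hB)
    rw [map_add, w.symm_apply_apply, add_comm] at h5
    exact (a1_orth (w.symm u) (rtL_of (hw.rt' u huR)) (by omega)).1 ((mem_Rt _).1 h5)
  rcases a1_check (w (sr 0)) (rtL_of (hw.rt _ (sr_Rt 0))) hz key with h | h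
  · exact Or.inl (funext h)
  · exact Or.inr (funext h)

/-- the first pass: data attached to the `A₁` factor -/
lemma first_pass [IsKilling F L] (hQ : IsMaximalFiniteAbelian Q) (hI : I * I = -1) (hθ : θ ∈ Q)
    (G : Good Q I θ q H E) :
    ∃ x e f : L, x ∈ H ∧ ⁅e, f⁆ = x ∧ ⁅x, e⁆ = (2 : F) • e ∧ ⁅x, f⁆ = (-2 : F) • f ∧ e ≠ 0 ∧ f ≠ 0 ∧ x ≠ 0 ∧
      θ.1 e = e ∧
      (∀ y, θ.1 y = y → ⁅x, y⁆ ∈ Submodule.span F {e, f}) ∧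
      ∀ r ∈ Q, (r.1 x = x ∧ (∃ a : F, r.1 e = a • e) ∧ ∃ b : F, r.1 f = b • f) ∨
        (r.1 x = -x ∧ ∃ a : F, r.1 e = a • f) := by
  obtain ⟨e, he, f, hf, x, hxe, hx2⟩ := G.fr.sl2 (sr 0) (sr_Rt 0)
  have hx0 : (x : L) ≠ 0 := fun h => by
    have : x = 0 := Subtype.ext h
    rw [this, map_zero] at hx2
    exact two_ne_zero hx2.symm
  have he0 : e ≠ 0 := by
    rintro rfl
    rw [zero_lie] at hxe; exact hx0 hxe
  have hf0 : f ≠ 0 := by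
    rintro rfl
    rw [lie_zero] at hxe; exact hx0 hxe
  have hnx : E (-sr 0) x = -2 := by rw [map_neg, LinearMap.neg_apply, hx2]
  refine ⟨x, e, f, x.2, hxe.symm, ?_, ?_, he0, hf0, hx0, ?_, ?_, ?_⟩
  · rw [(mem_RS H).1 he x, hx2]
  · rw [(mem_RS H).1 hf x, hnx]
  · rw [G.ch _ (sr_Rt 0) e he, sr02, zpow_zero, one_smul]
  · intro y hy
    refine Pker hI G x.2 _ (fun v hv hv2 b hb => ?_) y hy
    by_cases h1 : v = sr 0
    · rw [h1] at hb
      obtain ⟨c, rfl⟩ := G.fr.mem (sr_Rt 0) he he0 hb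
      rw [lie_smul, (mem_RS H).1 he x]
      exact Submodule.smul_mem _ _ (Submodule.smul_mem _ _ (Submodule.subset_span (by simp)))
    by_cases h2 : v = - sr 0
    · rw [h2] at hb
      obtain ⟨c, rfl⟩ := G.fr.mem (neg_Rt (sr_Rt 0)) hf hf0 hb
      rw [lie_smul, (mem_RS H).1 hf x]
      exact Submodule.smul_mem _ _ (Submodule.smul_mem _ _ (Submodule.subset_span (by simp)))
    have ho := a1_orth v (rtL_of hv) hv2
    have h3 : ⁅e, b⁆ = 0 := by
      have := lie_RS H he hb
      rw [← map_add] at this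
      refine G.fr.bot (fun h => h2 ?_) (fun h => ho.1 ?_) this
      · exact (neg_eq_of_add_eq_zero_right h).symm
      · rw [add_comm]; exact (mem_Rt _).1 h
    have h4 : ⁅f, b⁆ = 0 := by
      have := lie_RS H hf hb
      rw [← map_add] at this
      refine G.fr.bot (fun h => h1 ?_) (fun h => ho.2 ?_) this
      · exact (neg_add_eq_zero.1 h).symm
      · rw [sub_eq_neg_add]; exact (mem_Rt _).1 h
    rw [hxe, lie_lie, h3, h4, lie_zero, lie_zero, sub_zero]
    exact Submodule.zero_mem _
  · intro r hr
    obtain ⟨w, hw⟩ := G.wr hr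
    have hre := hw.mem _ e he
    have hrf := hw.mem _ f hf
    have hrx := hw.eq (sr 0) ⟨r.1 x, G.st r hr x x.2⟩ x rfl
    have hlie : r.1 x = ⁅r.1 e, r.1 f⁆ := by rw [hxe, r.2]
    have aux : ∀ t : F, r.1 x = t • (x : L) → E (w (sr 0)) x * t = 2 := by
      intro t ht
      have : (⟨r.1 x, G.st r hr x x.2⟩ : H) = t • x := Subtype.ext ht
      rw [this, map_smul, hx2, smul_eq_mul, mul_comm] at hrx
      exact hrx
    rcases w_sr0 hQ hI hθ G hr hw with h | h
    · left
      rw [map_neg, h] at hrf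
      rw [h] at hre aux
      obtain ⟨a, ha⟩ := G.fr.mem (sr_Rt 0) he he0 hre
      obtain ⟨b, hb⟩ := G.fr.mem (neg_Rt (sr_Rt 0)) hf hf0 hrf
      refine ⟨?_, ⟨a, ha⟩, b, hb⟩
      rw [ha, hb, smul_lie, lie_smul, smul_smul, ← hxe] at hlie
      have h1 := aux _ hlie
      rw [hx2] at h1
      have : a * b = 1 := by linear_combination h1 / 2
      rw [hlie, this, one_smul]
    · right
      rw [map_neg, h, neg_neg] at hrf
      rw [h] at hre aux
      obtain ⟨a, ha⟩ := G.fr.mem (neg_Rt (sr_Rt 0)) hf hf0 hre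
      obtain ⟨b, hb⟩ := G.fr.mem (sr_Rt 0) he he0 hrf
      refine ⟨?_, a, ha⟩
      rw [ha, hb, smul_lie, lie_smul, smul_smul, ← lie_skew, ← hxe, smul_neg, ← neg_smul] at hlie
      have h1 := aux _ hlie
      rw [hnx] at h1
      have : -(a * b) = -1 := by linear_combination - h1 / 2
      rw [hlie, this, neg_one_smul]

/-- choice of the second automorphism -/
lemma choose_q [IsKilling F L] (hQ : IsMaximalFiniteAbelian Q) (hI : I * I = -1) (hθ : θ ∈ Q)
    (G : Good Q I θ q H E) :
    ∃ (s : lieAut F L) (m : ℕ) (x e f : L), s ∈ Q ∧ s ^ 2 ^ m = 1 ∧ Hg Q x ∧ θ.1 x = x ∧ s.1 x = x ∧ e ≠ 0 ∧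
      θ.1 e = e ∧ ⁅x, e⁆ = (2 : F) • e ∧
      (∀ y, θ.1 y = y → ⁅x, y⁆ ∈ Submodule.span F {e, f}) ∧
      (∀ y ∈ Submodule.span F {e, f}, s.1 y = -y) := by
  obtain ⟨x, e, f, hxH, hef, hxe, hxf, he0, hf0, hx0, hθe, hsp, hr⟩ := first_pass hQ hI hθ G
  have hg : Hg Q x := fun r hrQ => by
    rcases hr r hrQ with h | h
    · exact ⟨1, by rw [h.1, one_smul]⟩
    · exact ⟨-1, by rw [h.1, neg_one_smul]⟩
  have hxn : -x ≠ x := fun h => by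
    have : (2 : F) • x = 0 := by
      rw [two_smul]
      nth_rewrite 1 [← h]
      exact neg_add_cancel x
    exact hx0 ((smul_eq_zero.1 this).resolve_left two_ne_zero)
  obtain ⟨r0, hr0, hr0x⟩ : ∃ r ∈ Q, r.1 x = -x := by
    by_contra hcon
    push Not at hcon
    refine hx0 (fix_zero hQ x fun r hrQ => ?_)
    rcases hr r hrQ with h | h
    · exact h.1
    · exact absurd h.1 (hcon r hrQ)
  obtain ⟨b0, hb0⟩ : ∃ b : F, r0.1 e = b • f := by
    rcases hr r0 hr0 with h | h
    · exact absurd (hr0x.symm.trans h.1) hxn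
    · exact h.2
  have hb00 : b0 ≠ 0 := by
    rintro rfl
    rw [zero_smul] at hb0
    exact he0 ((map_eq_zero_iff _ r0.1.injective).1 hb0)
  have hpm : ∀ r ∈ Q, r.1 x = x → (r.1 e = e ∧ r.1 f = f) ∨ (r.1 e = -e ∧ r.1 f = -f) := by
    intro r hrQ hrx
    rcases hr r hrQ with h | h
    · obtain ⟨-, ⟨a, ha⟩, b, hb⟩ := h
      have h1 : a * b = 1 := by
        have h2 : r.1 ⁅e, f⁆ = ⁅e, f⁆ := by rw [hef, hrx]
        rw [r.2, ha, hb, smul_lie, lie_smul, smul_smul, hef] at h2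
        apply smul_left_injective F hx0
        beta_reduce
        rw [h2, one_smul]
      have h2 : b = a := by
        have h3 := comm_apply hQ hrQ hr0 e
        rw [hb0, ha, map_smul, map_smul, hb0, hb, smul_smul, smul_smul] at h3
        have h4 := smul_left_injective F hf0 h3
        beta_reduce at h4
        exact mul_left_cancel₀ hb00 (by rw [h4, mul_comm])
      rw [h2] at h1
      rcases mul_self_eq_one_iff.1 h1 with h5 | h5
      · left; rw [ha, hb, h2, h5, one_smul, one_smul]; exact ⟨rfl, rfl⟩
      · right; rw [ha, hb, h2, h5, neg_one_smul, neg_one_smul]; exact ⟨rfl, rfl⟩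
    · exact absurd (h.1.symm.trans hrx) hxn
  obtain ⟨s, hs, hsx, hse, hsf⟩ : ∃ s ∈ Q, s.1 x = x ∧ s.1 e = -e ∧ s.1 f = -f := by
    by_contra hcon
    push Not at hcon
    have hfix : ∀ r ∈ Q, r.1 x = x → r.1 e = e := fun r hrQ hrx => by
      rcases hpm r hrQ hrx with h | h
      · exact h.1
      · exact absurd h.2 (hcon r hrQ hrx h.1)
    have h00 : r0.1 (r0.1 e) = e := hfix (r0 * r0) (Q.mul_mem hr0 hr0) (by
      show r0.1 (r0.1 x) = x
      rw [hr0x, map_neg, hr0x, neg_neg])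
    have hy : e + r0.1 e = 0 := by
      refine fix_zero hQ _ fun r hrQ => ?_
      rw [map_add, comm_apply hQ hrQ hr0]
      rcases hr r hrQ with h | h
      · rw [hfix r hrQ h.1]
      · have h1 : r0.1 (r.1 e) = e := hfix (r0 * r) (Q.mul_mem hr0 hrQ) (by
          show r0.1 (r.1 x) = x
          rw [h.1, map_neg, hr0x, neg_neg])
        have h2 : r.1 e = r0.1 e := r0.1.injective (by rw [h1, h00])
        rw [h1, h2, add_comm]
    rw [hb0] at hy
    have h1 : ⁅x, e + b0 • f⁆ = 0 := by rw [hy, lie_zero]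
    rw [lie_add, lie_smul, hxe, hxf] at h1
    have h2 : (4 : F) • e = 0 := by
      have h3 : (4 : F) • e = ((2 : F) • e + b0 • (-2 : F) • f) + (2 : F) • (e + b0 • f) := by module
      rw [h3, h1, hy, smul_zero, add_zero]
    exact he0 ((smul_eq_zero.1 h2).resolve_left (by norm_num))
  obtain ⟨hN, hpow⟩ := pow_card hQ
  obtain ⟨m, k, hk, hNk⟩ := Nat.exists_eq_two_pow_mul_odd hN.ne'
  refine ⟨s ^ k, m, x, e, f, Q.pow_mem hs k, ?_, hg, G.th x hxH, ?_, he0, hθe, hxe, hsp, ?_⟩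
  · rw [← pow_mul, mul_comm, ← hNk]; exact hpow s hs
  · have := aut_pow s k x 1 (by rw [hsx, one_smul])
    rw [this, one_pow, one_smul]
  · have h1 := aut_pow s k e (-1) (by rw [hse, neg_one_smul])
    have h2 := aut_pow s k f (-1) (by rw [hsf, neg_one_smul])
    rw [hk.neg_one_pow, neg_one_smul] at h1 h2
    intro y hy
    obtain ⟨a, b, rfl⟩ := Submodule.mem_span_pair.1 hy
    rw [map_add, map_smul, map_smul, h1, h2]
    module

/-- the second pass -/
lemma second_pass (hI : I * I = -1) (G : Good Q I θ q H E) {x e f : L} (hx : x ∈ H) (he0 : e ≠ 0)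
    (hθe : θ.1 e = e) (hxe : ⁅x, e⁆ = (2 : F) • e)
    (hsp : ∀ y, θ.1 y = y → ⁅x, y⁆ ∈ Submodule.span F {e, f})
    (hq : ∀ y ∈ Submodule.span F {e, f}, q.1 y = -y) (u : V →+ Additive Fˣ)
    (hu : ∀ v ∈ Rt, ∀ e ∈ RS H (E v), q.1 e = ch u v • e) : ch u (sr 0) = -1 := by
  classical
  let x' : H := ⟨x, hx⟩
  have hfix : ∀ v ∈ Rt, v 2 % 4 = 0 → ∀ b ∈ RS H (E v), θ.1 b = b := by
    intro v hv hv2 b hb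
    rw [G.ch v hv b hb, (I_pow_one hI (v 2)).2 ?_, one_smul]
    rw [ZMod.intCast_zmod_eq_zero_iff_dvd]; push_cast; omega
  have key : ∀ v ∈ Rt, v 2 % 4 = 0 → E v x' ≠ 0 → ∀ b ∈ RS H (E v), b ∈ Submodule.span F {e, f} := by
    intro v hv hv2 h b hb
    have h1 := hsp b (hfix v hv hv2 b hb)
    have h2 : ⁅x, b⁆ = E v x' • b := (mem_RS H).1 hb x'
    rw [h2] at h1
    exact (Submodule.smul_mem_iff _ h).1 h1
  by_cases h0 : E (sr 0) x' = 0
  · exfalso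
    obtain ⟨v, hv, hv2, hvx⟩ : ∃ v ∈ Rt, v 2 % 4 = 0 ∧ E v x' ≠ 0 := by
      by_contra hcon
      push Not at hcon
      have := Pker hI G hx ⊥ (fun v hv hv2 b hb => by
        rw [Submodule.mem_bot]
        have h2 : ⁅x, b⁆ = E v x' • b := (mem_RS H).1 hb x'
        rw [h2, hcon v hv hv2, zero_smul]) e hθe
      rw [Submodule.mem_bot, hxe] at this
      exact he0 ((smul_eq_zero.1 this).resolve_left two_ne_zero)
    rcases a7_split v (rtL_of hv) hv2 with h | h | ⟨p, hp, hp2, hpB, ⟨j1, hj1⟩, j2, hj2⟩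
    · rw [show v = sr 0 from funext h] at hvx; exact hvx h0
    · rw [show v = - sr 0 from funext h, map_neg, LinearMap.neg_apply, h0, neg_zero] at hvx; exact hvx rfl
    have hpR : p ∈ Rt := (mem_Rt p).2 ((mem_rtL p).1 hp)
    have hd : v - p ∈ Rt := (mem_Rt _).2 hpB
    obtain ⟨z, hz, hz2, hzx, hzv, hznv⟩ : ∃ z ∈ Rt, z 2 % 4 = 0 ∧ E z x' ≠ 0 ∧ z ≠ v ∧ z ≠ -v := by
      by_cases hpx : E p x' = 0
      · refine ⟨v - p, hd, ?_, ?_, ?_, ?_⟩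
        · rw [Pi.sub_apply]; omega
        · rw [map_sub, LinearMap.sub_apply, hpx, sub_zero]; exact hvx
        · intro h
          exact rt_ne hpR (sub_eq_self.1 h)
        · intro h
          apply hj2
          have := congrFun h j2
          rw [Pi.sub_apply, Pi.neg_apply] at this
          omega
      · refine ⟨p, hpR, hp2, hpx, ?_, ?_⟩
        · rintro rfl
          exact rt_ne hd (sub_self _)
        · intro h
          exact hj1 (congrFun h j1)
    obtain ⟨b1, hb1, hb10⟩ := G.fr.ex hv
    obtain ⟨b2, hb2, hb20⟩ := G.fr.ex (neg_Rt hv)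
    obtain ⟨b3, hb3, hb30⟩ := G.fr.ex hz
    have m1 := key v hv hv2 hvx b1 hb1
    have m2 := key (-v) (neg_Rt hv) (by rw [Pi.neg_apply]; omega)
      (by rw [map_neg, LinearMap.neg_apply]; exact neg_ne_zero.2 hvx) b2 hb2
    have m3 := key z hz hz2 hzx b3 hb3
    have hvn : v ≠ -v := by
      intro h
      apply rt_ne hv
      funext i
      have := congrFun h i
      rw [Pi.neg_apply] at this
      show v i = 0
      omega
    let ι : Fin 3 → V := ![v, -v, z]
    let bb : Fin 3 → L := ![b1, b2, b3]
    have hinj : Function.Injective (fun i => E (ι i)) := by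
      intro i j hij
      have hij' : ι i = ι j := G.fr.inj hij
      clear hij
      fin_cases i <;> fin_cases j
      · rfl
      · exact absurd hij' hvn
      · exact absurd hij'.symm hzv
      · exact absurd hij'.symm hvn
      · rfl
      · exact absurd hij'.symm hznv
      · exact absurd hij' hzv
      · exact absurd hij' hznv
      · rfl
    have hli : LinearIndependent F bb := by
      refine ((RS_indep H G.fr.ab).comp hinj).linearIndependent _ (v := bb) ?_ ?_
      · intro i
        fin_cases i
        · exact hb1
        · exact hb2
        · exact hb3
      · intro i
        fin_cases i
        · exact hb10
        · exact hb20
        · exact hb30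
    have h3 := finrank_span_eq_card hli
    have hle : Submodule.span F (Set.range bb) ≤ Submodule.span F {e, f} := by
      rw [Submodule.span_le]
      rintro _ ⟨i, rfl⟩
      fin_cases i
      · exact m1
      · exact m2
      · exact m3
    have h4 := Submodule.finrank_mono hle
    have h5 := finrank_span_finset_le_card (R := F) ({e, f} : Finset L)
    have h6 : ({e, f} : Finset L).card ≤ 2 := Finset.card_le_two
    rw [Finset.coe_pair] at h5
    rw [h3, Fintype.card_fin] at h4
    have h7 : Module.finrank F (Submodule.span F {e, f}) ≤ ({e, f} : Finset L).card := h5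
    omega
  · obtain ⟨b, hb, hb0⟩ := G.fr.ex (sr_Rt 0)
    have h1 := hq b (key _ (sr_Rt 0) (by rw [sr02]; rfl) h0 b hb)
    rw [hu _ (sr_Rt 0) b hb, ← neg_one_smul F b] at h1
    exact smul_left_injective F hb0 h1
end
end E8P

set_option linter.unusedSectionVars false
set_option linter.style.haveILetI false

namespace E8P
open LieAlgebra

section
variable {F L : Type*} [Field F] [CharZero F] [IsAlgClosed F] [LieRing L] [LieAlgebra F L]
  [FiniteDimensional F L] {Q : Subgroup (lieAut F L)}
variable {H : LieSubalgebra F L} {E : V →+ Module.Dual F H} {I : F} {θ q : lieAut F L}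

lemma ch_nsmul (n : ℕ) (u : V →+ Additive Fˣ) (v : V) : ch (n • u) v = ch u v ^ n := by
  simp [ch]

lemma ch_add' (u u' : V →+ Additive Fˣ) (v : V) : ch (u + u') v = ch u v * ch u' v := by
  simp [ch]

lemma ch_pow_ext (n : ℕ) (u : V →+ Additive Fˣ) (h : ∀ v ∈ Rt, ch u v ^ n = 1) (v : V) : ch u v ^ n = 1 := by
  have h0 : ∀ v, ch (0 : V →+ Additive Fˣ) v = 1 := fun v => by simp [ch]
  have := ch_ext (u := n • u) (u' := 0) (fun v hv => by rw [ch_nsmul, h v hv, h0]) v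
  rwa [ch_nsmul, h0] at this

lemma pow_fix (hE : Fr H E) (φ : lieAut F L) (h0 : ∀ h ∈ H, φ.1 h = h) (u : V →+ Additive Fˣ)
    (hu : ∀ v ∈ Rt, ∀ e ∈ RS H (E v), φ.1 e = ch u v • e) (n : ℕ) : φ ^ n = 1 ↔ ∀ v, ch u v ^ n = 1 := by
  constructor
  · intro h
    refine ch_pow_ext n u fun v hv => ?_
    obtain ⟨e, he, he0⟩ := hE.ex hv
    have h3 := aut_pow φ n e _ (hu v hv e he)
    rw [h] at h3
    have h6 : (1 : F) • e = ch u v ^ n • e := by rw [one_smul]; exact h3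
    exact (smul_left_injective F he0 h6).symm
  · intro h
    have hall : (⊤ : Submodule F L) ≤ LinearMap.eqLocus ((φ ^ n).1 : L →ₗ[F] L) LinearMap.id := by
      rw [← hE.top]
      refine iSup_le fun χ b hb => ?_
      show (φ ^ n).1 b = b
      by_cases hχ : χ = 0
      · rw [hχ] at hb
        have := aut_pow φ n b 1 (by rw [h0 b (hE.RS0.1 hb), one_smul])
        rw [this, one_pow, one_smul]
      by_cases hbot : RS H χ = ⊥
      · rw [hbot, Submodule.mem_bot] at hb
        rw [hb, map_zero]
      obtain ⟨v, hv, rfl⟩ := hE.root χ hχ hbot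
      rw [aut_pow φ n b _ (hu v hv b hb), h, one_smul]
    exact aut_ext _ _ fun x => hall (x := x) trivial

lemma order_four (hE : Fr H E) (φ : lieAut F L) (h0 : ∀ h ∈ H, φ.1 h = h) (u : V →+ Additive Fˣ)
    (hu : ∀ v ∈ Rt, ∀ e ∈ RS H (E v), φ.1 e = ch u v • e) (h4 : ∀ v, ch u v ^ 4 = 1) (h2 : ∃ v, ch u v ^ 2 ≠ 1) :
    orderOf φ = 4 := by
  have : orderOf φ = 2 ^ (1 + 1) := by
    refine orderOf_eq_prime_pow ?_ ?_
    · rw [pow_one, pow_fix hE φ h0 u hu]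
      push Not
      exact h2
    · exact (pow_fix hE φ h0 u hu 4).2 h4
  rw [this]; norm_num

lemma fix_fin (φ : lieAut F L) :
    Module.finrank F (fixedSubalgebra φ) = Module.finrank F (LinearMap.eqLocus (φ.1 : L →ₗ[F] L) LinearMap.id) := by
  have : (fixedSubalgebra φ).toSubmodule = LinearMap.eqLocus (φ.1 : L →ₗ[F] L) LinearMap.id := by
    ext x; rfl
  rw [← this]; rfl

lemma main_thm [IsKilling F L] (hQ : IsMaximalFiniteAbelian Q)
    (hcsa : ∀ H : LieSubalgebra F L, H.IsCartanSubalgebra → ∃ E, Fr H E)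
    (hθ : θ ∈ Q) (h4 : orderOf θ = 4) (h66 : Module.finrank F (fixedSubalgebra θ) = 66) :
    ∃ φ ∈ Q, orderOf φ = 4 ∧ Module.finrank F (fixedSubalgebra φ) = 60 := by
  classical
  rw [fix_fin] at h66
  have h44 : θ ^ 2 ^ 2 = 1 := by
    have := pow_orderOf_eq_one θ
    rw [h4] at this; exact this
  obtain ⟨I, hI'⟩ := IsAlgClosed.exists_pow_nat_eq (-1 : F) (n := 2) (by norm_num)
  have hI : I * I = -1 := by rw [← pow_two, hI']
  obtain ⟨H, E, G, -⟩ := csa_thm hQ hcsa hθ hθ h44 h66 h44 hI 0 (fun r _ => ⟨1, by rw [map_zero, smul_zero]⟩)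
    (map_zero _) (map_zero _)
  obtain ⟨q, m, x, e, f, hq, hm, hg, hθx, hqx, he0, hθe, hxe, hsp, hqsp⟩ := choose_q hQ hI hθ G
  clear G E H
  obtain ⟨H, E, G, hx⟩ := csa_thm hQ hcsa hθ hq h44 h66 hm hI x hg hθx hqx
  obtain ⟨u, hu⟩ := aut_char G.fr q G.qh
  have h0 := second_pass hI G hx he0 hθe hxe hsp hqsp u hu
  obtain ⟨ut, hut⟩ := ut_ex hI
  obtain ⟨hN, hpow⟩ := pow_card hQ
  obtain ⟨u', hu', h52, hp4, hp2⟩ := numbers u ut (Nat.card Q) hN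
    ((pow_fix G.fr q G.qh u hu _).1 (hpow q hq)) I hI h0
    (fun w => (Finset.sum_congr rfl fun v _ => by rw [pow_one]).trans (inv_sum hQ hI hθ hq G u hu 1 w))
    (fun w => inv_sum hQ hI hθ hq G u hu 2 w) hut
  obtain ⟨φ, hφ, hφH, hφu⟩ : ∃ φ ∈ Q, (∀ h ∈ H, φ.1 h = h) ∧
      ∀ v ∈ Rt, ∀ e ∈ RS H (E v), φ.1 e = ch u' v • e := by
    rcases hu' with rfl | rfl
    · exact ⟨q, hq, G.qh, hu⟩
    · refine ⟨q * θ, Q.mul_mem hq hθ, fun h hh => ?_, fun v hv e he => ?_⟩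
      · show q.1 (θ.1 h) = h
        rw [G.th h hh, G.qh h hh]
      · show q.1 (θ.1 e) = _
        rw [G.ch v hv e he, map_smul, hu v hv e he, smul_smul, ← hut]
        rw [ch_add', mul_comm]
  refine ⟨φ, hφ, order_four G.fr φ hφH u' hφu hp4 hp2, ?_⟩
  rw [fix_fin]
  have hcount := G.fr.count (φ.1 : L →ₗ[F] L) (ch u') hφH hφu
  have h52' : (Rt.filter fun v => ch u' v = 1).card = 52 := by convert h52
  rw [hcount]
  convert congrArg (fun n => 8 + n) h52'
end

end E8P

theorem stmt9 (F : Type) [Field F] [IsAlgClosed F] [CharZero F]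
    (Q : Subgroup ↥(lieAut F (LieAlgebra.e₈ F)))
    (hQ : IsMaximalFiniteAbelian Q)
    (h : ∃ θ ∈ Q, orderOf θ = 4 ∧ Module.finrank F ↥(fixedSubalgebra θ) = 66) :
    ∃ φ ∈ Q, orderOf φ = 4 ∧ Module.finrank F ↥(fixedSubalgebra φ) = 60 := by
  obtain ⟨θ, hθ, h4, h66⟩ := h
  have hnt : Nontrivial (LieAlgebra.e₈ F) := by
    by_contra hcon
    rw [not_nontrivial_iff_subsingleton] at hcon
    have : Module.finrank F ↥(fixedSubalgebra θ) = 0 := Module.finrank_zero_of_subsingleton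
    omega
  obtain ⟨hfd, hk, hB⟩ := E8P.e8_all F
  exact E8P.main_thm hQ (fun H hH => by
    obtain ⟨B, hB⟩ := hB H hH
    exact E8P.fr_of_csa H B hB) hθ h4 h66
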